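/- Let Ω ⊂ ℝ^N be a bounded domain of class C² and let g ∈ C(ℝ) be odd, continuous and monotone increasing with g(0) = 0. If μ ∈ 𝔐_ρ(Ω) and the total variation measure |μ| is g-good, then μ is g-good. -/

import Mathlib

open MeasureTheory Metric Set Filter Topology ENNReal

noncomputable section

abbrev Euc (N : ℕ) := EuclideanSpace ℝ (Fin N)

variable {N : ℕ}

/-- Distance to the boundary of `Ω`. -/
def rho (Ω : Set (Euc N)) (x : Euc N) : ℝ := Metric.infDist x (frontier Ω)

/-- A bounded domain of class `C²`: open, connected, bounded, and near every boundary
point `Ω` coincides with the sublevel set of a `C²` function with nonvanishing derivative. -/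
def IsBoundedC2Domain (Ω : Set (Euc N)) : Prop :=
  IsOpen Ω ∧ IsConnected Ω ∧ Bornology.IsBounded Ω ∧
  ∀ x ∈ frontier Ω, ∃ f : Euc N → ℝ, ∃ U : Set (Euc N),
    U ∈ nhds x ∧ ContDiffOn ℝ 2 f U ∧ (∀ y ∈ U, fderiv ℝ f y ≠ 0) ∧
    Ω ∩ U = {y ∈ U | f y < 0}

/-- The Laplacian, as the trace of the second derivative. -/
def lap (φ : Euc N → ℝ) (x : Euc N) : ℝ :=
  ∑ i : Fin N,
    iteratedFDeriv ℝ 2 φ x ![EuclideanSpace.single i 1, EuclideanSpace.single i 1]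

/-- Test functions of class `C²(Ω̄)` vanishing on `∂Ω`. -/
def TestFun (Ω : Set (Euc N)) (φ : Euc N → ℝ) : Prop :=
  ContDiff ℝ 2 φ ∧ ∀ x ∈ frontier Ω, φ x = 0

/-- Smooth functions compactly supported in the open set `Ω`. -/
def CcInf (Ω : Set (Euc N)) (φ : Euc N → ℝ) : Prop :=
  ContDiff ℝ (⊤ : ℕ∞) φ ∧ HasCompactSupport φ ∧ tsupport φ ⊆ Ω

/-- A positive Borel measure on `Ω` with `∫_Ω ρ dμ < ∞`. -/
def MemMrho (Ω : Set (Euc N)) (μ : Measure (Euc N)) : Prop :=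
  μ Ωᶜ = 0 ∧ ∫⁻ x, ENNReal.ofReal (rho Ω x) ∂μ < ⊤

/-- A (signed) measure in `𝔐_ρ(Ω)`, given by its Jordan decomposition:
a mutually singular pair of positive measures, each carried by `Ω` and
with finite `ρ`-integral.  The total variation is `pos + neg`. -/
structure SignedRho (Ω : Set (Euc N)) where
  pos : Measure (Euc N)
  neg : Measure (Euc N)
  singular : MeasureTheory.Measure.MutuallySingular pos neg
  pos_mem : MemMrho Ω pos
  neg_mem : MemMrho Ω neg

/-- `u` is a weak solution of `-Δu + g∘u = μ` in `Ω`, `u = 0` on `∂Ω`,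
for the signed measure `μ = μp - μn`. -/
def IsWeakSol (Ω : Set (Euc N)) (g : ℝ → ℝ) (μp μn : Measure (Euc N))
    (u : Euc N → ℝ) : Prop :=
  IntegrableOn u Ω volume ∧
  IntegrableOn (fun x => g |u x| * rho Ω x) Ω volume ∧
  ∀ φ : Euc N → ℝ, TestFun Ω φ →
    Integrable φ μp ∧ Integrable φ μn ∧
    ∫ x in Ω, (-(u x) * lap φ x + g (u x) * φ x) =
      (∫ x, φ x ∂μp) - ∫ x, φ x ∂μn

/-- `w = 𝔾_μ` is the Green potential of the (signed) measure `μ = μp - μn`. -/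
def IsGreenPot (Ω : Set (Euc N)) (μp μn : Measure (Euc N)) (w : Euc N → ℝ) : Prop :=
  IntegrableOn w Ω volume ∧
  ∀ φ : Euc N → ℝ, TestFun Ω φ →
    Integrable φ μp ∧ Integrable φ μn ∧
    ∫ x in Ω, w x * (-(lap φ x)) = (∫ x, φ x ∂μp) - ∫ x, φ x ∂μn

/-- Membership in the Orlicz space `L^h(S)`. -/
def MemOrlicz (h : ℝ → ℝ) (S : Set (Euc N)) (f : Euc N → ℝ) : Prop :=
  AEStronglyMeasurable f (volume.restrict S) ∧
  ∃ k : ℝ, 0 < k ∧ ∫⁻ x in S, ENNReal.ofReal (h (f x / k)) ∂volume ≤ 1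

/-- Membership in `L^h_loc(Ω)`. -/
def MemOrliczLoc (h : ℝ → ℝ) (Ω : Set (Euc N)) (f : Euc N → ℝ) : Prop :=
  ∀ K : Set (Euc N), IsCompact K → K ⊆ Ω → MemOrlicz h K f

/-- The Luxemburg norm on `L^h(S)`, valued in `ℝ≥0∞` (`∞` if no admissible constant). -/
def orliczNorm (h : ℝ → ℝ) (S : Set (Euc N)) (f : Euc N → ℝ) : ℝ≥0∞ :=
  sInf ((fun r : ℝ => ENNReal.ofReal r) ''
    {r : ℝ | 0 < r ∧ ∫⁻ x in S, ENNReal.ofReal (h (f x / r)) ∂volume ≤ 1})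

/-- The norm of `W²L^h(S)`: the sum of the Luxemburg norms of all derivatives
of order at most 2. -/
def sobNorm2 (h : ℝ → ℝ) (S : Set (Euc N)) (φ : Euc N → ℝ) : ℝ≥0∞ :=
  orliczNorm h S φ
  + ∑ i : Fin N, orliczNorm h S (fun x => fderiv ℝ φ x (EuclideanSpace.single i 1))
  + ∑ i : Fin N, ∑ j : Fin N, orliczNorm h S
      (fun x => iteratedFDeriv ℝ 2 φ x ![EuclideanSpace.single i 1, EuclideanSpace.single j 1])

/-- `h = |g|`. -/
def absFun (g : ℝ → ℝ) : ℝ → ℝ := fun t => |g t|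

/-- The class `𝒢`: odd continuous monotone increasing `g` such that `h = |g|` is `C¹`,
strictly convex, `h'(0) = 0`, `h' > 0` on `(0,∞)` and `h'(t) → ∞` as `t → ∞`. -/
def MemG (g : ℝ → ℝ) : Prop :=
  Continuous g ∧ Monotone g ∧ (∀ t, g (-t) = - g t) ∧
  ContDiff ℝ 1 (absFun g) ∧ StrictConvexOn ℝ Set.univ (absFun g) ∧
  deriv (absFun g) 0 = 0 ∧ (∀ t > 0, 0 < deriv (absFun g) t) ∧
  Tendsto (deriv (absFun g)) atTop atTop

/-- The `Δ₂` condition. -/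
def DeltaTwo (h : ℝ → ℝ) : Prop :=
  ∃ C : ℝ, 0 < C ∧ ∀ a > (0:ℝ), ∀ b > (0:ℝ), h (a + b) ≤ C * (h a + h b)

/-- The conjugate function `h*(t) = ∫_0^t (h')⁻¹(s) ds`. -/
def conjFun (h : ℝ → ℝ) : ℝ → ℝ := fun t => ∫ s in (0:ℝ)..t, Function.invFun (deriv h) s

/-- The class `𝒢₂`: `g ∈ 𝒢` with `h = |g|` and `h*` satisfying the `Δ₂` condition. -/
def MemG2 (g : ℝ → ℝ) : Prop :=
  MemG g ∧ DeltaTwo (absFun g) ∧ DeltaTwo (conjFun (absFun g))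

/-- The capacity `C_{2,h*}(E)` (for compact `E ⊆ Ω`): the supremum of `ν(Ω)` over positive
measures `ν` concentrated on `E` whose Green potential exists and has `L^{h*}` norm `≤ 1`. -/
def capacity (Ω : Set (Euc N)) (hstar : ℝ → ℝ) (E : Set (Euc N)) : ℝ≥0∞ :=
  sSup {m : ℝ≥0∞ | ∃ ν : Measure (Euc N), ν (Ω \ E) = 0 ∧ ν Ωᶜ = 0 ∧
    (∃ w : Euc N → ℝ, IsGreenPot Ω ν 0 w ∧ orliczNorm hstar Ω w ≤ 1) ∧ m = ν Ω}

/-- The signed measure `μ = μp - μn` belongs to `W^{-2}L^g(Ω)` (with `h = h*` as parameter):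
`|∫ φ dμ| ≤ C ‖φ‖_{W²L^{h*}(Ω)}` for all test functions `φ ∈ C_c^∞(Ω)`. -/
def MemWneg2 (Ω : Set (Euc N)) (hstar : ℝ → ℝ) (μp μn : Measure (Euc N)) : Prop :=
  ∃ C : ℝ, 0 < C ∧ ∀ φ : Euc N → ℝ, CcInf Ω φ →
    Integrable φ μp ∧ Integrable φ μn ∧
    ENNReal.ofReal |(∫ x, φ x ∂μp) - ∫ x, φ x ∂μn| ≤
      ENNReal.ofReal C * sobNorm2 hstar Ω φ

/-- Local membership in `W^{-2}L^g`: the bound holds on every `C²` subdomain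
compactly contained in `Ω`. -/
def MemWneg2Loc (Ω : Set (Euc N)) (hstar : ℝ → ℝ) (μp μn : Measure (Euc N)) : Prop :=
  ∀ Ω' : Set (Euc N), IsBoundedC2Domain Ω' → closure Ω' ⊆ Ω → MemWneg2 Ω' hstar μp μn

/-- The Keller–Osserman condition: `∫_1^∞ (∫_0^s g)^{-1/2} ds < ∞`. -/
def KellerOsserman (g : ℝ → ℝ) : Prop :=
  IntegrableOn (fun s : ℝ => (∫ t in (0:ℝ)..s, g t) ^ (-(1:ℝ)/2)) (Set.Ici (1:ℝ)) volume

/-- The subcriticality condition `∫_0^1 g(r^{2-N}) r^{N-1} dr < ∞`. -/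
def Subcritical (g : ℝ → ℝ) (N : ℕ) : Prop :=
  IntegrableOn (fun r : ℝ => g (r ^ ((2:ℝ) - N)) * r ^ ((N:ℝ) - 1))
    (Set.Ioo (0:ℝ) 1) volume

/-- `μ ∈ 𝔅_∞(Ω)` with singular (compact) set `F`. -/
def MemBinfty (Ω : Set (Euc N)) (μ : Measure (Euc N)) (F : Set (Euc N)) : Prop :=
  IsCompact F ∧ F ⊆ Ω ∧ μ Ωᶜ = 0 ∧
  (∀ O : Set (Euc N), IsOpen O → F ⊆ O → μ (Ω \ closure O) < ⊤) ∧
  ∀ A : Set (Euc N), MeasurableSet A → A ⊆ F → A.Nonempty → μ A = ⊤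

/-- A generalized solution of `-Δu + g∘u = μ` in `Ω`, `u = 0` on `∂Ω`,
for `μ ∈ 𝔅_∞(Ω)` with singular set `F`. -/
def IsGenSol (Ω : Set (Euc N)) (g : ℝ → ℝ) (μ : Measure (Euc N)) (F : Set (Euc N))
    (u : Euc N → ℝ) : Prop :=
  (∀ O : Set (Euc N), IsOpen O → F ⊆ O →
    IntegrableOn u (Ω \ closure O) volume ∧
    IntegrableOn (fun x => g (u x)) (Ω \ closure O) volume) ∧
  (∀ φ : Euc N → ℝ, TestFun Ω φ → tsupport φ ⊆ closure Ω \ F →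
    Integrable φ μ ∧
    ∫ x in Ω, (-(u x) * lap φ x + g (u x) * φ x) = ∫ x, φ x ∂μ) ∧
  ∀ ν : Measure (Euc N), MemMrho Ω ν → ν Fᶜ = 0 →
    ∀ v : Euc N → ℝ, IsWeakSol Ω g ν 0 v →
      ∀ᵐ x ∂(volume.restrict (Ω \ F)), v x ≤ u x

/-- A nonnegative solution of the homogeneous equation `-Δu + g∘u = 0` in `Ω ∖ F`
vanishing on `∂Ω`. -/
def IsHomSol (Ω F : Set (Euc N)) (g : ℝ → ℝ) (U : Euc N → ℝ) : Prop :=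
  (∀ O : Set (Euc N), IsOpen O → F ⊆ O →
    IntegrableOn U (Ω \ closure O) volume ∧
    IntegrableOn (fun x => g (U x)) (Ω \ closure O) volume) ∧
  (∀ᵐ x ∂(volume.restrict (Ω \ F)), 0 ≤ U x) ∧
  ∀ φ : Euc N → ℝ, TestFun Ω φ → tsupport φ ⊆ closure Ω \ F →
    ∫ x in Ω, (-(U x) * lap φ x + g (U x) * φ x) = 0

/-! ### Partial derivatives -/

/-- The `i`-th standard basis vector. -/
abbrev bv (i : Fin N) : Euc N := EuclideanSpace.single i 1

/-- The partial derivative in the `i`-th coordinate direction. -/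
def pd (i : Fin N) (f : Euc N → ℝ) (x : Euc N) : ℝ := fderiv ℝ f x (bv i)

theorem ContDiff.pd {f : Euc N → ℝ} {n m : WithTop ℕ∞} (hf : ContDiff ℝ n f) (hmn : m + 1 ≤ n)
    (i : Fin N) : ContDiff ℝ m (pd i f) :=
  (hf.fderiv_right hmn).clm_apply contDiff_const

theorem continuous_pd {f : Euc N → ℝ} (hf : ContDiff ℝ 1 f) (i : Fin N) : Continuous (pd i f) :=
  (hf.pd (m := 0) (by simp) i).continuous

theorem continuous_pd_pd {f : Euc N → ℝ} (hf : ContDiff ℝ 2 f) (i k : Fin N) :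
    Continuous (pd i (pd k f)) :=
  continuous_pd (hf.pd (m := 1) (by norm_num) k) i

theorem pd_pd_eq {f : Euc N → ℝ} (hf : ContDiff ℝ 2 f) (i k : Fin N) (x : Euc N) :
    pd i (pd k f) x = fderiv ℝ (fderiv ℝ f) x (bv i) (bv k) := by
  have h1 : DifferentiableAt ℝ (fderiv ℝ f) x :=
    (hf.fderiv_right (m := 1) (by norm_num)).differentiable (by norm_num) x
  have h2 : HasFDerivAt (fun y => fderiv ℝ f y (bv k))
      ((fderiv ℝ (fderiv ℝ f) x).flip (bv k)) x := by
    have := h1.hasFDerivAt.clm_apply (hasFDerivAt_const (bv k) x)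
    refine this.congr_fderiv ?_
    ext v; simp
  change fderiv ℝ (fun y => fderiv ℝ f y (bv k)) x (bv i) = _
  rw [h2.fderiv]; rfl

theorem pd_comm {f : Euc N → ℝ} (hf : ContDiff ℝ 2 f) (i k : Fin N) :
    pd i (pd k f) = pd k (pd i f) := by
  ext x
  rw [pd_pd_eq hf, pd_pd_eq hf]
  exact (hf.contDiffAt.isSymmSndFDerivAt (by simp)) _ _

theorem lap_eq_sum_pd {f : Euc N → ℝ} (hf : ContDiff ℝ 2 f) (x : Euc N) :
    lap f x = ∑ i, pd i (pd i f) x := by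
  unfold lap
  refine Finset.sum_congr rfl fun i _ => ?_
  rw [iteratedFDeriv_two_apply, pd_pd_eq hf]; rfl

theorem continuous_lap {f : Euc N → ℝ} (hf : ContDiff ℝ 2 f) : Continuous (lap f) := by
  have : lap f = fun x => ∑ i, pd i (pd i f) x := funext (lap_eq_sum_pd hf)
  rw [this]
  exact continuous_finsetSum _ fun i _ => continuous_pd_pd hf i i

theorem lap_congr {f g : Euc N → ℝ} {x : Euc N} (h : f =ᶠ[𝓝 x] g) : lap f x = lap g x := by
  unfold lap
  simp only [(EventuallyEq.iteratedFDeriv ℝ h 2).eq_of_nhds]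

theorem pd_congr {f g : Euc N → ℝ} {x : Euc N} (h : f =ᶠ[𝓝 x] g) (i : Fin N) :
    pd i f x = pd i g x := by
  unfold pd; rw [h.fderiv_eq]

theorem pd_add {f g : Euc N → ℝ} {x : Euc N} (hf : DifferentiableAt ℝ f x)
    (hg : DifferentiableAt ℝ g x) (i : Fin N) :
    pd i (fun y => f y + g y) x = pd i f x + pd i g x := by
  unfold pd; rw [fderiv_fun_add hf hg]; rfl

theorem pd_sub {f g : Euc N → ℝ} {x : Euc N} (hf : DifferentiableAt ℝ f x)
    (hg : DifferentiableAt ℝ g x) (i : Fin N) :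
    pd i (fun y => f y - g y) x = pd i f x - pd i g x := by
  unfold pd; rw [fderiv_fun_sub hf hg]; rfl

theorem pd_mul {f g : Euc N → ℝ} {x : Euc N} (hf : DifferentiableAt ℝ f x)
    (hg : DifferentiableAt ℝ g x) (i : Fin N) :
    pd i (fun y => f y * g y) x = f x * pd i g x + g x * pd i f x := by
  unfold pd; rw [fderiv_fun_mul hf hg]; rfl

theorem pd_const_mul (c : ℝ) {f : Euc N → ℝ} {x : Euc N} (hf : DifferentiableAt ℝ f x)
    (i : Fin N) : pd i (fun y => c * f y) x = c * pd i f x := by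
  unfold pd; rw [fderiv_const_mul hf]; rfl

theorem pd_const (c : ℝ) (i : Fin N) (x : Euc N) : pd i (fun _ => c) x = 0 := by
  unfold pd; simp

theorem pd_comp {γ : ℝ → ℝ} {f : Euc N → ℝ} {x : Euc N} (hγ : DifferentiableAt ℝ γ (f x))
    (hf : DifferentiableAt ℝ f x) (i : Fin N) :
    pd i (fun y => γ (f y)) x = deriv γ (f x) * pd i f x := by
  unfold pd
  have := hγ.hasDerivAt.comp_hasFDerivAt x hf.hasFDerivAt
  rw [show (fun y => γ (f y)) = γ ∘ f from rfl, this.fderiv]; rfl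

theorem lap_add {f g : Euc N → ℝ} (hf : ContDiff ℝ 2 f) (hg : ContDiff ℝ 2 g) (x : Euc N) :
    lap (fun y => f y + g y) x = lap f x + lap g x := by
  rw [lap_eq_sum_pd (hf.add hg), lap_eq_sum_pd hf, lap_eq_sum_pd hg, ← Finset.sum_add_distrib]
  refine Finset.sum_congr rfl fun i _ => ?_
  have h : pd i (fun y => f y + g y) = fun y => pd i f y + pd i g y := funext fun y =>
    pd_add (hf.differentiable (by norm_num) y) (hg.differentiable (by norm_num) y) i
  rw [h]
  exact pd_add ((hf.pd (m := 1) (by norm_num) i).differentiable (by norm_num) x)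
    ((hg.pd (m := 1) (by norm_num) i).differentiable (by norm_num) x) i

theorem lap_const_mul (c : ℝ) {f : Euc N → ℝ} (hf : ContDiff ℝ 2 f) (x : Euc N) :
    lap (fun y => c * f y) x = c * lap f x := by
  rw [lap_eq_sum_pd (contDiff_const.mul hf), lap_eq_sum_pd hf, Finset.mul_sum]
  refine Finset.sum_congr rfl fun i _ => ?_
  have h : pd i (fun y => c * f y) = fun y => c * pd i f y := funext fun y =>
    pd_const_mul c (hf.differentiable (by norm_num) y) i
  rw [h]
  exact pd_const_mul c ((hf.pd (m := 1) (by norm_num) i).differentiable (by norm_num) x) i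

theorem lap_neg {f : Euc N → ℝ} (hf : ContDiff ℝ 2 f) (x : Euc N) :
    lap (fun y => - f y) x = - lap f x := by
  have := lap_const_mul (-1) hf x
  simpa using this

theorem lap_sub {f g : Euc N → ℝ} (hf : ContDiff ℝ 2 f) (hg : ContDiff ℝ 2 g) (x : Euc N) :
    lap (fun y => f y - g y) x = lap f x - lap g x := by
  have := lap_add hf hg.neg x
  simp only [← sub_eq_add_neg] at this
  rw [this, lap_neg hg]; ring

theorem lap_mul {f g : Euc N → ℝ} (hf : ContDiff ℝ 2 f) (hg : ContDiff ℝ 2 g) (x : Euc N) :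
    lap (fun y => f y * g y) x =
      f x * lap g x + g x * lap f x + 2 * ∑ i, pd i f x * pd i g x := by
  rw [lap_eq_sum_pd (hf.mul hg), lap_eq_sum_pd hf, lap_eq_sum_pd hg, Finset.mul_sum,
    Finset.mul_sum, Finset.mul_sum, ← Finset.sum_add_distrib, ← Finset.sum_add_distrib]
  refine Finset.sum_congr rfl fun i _ => ?_
  have df := fun y => hf.differentiable (by norm_num) y
  have dg := fun y => hg.differentiable (by norm_num) y
  have df' := (hf.pd (m := 1) (by norm_num) i).differentiable (by norm_num) x
  have dg' := (hg.pd (m := 1) (by norm_num) i).differentiable (by norm_num) x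
  have h : pd i (fun y => f y * g y) = fun y => f y * pd i g y + g y * pd i f y :=
    funext fun y => pd_mul (df y) (dg y) i
  rw [h, pd_add ((df x).fun_mul dg') ((dg x).fun_mul df'), pd_mul (df x) dg', pd_mul (dg x) df']
  ring

theorem lap_comp {γ : ℝ → ℝ} {f : Euc N → ℝ} (hγ : ContDiff ℝ 2 γ) (hf : ContDiff ℝ 2 f)
    (x : Euc N) :
    lap (fun y => γ (f y)) x =
      deriv γ (f x) * lap f x + deriv (deriv γ) (f x) * ∑ i, (pd i f x) ^ 2 := by
  rw [lap_eq_sum_pd (hγ.fun_comp hf), lap_eq_sum_pd hf, Finset.mul_sum,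
    Finset.mul_sum, ← Finset.sum_add_distrib]
  refine Finset.sum_congr rfl fun i _ => ?_
  have df := fun y => hf.differentiable (by norm_num) y
  have df' := (hf.pd (m := 1) (by norm_num) i).differentiable (by norm_num) x
  have hγ' : ContDiff ℝ 1 (deriv γ) := (contDiff_succ_iff_deriv (n := 1)).1 hγ |>.2.2
  have dγ := fun t => hγ.differentiable (by norm_num) t
  have dγ' := fun t => hγ'.differentiable (by norm_num) t
  have h : pd i (fun y => γ (f y)) = fun y => deriv γ (f y) * pd i f y :=
    funext fun y => pd_comp (dγ _) (df y) i
  rw [h, pd_mul ((dγ' _).fun_comp' x (df x)) df', pd_comp (dγ' _) (df x)]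
  ring

/-- At a local minimum the pure second partial derivatives are nonnegative. -/
theorem pd_pd_nonneg_of_isLocalMin {f : Euc N → ℝ} (hf : ContDiff ℝ 2 f) {x : Euc N}
    (hx : IsLocalMin f x) (i : Fin N) : 0 ≤ pd i (pd i f) x := by
  by_contra! hneg
  have hl : ∀ t : ℝ, HasDerivAt (fun t : ℝ => x + t • bv i) (bv i) t := fun t => by
    simpa using ((hasDerivAt_id t).smul_const (bv i)).const_add x
  have key : ∀ F : Euc N → ℝ, Differentiable ℝ F → ∀ t,
      HasDerivAt (fun t : ℝ => F (x + t • bv i)) (pd i F (x + t • bv i)) t := fun F hF t =>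
    (hF _).hasFDerivAt.comp_hasDerivAt t (hl t)
  have h1 := key f (hf.differentiable (by norm_num))
  have h2 := key (pd i f) ((hf.pd (m := 1) (by norm_num) i).differentiable (by norm_num))
  have e1 : deriv (fun t : ℝ => f (x + t • bv i)) = fun t => pd i f (x + t • bv i) :=
    funext fun t => (h1 t).deriv
  have hct : ContinuousAt (fun t : ℝ => x + t • bv i) 0 := (hl 0).continuousAt
  have hmin : IsLocalMin (fun t : ℝ => f (x + t • bv i)) 0 := by
    have : Tendsto (fun t : ℝ => x + t • bv i) (𝓝 0) (𝓝 x) := by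
      simpa [ContinuousAt] using hct
    have := this.eventually hx
    simpa [IsLocalMin, IsMinFilter] using this
  have hmax : IsLocalMax (fun t : ℝ => f (x + t • bv i)) 0 := by
    refine isLocalMax_of_deriv_deriv_neg ?_ ?_ (h1 0).continuousAt
    · rw [e1, (h2 0).deriv]; simpa using hneg
    · exact hmin.deriv_eq_zero
  have hconst : (fun t : ℝ => f (x + t • bv i)) =ᶠ[𝓝 0] fun _ => f x := by
    filter_upwards [hmin, hmax] with t ht1 ht2
    simp only [zero_smul, add_zero] at ht1 ht2
    exact le_antisymm ht2 ht1
  have h3 := hconst.deriv.deriv.eq_of_nhds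
  rw [e1, (h2 0).deriv] at h3
  simp at h3
  linarith

theorem lap_nonneg_of_isLocalMin {f : Euc N → ℝ} (hf : ContDiff ℝ 2 f) {x : Euc N}
    (hx : IsLocalMin f x) : 0 ≤ lap f x := by
  rw [lap_eq_sum_pd hf]
  exact Finset.sum_nonneg fun i _ => pd_pd_nonneg_of_isLocalMin hf hx i

/-- Weak maximum principle for strictly superharmonic functions. -/
theorem nonneg_of_lap_neg {K U : Set (Euc N)} {f : Euc N → ℝ} (hK : IsCompact K) (hU : IsOpen U)
    (hUK : U ⊆ K) (hf : ContDiff ℝ 2 f) (hlap : ∀ x ∈ U, lap f x < 0)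
    (hbd : ∀ x ∈ K \ U, 0 ≤ f x) : ∀ x ∈ K, 0 ≤ f x := by
  intro x hx
  obtain ⟨y, hy, hmin⟩ := hK.exists_isMinOn ⟨x, hx⟩ hf.continuous.continuousOn
  refine le_trans ?_ (hmin hx)
  by_cases hyU : y ∈ U
  · have : IsLocalMin f y := by
      filter_upwards [hU.mem_nhds hyU] with z hz using hmin (hUK hz)
    exact absurd (lap_nonneg_of_isLocalMin hf this) (not_le.2 (hlap y hyU))
  · exact hbd y ⟨hy, hyU⟩

/-! ### A smooth convex approximation of the positive part -/

/-- A smooth convex primitive of the smooth transition function. -/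
def cvx (t : ℝ) : ℝ := ∫ s in (0:ℝ)..t, Real.smoothTransition s

theorem hasDerivAt_cvx (t : ℝ) : HasDerivAt cvx (Real.smoothTransition t) t :=
  intervalIntegral.integral_hasDerivAt_right
    (Real.smoothTransition.continuous.intervalIntegrable _ _)
    (Real.smoothTransition.continuous.stronglyMeasurableAtFilter _ _)
    Real.smoothTransition.continuousAt

theorem deriv_cvx : deriv cvx = Real.smoothTransition := funext fun t => (hasDerivAt_cvx t).deriv

theorem contDiff_cvx : ContDiff ℝ 2 cvx := by
  rw [show (2 : WithTop ℕ∞) = 1 + 1 by norm_num, contDiff_succ_iff_deriv]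
  refine ⟨fun t => (hasDerivAt_cvx t).differentiableAt, by simp, ?_⟩
  rw [deriv_cvx]
  exact_mod_cast Real.smoothTransition.contDiff (n := 1)

theorem deriv_deriv_cvx_nonneg (t : ℝ) : 0 ≤ deriv (deriv cvx) t := by
  rw [deriv_cvx]
  exact Real.smoothTransition.monotone.deriv_nonneg

theorem cvx_of_nonpos {t : ℝ} (ht : t ≤ 0) : cvx t = 0 := by
  unfold cvx
  rw [intervalIntegral.integral_congr (g := fun _ => (0:ℝ))]
  · simp
  · intro s hs
    rw [uIcc_of_ge ht] at hs
    exact Real.smoothTransition.zero_of_nonpos hs.2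

theorem cvx_nonneg (t : ℝ) : 0 ≤ cvx t := by
  rcases le_total t 0 with h | h
  · rw [cvx_of_nonpos h]
  · exact intervalIntegral.integral_nonneg h fun s _ => Real.smoothTransition.nonneg s

theorem cvx_le {t : ℝ} (ht : 0 ≤ t) : cvx t ≤ t := by
  have := intervalIntegral.integral_mono_on (μ := volume) ht
    (Real.smoothTransition.continuous.intervalIntegrable _ _)
    (continuous_const (y := (1:ℝ)).intervalIntegrable _ _)
    fun s _ => Real.smoothTransition.le_one s
  simpa [cvx] using this

theorem cvx_le_mul_deriv (t : ℝ) : cvx t ≤ (t + 1) * Real.smoothTransition t := by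
  rcases le_total t 0 with h | h
  · rw [cvx_of_nonpos h, Real.smoothTransition.zero_of_nonpos h, mul_zero]
  · have := intervalIntegral.integral_mono_on (μ := volume) h
      (Real.smoothTransition.continuous.intervalIntegrable _ _)
      (continuous_const (y := Real.smoothTransition t).intervalIntegrable _ _)
      fun s hs => Real.smoothTransition.monotone hs.2
    have h' : cvx t ≤ t * Real.smoothTransition t := by simpa [cvx] using this
    nlinarith [Real.smoothTransition.nonneg t]

theorem sub_one_le_cvx (t : ℝ) : t - 1 ≤ cvx t := by
  rcases le_total t 1 with h | h
  · linarith [cvx_nonneg t]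
  · have h01 : cvx t = cvx 1 + (t - 1) := by
      unfold cvx
      rw [← intervalIntegral.integral_add_adjacent_intervals (b := 1)
        (Real.smoothTransition.continuous.intervalIntegrable _ _)
        (Real.smoothTransition.continuous.intervalIntegrable _ _)]
      congr 1
      rw [intervalIntegral.integral_congr (g := fun _ => (1:ℝ))]
      · simp
      · intro s hs
        rw [uIcc_of_le h] at hs
        exact Real.smoothTransition.one_of_one_le hs.1
    linarith [cvx_nonneg 1]

/-- Smooth convex functions, vanishing for `t ≤ ε`, approximating the positive part. -/
def spos (ε t : ℝ) : ℝ := ε * cvx (t / ε - 1)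

theorem contDiff_spos (ε : ℝ) : ContDiff ℝ 2 (spos ε) :=
  contDiff_const.mul (contDiff_cvx.comp ((contDiff_id.div_const ε).sub contDiff_const))

theorem hasDerivAt_spos {ε : ℝ} (hε : 0 < ε) (t : ℝ) :
    HasDerivAt (spos ε) (Real.smoothTransition (t / ε - 1)) t := by
  have h : HasDerivAt (fun t : ℝ => t / ε - 1) (1 / ε) t :=
    ((hasDerivAt_id t).div_const ε).sub_const 1
  have := ((hasDerivAt_cvx (t / ε - 1)).comp t h).const_mul ε
  refine this.congr_deriv ?_
  field_simp

theorem deriv_spos {ε : ℝ} (hε : 0 < ε) :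
    deriv (spos ε) = fun t => Real.smoothTransition (t / ε - 1) :=
  funext fun t => (hasDerivAt_spos hε t).deriv

theorem deriv_deriv_spos_nonneg {ε : ℝ} (hε : 0 < ε) (t : ℝ) : 0 ≤ deriv (deriv (spos ε)) t := by
  rw [deriv_spos hε]
  refine Monotone.deriv_nonneg fun a b hab => Real.smoothTransition.monotone ?_
  gcongr

theorem spos_nonneg {ε : ℝ} (hε : 0 < ε) (t : ℝ) : 0 ≤ spos ε t :=
  mul_nonneg hε.le (cvx_nonneg _)

theorem spos_of_le {ε : ℝ} (hε : 0 < ε) {t : ℝ} (ht : t ≤ ε) : spos ε t = 0 := by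
  unfold spos
  rw [cvx_of_nonpos, mul_zero]
  rw [sub_nonpos, div_le_one hε]; exact ht

theorem spos_le_pos {ε : ℝ} (hε : 0 < ε) (t : ℝ) : spos ε t ≤ max t 0 := by
  rcases le_total t ε with h | h
  · rw [spos_of_le hε h]; exact le_max_right _ _
  · refine le_max_of_le_left ?_
    have h1 : 0 ≤ t / ε - 1 := by rw [sub_nonneg, le_div_iff₀ hε]; linarith
    have := mul_le_mul_of_nonneg_left (cvx_le h1) hε.le
    unfold spos
    have e : ε * (t / ε - 1) = t - ε := by field_simp
    linarith

theorem sub_le_spos {ε : ℝ} (hε : 0 < ε) (t : ℝ) : t - 2 * ε ≤ spos ε t := by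
  have := mul_le_mul_of_nonneg_left (sub_one_le_cvx (t / ε - 1)) hε.le
  unfold spos
  have e : ε * (t / ε - 1 - 1) = t - 2 * ε := by field_simp; ring
  linarith

theorem spos_le_mul_deriv {ε : ℝ} (hε : 0 < ε) (t : ℝ) : spos ε t ≤ t * deriv (spos ε) t := by
  rw [deriv_spos hε]
  have := mul_le_mul_of_nonneg_left (cvx_le_mul_deriv (t / ε - 1)) hε.le
  unfold spos
  have e : ε * ((t / ε - 1 + 1) * Real.smoothTransition (t / ε - 1))
    = t * Real.smoothTransition (t / ε - 1) := by field_simp; ring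
  linarith

theorem tendsto_spos (t : ℝ) :
    Tendsto (fun n : ℕ => spos (1 / ((n:ℝ) + 1)) t) atTop (𝓝 (max t 0)) := by
  have h0 := tendsto_one_div_add_atTop_nhds_zero_nat (𝕜 := ℝ)
  have hp : ∀ n : ℕ, (0:ℝ) < 1 / ((n:ℝ) + 1) := fun n => by positivity
  refine tendsto_of_tendsto_of_tendsto_of_le_of_le (g := fun n : ℕ => max t 0 - 2 * (1 / ((n:ℝ) + 1)))
    ?_ tendsto_const_nhds (fun n => ?_) fun n => spos_le_pos (hp n) t
  · simpa using tendsto_const_nhds.sub (h0.const_mul 2)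
  · change max t 0 - 2 * (1 / ((n:ℝ) + 1)) ≤ _
    have := sub_le_spos (hp n) t
    have := spos_nonneg (hp n) t
    rcases max_cases t 0 with h | h <;> linarith [h.1, hp n]

/-! ### Cutoff functions and Lipschitz bounds -/

theorem exists_cutoff {K U : Set (Euc N)} (hK : IsCompact K) (hU : IsOpen U) (hKU : K ⊆ U) :
    ∃ χ : Euc N → ℝ, ContDiff ℝ (⊤ : ℕ∞) χ ∧ HasCompactSupport χ ∧ tsupport χ ⊆ U ∧
      (∀ x, 0 ≤ χ x) ∧ (∀ x, χ x ≤ 1) ∧ ∀ x ∈ K, ∀ᶠ y in 𝓝 x, χ y = 1 := by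
  obtain ⟨K2, hK2, hKK2, hK2U⟩ := exists_compact_between hK hU hKU
  obtain ⟨K1, hK1, hKK1, hK12⟩ := exists_compact_between hK isOpen_interior hKK2
  obtain ⟨f, hf, hr, hs, h1⟩ := exists_contMDiff_support_eq_eq_one_iff
    (modelWithCornersSelf ℝ (Euc N)) (n := ⊤) (isOpen_interior (s := K2)) hK1.isClosed hK12
  have hsub : tsupport f ⊆ K2 := by
    rw [tsupport, hs]
    exact closure_minimal interior_subset hK2.isClosed
  refine ⟨f, contMDiff_iff_contDiff.1 hf, hK2.of_isClosed_subset (isClosed_tsupport f) hsub,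
    hsub.trans hK2U, fun x => (hr ⟨x, rfl⟩).1, fun x => (hr ⟨x, rfl⟩).2, fun x hx => ?_⟩
  filter_upwards [isOpen_interior.mem_nhds (hKK1 hx)] with y hy
  exact (h1 y).1 (interior_subset hy)

theorem ContDiff.two_of_top {f : Euc N → ℝ} (hf : ContDiff ℝ (⊤ : ℕ∞) f) : ContDiff ℝ 2 f :=
  by exact_mod_cast contDiff_infty.1 hf 2

theorem contDiff_of_forall_mem_tsupport {f : Euc N → ℝ} {n : WithTop ℕ∞}
    (h : ∀ x ∈ tsupport f, ContDiffAt ℝ n f x) : ContDiff ℝ n f := by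
  rw [contDiff_iff_contDiffAt]
  intro x
  by_cases hx : x ∈ tsupport f
  · exact h x hx
  · exact (contDiffAt_const (c := (0:ℝ))).congr_of_eventuallyEq
      (notMem_tsupport_iff_eventuallyEq.1 hx)

theorem contDiff_mul_of_tsupport_subset {b f : Euc N → ℝ} {U : Set (Euc N)} {n : WithTop ℕ∞}
    (hU : IsOpen U) (hb : ContDiff ℝ n b) (hf : ContDiffOn ℝ n f U) (hs : tsupport b ⊆ U) :
    ContDiff ℝ n (fun x => b x * f x) :=
  contDiff_of_forall_mem_tsupport fun x hx =>
    have hxU : x ∈ U := hs (closure_mono (Function.support_mul_subset_left b f) hx)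
    hb.contDiffAt.mul (hf.contDiffAt (hU.mem_nhds hxU))

theorem exists_bound_of_continuous {f : Euc N → ℝ} (hf : Continuous f) {K : Set (Euc N)}
    (hK : Bornology.IsBounded K) : ∃ C, 0 ≤ C ∧ ∀ x ∈ K, |f x| ≤ C := by
  obtain ⟨C, hC⟩ := hK.isCompact_closure.exists_bound_of_continuousOn hf.continuousOn
  exact ⟨max C 0, le_max_right _ _, fun x hx => le_max_of_le_left (hC x (subset_closure hx))⟩

theorem exists_lipschitz_bound {f : Euc N → ℝ} (hf : ContDiff ℝ 1 f) {K : Set (Euc N)}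
    (hK : Bornology.IsBounded K) :
    ∃ C, 0 ≤ C ∧ ∀ x ∈ K, ∀ y ∈ K, |f x - f y| ≤ C * dist x y := by
  obtain ⟨R, hR⟩ := hK.subset_closedBall 0
  obtain ⟨C, hC⟩ := (isCompact_closedBall (0 : Euc N) R).exists_bound_of_continuousOn
    (hf.continuous_fderiv (by norm_num)).continuousOn
  refine ⟨max C 0, le_max_right _ _, fun x hx y hy => ?_⟩
  have := (convex_closedBall (0 : Euc N) R).norm_image_sub_le_of_norm_fderiv_le
    (fun z _ => hf.differentiable (by norm_num) z) hC (hR hy) (hR hx)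
  rw [Real.norm_eq_abs, ← dist_eq_norm] at this
  exact this.trans (mul_le_mul_of_nonneg_right (le_max_left _ _) dist_nonneg)

theorem abs_pd_le_norm (f : Euc N → ℝ) (i : Fin N) (x : Euc N) : |pd i f x| ≤ ‖fderiv ℝ f x‖ := by
  have := (fderiv ℝ f x).le_opNorm (bv i)
  simpa [pd] using this

theorem fderiv_apply_eq_sum_pd (f : Euc N → ℝ) (x v : Euc N) :
    fderiv ℝ f x v = ∑ i, v i * pd i f x := by
  have hv : v = ∑ i, v i • bv i := by
    have := (EuclideanSpace.basisFun (Fin N) ℝ).sum_repr v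
    simpa using this.symm
  conv_lhs => rw [hv]
  simp [pd]

/-! ### The domain and its boundary distance -/

theorem subset_of_disjoint_frontier {Ω S : Set (Euc N)} (hΩ : IsOpen Ω) (hS : IsPreconnected S)
    (hne : (S ∩ Ω).Nonempty) (hd : ∀ x ∈ S, x ∉ frontier Ω) : S ⊆ Ω := by
  refine hS.subset_of_closure_inter_subset hΩ hne ?_
  rintro x ⟨hx, hxS⟩
  by_contra hxΩ
  exact hd x hxS ⟨hx, fun h => hxΩ (interior_subset h)⟩

theorem rho_nonneg (Ω : Set (Euc N)) (x : Euc N) : 0 ≤ rho Ω x := infDist_nonneg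

theorem continuous_rho (Ω : Set (Euc N)) : Continuous (rho Ω) := continuous_infDist_pt _

theorem rho_le_add (Ω : Set (Euc N)) (x y : Euc N) : rho Ω x ≤ rho Ω y + dist x y :=
  infDist_le_infDist_add_dist

theorem ball_rho_subset {Ω : Set (Euc N)} (hΩ : IsOpen Ω) {x : Euc N} (hx : x ∈ Ω) :
    ball x (rho Ω x) ⊆ Ω := by
  by_cases h0 : 0 < rho Ω x
  · refine subset_of_disjoint_frontier hΩ (convex_ball _ _).isPreconnected
      ⟨x, mem_ball_self h0, hx⟩ fun y hy hyf => ?_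
    have h1 : rho Ω x ≤ dist x y := infDist_le_dist_of_mem hyf
    rw [mem_ball, dist_comm] at hy
    exact absurd hy (not_lt.2 h1)
  · rw [ball_eq_empty.2 (not_lt.1 h0)]; exact empty_subset _

theorem IsBoundedC2Domain.isCompact_frontier {Ω : Set (Euc N)} (hΩ : IsBoundedC2Domain Ω) :
    IsCompact (frontier Ω) :=
  hΩ.2.2.1.isCompact_closure.of_isClosed_subset isClosed_frontier frontier_subset_closure

theorem IsBoundedC2Domain.frontier_nonempty [NeZero N] {Ω : Set (Euc N)}
    (hΩ : IsBoundedC2Domain Ω) : (frontier Ω).Nonempty := by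
  rw [nonempty_frontier_iff]
  refine ⟨hΩ.2.1.nonempty, fun h => ?_⟩
  have hb := hΩ.2.2.1
  rw [h] at hb
  have : Nonempty (Fin N) := ⟨0⟩
  have : Nontrivial (Euc N) := inferInstance
  exact NormedSpace.unbounded_univ ℝ (Euc N) hb

theorem IsBoundedC2Domain.rho_pos [NeZero N] {Ω : Set (Euc N)} (hΩ : IsBoundedC2Domain Ω)
    {x : Euc N} (hx : x ∈ Ω) : 0 < rho Ω x := by
  refine (infDist_pos_iff_notMem_closure hΩ.frontier_nonempty).1 ?_
  rw [isClosed_frontier.closure_eq]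
  exact fun h => h.2 (by rwa [hΩ.1.interior_eq])

theorem IsBoundedC2Domain.exists_frontier_dist [NeZero N] {Ω : Set (Euc N)}
    (hΩ : IsBoundedC2Domain Ω) (x : Euc N) : ∃ y ∈ frontier Ω, rho Ω x = dist x y :=
  hΩ.isCompact_frontier.exists_infDist_eq_dist hΩ.frontier_nonempty x

theorem mem_or_mem_frontier {Ω : Set (Euc N)} {x : Euc N} (hx : x ∈ closure Ω) :
    x ∈ Ω ∨ x ∈ frontier Ω := by
  by_cases h : x ∈ Ω
  · exact Or.inl h
  · exact Or.inr ⟨hx, fun h' => h (interior_subset h')⟩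

/-! ### Test functions -/

namespace TestFun

variable {Ω : Set (Euc N)} {φ χ : Euc N → ℝ}

theorem add (h1 : TestFun Ω φ) (h2 : TestFun Ω χ) : TestFun Ω (fun x => φ x + χ x) :=
  ⟨h1.1.add h2.1, fun x hx => by simp [h1.2 x hx, h2.2 x hx]⟩

theorem const_mul (c : ℝ) (h1 : TestFun Ω φ) : TestFun Ω (fun x => c * φ x) :=
  ⟨contDiff_const.mul h1.1, fun x hx => by simp [h1.2 x hx]⟩

theorem neg (h1 : TestFun Ω φ) : TestFun Ω (fun x => - φ x) :=
  ⟨h1.1.neg, fun x hx => by simp [h1.2 x hx]⟩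

theorem sub (h1 : TestFun Ω φ) (h2 : TestFun Ω χ) : TestFun Ω (fun x => φ x - χ x) :=
  ⟨h1.1.sub h2.1, fun x hx => by simp [h1.2 x hx, h2.2 x hx]⟩

theorem of_tsupport_subset (hΩ : IsOpen Ω) (h1 : ContDiff ℝ 2 φ) (h2 : tsupport φ ⊆ Ω) :
    TestFun Ω φ :=
  ⟨h1, fun x hx => image_eq_zero_of_notMem_tsupport fun h =>
    hx.2 (by rw [hΩ.interior_eq]; exact h2 h)⟩

theorem exists_le_rho [NeZero N] (hΩ : IsBoundedC2Domain Ω) (h : TestFun Ω φ) :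
    ∃ C, 0 ≤ C ∧ ∀ x ∈ closure Ω, |φ x| ≤ C * rho Ω x := by
  obtain ⟨C, hC0, hC⟩ := exists_lipschitz_bound (h.1.of_le (by norm_num)) hΩ.2.2.1.closure
  refine ⟨C, hC0, fun x hx => ?_⟩
  obtain ⟨y, hy, hxy⟩ := hΩ.exists_frontier_dist x
  have := hC x hx y (frontier_subset_closure hy)
  rwa [h.2 y hy, sub_zero, ← hxy] at this

theorem exists_lap_le (hΩ : IsBoundedC2Domain Ω) (h : TestFun Ω φ) :
    ∃ C, 0 ≤ C ∧ ∀ x ∈ Ω, |lap φ x| ≤ C :=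
  exists_bound_of_continuous (continuous_lap h.1) hΩ.2.2.1

end TestFun

theorem IsBoundedC2Domain.volume_lt_top {Ω : Set (Euc N)} (hΩ : IsBoundedC2Domain Ω) :
    volume Ω < ⊤ := hΩ.2.2.1.measure_lt_top

theorem integrableOn_mul_of_continuous {Ω : Set (Euc N)} (hΩ : IsBoundedC2Domain Ω)
    {u f : Euc N → ℝ} (hu : IntegrableOn u Ω) (hf : Continuous f) :
    IntegrableOn (fun x => u x * f x) Ω := by
  obtain ⟨C, -, hC⟩ := exists_bound_of_continuous hf hΩ.2.2.1
  exact Integrable.mul_bdd hu hf.aestronglyMeasurable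
    ((ae_restrict_iff' hΩ.1.measurableSet).2 (ae_of_all _ hC))

/-- Integrability against test functions of functions integrable with weight `ρ`. -/
theorem integrableOn_mul_of_rho [NeZero N] {Ω : Set (Euc N)} (hΩ : IsBoundedC2Domain Ω)
    {f φ : Euc N → ℝ} (hf : IntegrableOn (fun x => f x * rho Ω x) Ω) (hφ : TestFun Ω φ) :
    IntegrableOn (fun x => f x * φ x) Ω := by
  obtain ⟨C, hC0, hC⟩ := hφ.exists_le_rho hΩ
  have h1 : IntegrableOn (fun x => (f x * rho Ω x) * (φ x / rho Ω x)) Ω := by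
    refine Integrable.mul_bdd (c := C) hf ?_ ?_
    · exact (hφ.1.continuous.measurable.div (continuous_rho Ω).measurable).aestronglyMeasurable
    · refine (ae_restrict_iff' hΩ.1.measurableSet).2 (ae_of_all _ fun x hx => ?_)
      rw [Real.norm_eq_abs, abs_div, abs_of_pos (hΩ.rho_pos hx), div_le_iff₀ (hΩ.rho_pos hx)]
      exact hC x (subset_closure hx)
  refine h1.congr ((ae_restrict_iff' hΩ.1.measurableSet).2 (ae_of_all _ fun x hx => ?_))
  have := (hΩ.rho_pos hx).ne'
  field_simp

theorem integrable_rho_of_memMrho {Ω : Set (Euc N)} {μ : Measure (Euc N)} (h : MemMrho Ω μ) :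
    Integrable (rho Ω) μ := by
  refine ⟨(continuous_rho Ω).aestronglyMeasurable, ?_⟩
  rw [hasFiniteIntegral_iff_ofReal (ae_of_all _ (rho_nonneg Ω))]
  exact h.2

theorem MemMrho.ae_mem {Ω : Set (Euc N)} {μ : Measure (Euc N)} (h : MemMrho Ω μ) :
    ∀ᵐ x ∂μ, x ∈ Ω := h.1

theorem integrable_of_le_rho {Ω : Set (Euc N)} {μ : Measure (Euc N)} (h : MemMrho Ω μ)
    {f : Euc N → ℝ} (hf : AEStronglyMeasurable f μ) {C : ℝ}
    (hC : ∀ x ∈ Ω, |f x| ≤ C * rho Ω x) : Integrable f μ := by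
  refine ((integrable_rho_of_memMrho h).const_mul C).mono' hf ?_
  filter_upwards [h.ae_mem] with x hx using hC x hx

theorem TestFun.integrable [NeZero N] {Ω : Set (Euc N)} (hΩ : IsBoundedC2Domain Ω)
    {μ : Measure (Euc N)} (h : MemMrho Ω μ) {φ : Euc N → ℝ} (hφ : TestFun Ω φ) :
    Integrable φ μ := by
  obtain ⟨C, -, hC⟩ := hφ.exists_le_rho hΩ
  exact integrable_of_le_rho h hφ.1.continuous.aestronglyMeasurable
    fun x hx => hC x (subset_closure hx)

/-- Truncation of a test function to a compactly supported one. -/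
theorem TestFun.spos_comp {Ω : Set (Euc N)} (hΩ : IsOpen Ω) {φ : Euc N → ℝ}
    (h : TestFun Ω φ) {ε : ℝ} (hε : 0 < ε) :
    TestFun Ω (Ω.indicator fun x => spos ε (φ x)) := by
  have hc : ContDiff ℝ 2 fun x => spos ε (φ x) := (contDiff_spos ε).comp h.1
  refine ⟨contDiff_iff_contDiffAt.2 fun x => ?_, fun x hx => ?_⟩
  · by_cases hx : x ∈ Ω
    · refine hc.contDiffAt.congr_of_eventuallyEq ?_
      filter_upwards [hΩ.mem_nhds hx] with y hy using indicator_of_mem hy _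
    · refine (contDiffAt_const (c := (0:ℝ))).congr_of_eventuallyEq ?_
      by_cases hxc : x ∈ closure Ω
      · have hxf : x ∈ frontier Ω := (mem_or_mem_frontier hxc).resolve_left hx
        have : ∀ᶠ y in 𝓝 x, φ y < ε :=
          h.1.continuous.continuousAt.eventually (gt_mem_nhds (by rw [h.2 x hxf]; exact hε))
        filter_upwards [this] with y hy
        by_cases hyΩ : y ∈ Ω
        · rw [indicator_of_mem hyΩ, spos_of_le hε hy.le]
        · exact indicator_of_notMem hyΩ _
      · filter_upwards [isClosed_closure.isOpen_compl.mem_nhds hxc] with y hy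
        exact indicator_of_notMem (fun hyΩ => hy (subset_closure hyΩ)) _
  · exact indicator_of_notMem (fun hxΩ => hx.2 (by rwa [hΩ.interior_eq])) _

theorem lap_indicator {Ω : Set (Euc N)} (hΩ : IsOpen Ω) (f : Euc N → ℝ) {x : Euc N} (hx : x ∈ Ω) :
    lap (Ω.indicator f) x = lap f x := by
  refine lap_congr ?_
  filter_upwards [hΩ.mem_nhds hx] with y hy using indicator_of_mem hy _

theorem IsBoundedC2Domain.exists_local_defining {Ω : Set (Euc N)} (hΩ : IsBoundedC2Domain Ω)
    {z : Euc N} (hz : z ∈ frontier Ω) : ∃ f : Euc N → ℝ, ∃ r : ℝ, 0 < r ∧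
      ContDiffOn ℝ 2 f (ball z r) ∧ (∀ y ∈ ball z r, fderiv ℝ f y ≠ 0) ∧
      (∀ y ∈ ball z r, y ∈ Ω ↔ f y < 0) ∧ ∀ y ∈ ball z r, y ∈ frontier Ω ↔ f y = 0 := by
  obtain ⟨hO, -, -, h⟩ := hΩ
  obtain ⟨f, U, hU, hf, hdf, hs⟩ := h z hz
  obtain ⟨r, hr, hrU⟩ := Metric.mem_nhds_iff.1 hU
  have hmem : ∀ y ∈ ball z r, y ∈ Ω ↔ f y < 0 := by
    intro y hy
    have := Set.ext_iff.1 hs y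
    simp only [mem_inter_iff, mem_ofPred_eq, hrU hy, and_true, true_and] at this
    exact this
  have hfB := hf.mono hrU
  refine ⟨f, r, hr, hfB, fun y hy => hdf y (hrU hy), hmem, fun y hy => ⟨fun hyf => ?_, fun hy0 => ?_⟩⟩
  · have h1 : 0 ≤ f y := by
      by_contra! hlt
      have : y ∈ Ω := (hmem y hy).2 hlt
      rw [hO.frontier_eq] at hyf
      exact hyf.2 this
    refine le_antisymm ?_ h1
    have hc : ContinuousAt f y :=
      (hfB.continuousOn).continuousAt (isOpen_ball.mem_nhds hy)
    have hcl : y ∈ closure Ω := frontier_subset_closure hyf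
    by_contra! hpos
    have : ∀ᶠ w in 𝓝 y, 0 < f w ∧ w ∈ ball z r :=
      (hc.eventually (lt_mem_nhds hpos)).and (isOpen_ball.mem_nhds hy)
    obtain ⟨w, hw3, hw1, hw2⟩ := ((mem_closure_iff_frequently.1 hcl).and_eventually this).exists
    have := (hmem w hw2).1 hw3
    linarith
  · rw [hO.frontier_eq]
    refine ⟨?_, fun hyΩ => by have := (hmem y hy).1 hyΩ; linarith⟩
    by_contra hncl
    have hev : ∀ᶠ w in 𝓝 y, 0 ≤ f w := by
      filter_upwards [isOpen_ball.mem_nhds hy, isClosed_closure.isOpen_compl.mem_nhds hncl]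
        with w hw hw2
      by_contra! hlt
      exact hw2 (subset_closure ((hmem w hw).2 hlt))
    have : IsLocalMin f y := by
      filter_upwards [hev] with w hw
      rw [hy0]; exact hw
    exact hdf y (hrU hy) this.fderiv_eq_zero

theorem fderiv_nonpos_of_nonneg_right {f : Euc N → ℝ} {z e : Euc N} (hf : DifferentiableAt ℝ f z)
    (hz : f z = 0) (h : ∀ᶠ t in 𝓝[>] (0:ℝ), f (z + t • e) ≤ 0) : fderiv ℝ f z e ≤ 0 := by
  have h1 : HasDerivAt (fun t : ℝ => f (z + t • e)) (fderiv ℝ f z e) 0 := by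
    have := hf.hasFDerivAt.hasLineDerivAt e
    simpa [HasLineDerivAt] using this
  have h2 := h1.tendsto_slope_zero_right
  refine le_of_tendsto h2 ?_
  filter_upwards [h, self_mem_nhdsWithin] with t ht ht0
  simp only [zero_add, zero_smul, add_zero, hz, sub_zero, smul_eq_mul]
  exact mul_nonpos_of_nonneg_of_nonpos (inv_nonneg.2 (le_of_lt ht0)) ht

theorem eventually_neg_right {f : Euc N → ℝ} {z e : Euc N} (hf : DifferentiableAt ℝ f z)
    (hz : f z = 0) (h : fderiv ℝ f z e < 0) : ∀ᶠ t in 𝓝[>] (0:ℝ), f (z + t • e) < 0 := by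
  have h1 : HasDerivAt (fun t : ℝ => f (z + t • e)) (fderiv ℝ f z e) 0 := by
    have := hf.hasFDerivAt.hasLineDerivAt e
    simpa [HasLineDerivAt] using this
  have h2 := h1.tendsto_slope_zero_right
  filter_upwards [h2.eventually (gt_mem_nhds h), self_mem_nhdsWithin] with t ht ht0
  simp only [zero_add, zero_smul, add_zero, hz, sub_zero, smul_eq_mul] at ht
  by_contra! hc
  exact absurd (mul_nonneg (inv_nonneg.2 (le_of_lt ht0)) hc) (not_le.2 ht)

/-- A bounded `C²` domain has a global `C²` defining function. -/
theorem IsBoundedC2Domain.exists_defining [NeZero N] {Ω : Set (Euc N)}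
    (hΩ : IsBoundedC2Domain Ω) : ∃ ψ : Euc N → ℝ, TestFun Ω ψ ∧ (∀ x ∈ Ω, 0 < ψ x) ∧
      ∀ x ∈ frontier Ω, fderiv ℝ ψ x ≠ 0 := by
  have hO := hΩ.1
  have hfr := hΩ.isCompact_frontier
  have hclos : IsCompact (closure Ω) := hΩ.2.2.1.isCompact_closure
  choose f r hr hf hdf hfΩ hf0 using fun z : frontier Ω => hΩ.exists_local_defining z.2
  have hcut : ∀ z : frontier Ω, ∃ χ : Euc N → ℝ, ContDiff ℝ (⊤ : ℕ∞) χ ∧ HasCompactSupport χ ∧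
      tsupport χ ⊆ ball z (r z) ∧ (∀ x, 0 ≤ χ x) ∧ (∀ x, χ x ≤ 1) ∧
        ∀ x ∈ closedBall (z : Euc N) (r z / 2), ∀ᶠ y in 𝓝 x, χ y = 1 := fun z =>
    exists_cutoff (isCompact_closedBall _ _) isOpen_ball
      (closedBall_subset_ball (by linarith [hr z]))
  choose b hb hbc hbs hb0 hb1 hbK using hcut
  obtain ⟨t, ht⟩ := hfr.elim_finite_subcover (fun z : frontier Ω => ball (z : Euc N) (r z / 2))
    (fun z => isOpen_ball) (fun x hx => mem_iUnion.2 ⟨⟨x, hx⟩, mem_ball_self (by linarith [hr ⟨x, hx⟩])⟩)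
  set W : Set (Euc N) := ⋃ i ∈ t, ball (i : Euc N) (r i / 2) with hW
  have hWo : IsOpen W := isOpen_biUnion fun i _ => isOpen_ball
  have hKc : IsCompact (closure Ω \ W) := hclos.diff hWo
  have hKΩ : closure Ω \ W ⊆ Ω := by
    rintro x ⟨hx1, hx2⟩
    rcases mem_or_mem_frontier hx1 with h | h
    · exact h
    · exact absurd (ht h) hx2
  obtain ⟨b0, hb00, hb0c, hb0s, hb0n, hb01, hb0K⟩ := exists_cutoff hKc hO hKΩ
  have hsm : ∀ z : frontier Ω, ContDiff ℝ 2 (fun x => b z x * f z x) := fun z =>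
    contDiff_mul_of_tsupport_subset isOpen_ball (hb z).two_of_top (hf z) (hbs z)
  have hbz : ∀ z : frontier Ω, ∀ x, x ∉ ball (z : Euc N) (r z) → b z x = 0 := fun z x hx =>
    image_eq_zero_of_notMem_tsupport fun h => hx (hbs z h)
  have hfrz : ∀ z : frontier Ω, ∀ x ∈ frontier Ω, b z x * f z x = 0 := by
    intro z x hx
    by_cases h : x ∈ ball (z : Euc N) (r z)
    · rw [(hf0 z x h).1 hx, mul_zero]
    · rw [hbz z x h, zero_mul]
  have hneg : ∀ z : frontier Ω, ∀ x ∈ Ω, b z x * f z x ≤ 0 := by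
    intro z x hx
    by_cases h : x ∈ ball (z : Euc N) (r z)
    · exact mul_nonpos_of_nonneg_of_nonpos (hb0 z x) ((hfΩ z x h).1 hx).le
    · rw [hbz z x h, zero_mul]
  refine ⟨fun x => b0 x - ∑ z ∈ t, b z x * f z x, ⟨?_, ?_⟩, ?_, ?_⟩
  · exact hb00.two_of_top.sub (ContDiff.sum fun z _ => hsm z)
  · intro x hx
    have : b0 x = 0 := image_eq_zero_of_notMem_tsupport fun h => by
      have := hb0s h
      rw [hO.frontier_eq] at hx
      exact hx.2 this
    simp only [this, Finset.sum_eq_zero fun z _ => hfrz z x hx, sub_zero]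
  · intro x hx
    by_cases hxW : x ∈ W
    · obtain ⟨z, hzt, hz⟩ := mem_iUnion₂.1 hxW
      have h1 : b z x = 1 := (hbK z x (ball_subset_closedBall hz)).self_of_nhds
      have h2 : f z x < 0 := (hfΩ z x (ball_subset_ball (by linarith [hr z]) hz)).1 hx
      have : ∑ z ∈ t, b z x * f z x < 0 := by
        refine Finset.sum_neg' (fun z _ => hneg z x hx) ⟨z, hzt, ?_⟩
        rw [h1, one_mul]; exact h2
      have := hb0n x
      show 0 < _
      linarith
    · have h1 : b0 x = 1 := (hb0K x ⟨subset_closure hx, hxW⟩).self_of_nhds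
      have : ∑ z ∈ t, b z x * f z x ≤ 0 := Finset.sum_nonpos fun z _ => hneg z x hx
      show 0 < _
      linarith
  · intro x hx
    obtain ⟨z, hzt, hz⟩ := mem_iUnion₂.1 (ht hx)
    have hzb : x ∈ ball (z : Euc N) (r z) := ball_subset_ball (by linarith [hr z]) hz
    have hdiff : ∀ w : frontier Ω, x ∈ ball (w : Euc N) (r w) → DifferentiableAt ℝ (f w) x :=
      fun w hw => ((hf w).contDiffAt (isOpen_ball.mem_nhds hw)).differentiableAt (by norm_num)
    obtain ⟨e, he⟩ : ∃ e, fderiv ℝ (f z) x e < 0 := by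
      obtain ⟨e, he⟩ := ContinuousLinearMap.exists_ne_zero (hdf z x hzb)
      rcases lt_or_gt_of_ne he with h | h
      · exact ⟨e, h⟩
      · exact ⟨-e, by rw [map_neg]; linarith⟩
    have hcont : Tendsto (fun t : ℝ => x + t • e) (𝓝[>] 0) (𝓝 x) := by
      have : Continuous fun t : ℝ => x + t • e := by fun_prop
      simpa using (this.tendsto 0).mono_left nhdsWithin_le_nhds
    have hin : ∀ᶠ s in 𝓝[>] (0:ℝ), x + s • e ∈ Ω := by
      filter_upwards [eventually_neg_right (hdiff z hzb) ((hf0 z x hzb).1 hx) he,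
        hcont.eventually (isOpen_ball.mem_nhds hzb)] with s hs hs2
      exact (hfΩ z _ hs2).2 hs
    have hterm : ∀ w : frontier Ω, fderiv ℝ (fun y => b w y * f w y) x e ≤ 0 := by
      intro w
      refine fderiv_nonpos_of_nonneg_right ((hsm w).differentiable (by norm_num) x)
        (hfrz w x hx) ?_
      filter_upwards [hin] with s hs using hneg w _ hs
    have hz1 : fderiv ℝ (fun y => b z y * f z y) x e < 0 := by
      have : (fun y => b z y * f z y) =ᶠ[𝓝 x] f z := by
        filter_upwards [hbK z x (ball_subset_closedBall hz)] with y hy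
        rw [hy, one_mul]
      rw [this.fderiv_eq]; exact he
    have hb0d : fderiv ℝ b0 x = 0 := by
      have : b0 =ᶠ[𝓝 x] fun _ => 0 := by
        have : x ∉ tsupport b0 := fun h => by
          rw [hO.frontier_eq] at hx
          exact hx.2 (hb0s h)
        exact notMem_tsupport_iff_eventuallyEq.1 this
      rw [this.fderiv_eq]; simp
    intro hzero
    have h1 : fderiv ℝ (fun x => b0 x - ∑ z ∈ t, b z x * f z x) x e =
        - ∑ z ∈ t, fderiv ℝ (fun y => b z y * f z y) x e := by
      rw [fderiv_fun_sub (hb00.two_of_top.differentiable (by norm_num) x)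
        ((ContDiff.sum fun z _ => hsm z).differentiable (by norm_num) x), hb0d,
        fderiv_fun_sum fun w _ => (hsm w).differentiable (by norm_num) x]
      simp
    rw [hzero] at h1
    have : ∑ z ∈ t, fderiv ℝ (fun y => b z y * f z y) x e < 0 :=
      Finset.sum_neg' (fun w _ => hterm w) ⟨z, hzt, hz1⟩
    simp at h1
    linarith

theorem sum_pd_sq_pos {f : Euc N → ℝ} {x : Euc N} (h : fderiv ℝ f x ≠ 0) :
    0 < ∑ i, (pd i f x) ^ 2 := by
  by_contra! hc
  have h0 : ∀ i ∈ Finset.univ, (pd i f x) ^ 2 = 0 :=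
    (Finset.sum_eq_zero_iff_of_nonneg fun i _ => sq_nonneg _).1
      (le_antisymm hc (Finset.sum_nonneg fun i _ => sq_nonneg _))
  apply h
  ext v
  rw [fderiv_apply_eq_sum_pd]
  simp only [zero_apply]
  refine Finset.sum_eq_zero fun i hi => ?_
  rw [pow_eq_zero_iff two_ne_zero |>.1 (h0 i hi), mul_zero]

theorem lap_sq_norm (x : Euc N) : lap (fun y : Euc N => ‖y‖ ^ 2) x = 2 * N := by
  have h2 : ContDiff ℝ 2 fun y : Euc N => ‖y‖ ^ 2 := contDiff_norm_sq ℝ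
  have hpd : ∀ i : Fin N, pd i (fun y : Euc N => ‖y‖ ^ 2) = fun y => 2 * y i := by
    intro i; ext y
    simp only [pd]
    have := (hasStrictFDerivAt_norm_sq y).hasFDerivAt.fderiv
    rw [this]
    simp [bv, EuclideanSpace.inner_single_right]
  rw [lap_eq_sum_pd h2]
  have : ∀ i : Fin N, pd i (pd i fun y : Euc N => ‖y‖ ^ 2) x = 2 := by
    intro i
    rw [hpd i]
    have hp : HasFDerivAt (fun y : Euc N => y i) (EuclideanSpace.proj i : Euc N →L[ℝ] ℝ) x :=
      (EuclideanSpace.proj i : Euc N →L[ℝ] ℝ).hasFDerivAt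
    simp only [pd]
    rw [(hp.const_mul 2).fderiv]
    simp [bv]
  rw [Finset.sum_congr rfl fun i _ => this i]
  simp [mul_comm]

theorem IsBoundedC2Domain.exists_superharmonic [NeZero N] {Ω : Set (Euc N)}
    (hΩ : IsBoundedC2Domain Ω) : ∃ V : Euc N → ℝ, TestFun Ω V ∧ (∀ x ∈ Ω, 0 ≤ V x) ∧
      ∀ x ∈ Ω, 1 ≤ - lap V x := by
  obtain ⟨ψ, ⟨hψ, hψ0⟩, hψpos, hψd⟩ := hΩ.exists_defining
  have hO := hΩ.1
  have hfr := hΩ.isCompact_frontier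
  have hclos : IsCompact (closure Ω) := hΩ.2.2.1.isCompact_closure
  have hne : (closure Ω).Nonempty := hΩ.2.1.nonempty.closure
  have hfne := hΩ.frontier_nonempty
  have hlapψ := continuous_lap hψ
  have hgradc : Continuous fun x => ∑ i, (pd i ψ x) ^ 2 :=
    continuous_finsetSum _ fun i _ => (continuous_pd (hψ.of_le (by norm_num)) i).pow 2
  obtain ⟨k, hk0, hk⟩ : ∃ k : ℝ, 0 < k ∧ ∀ x ∈ frontier Ω,
      lap ψ x < k * ∑ i, (pd i ψ x) ^ 2 := by
    obtain ⟨x0, hx0, hmin⟩ := hfr.exists_isMinOn hfne hgradc.continuousOn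
    obtain ⟨C, hC0, hC⟩ := exists_bound_of_continuous hlapψ hfr.isBounded
    have hm := sum_pd_sq_pos (hψd x0 hx0)
    refine ⟨(C + 1) / ∑ i, (pd i ψ x0) ^ 2, by positivity, fun x hx => ?_⟩
    have h1 : ∑ i, (pd i ψ x0) ^ 2 ≤ ∑ i, (pd i ψ x) ^ 2 := hmin hx
    calc lap ψ x ≤ C := (le_abs_self _).trans (hC x hx)
      _ < C + 1 := by linarith
      _ = (C + 1) / (∑ i, (pd i ψ x0) ^ 2) * ∑ i, (pd i ψ x0) ^ 2 := by field_simp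
      _ ≤ _ := by gcongr
  set γ : ℝ → ℝ := fun t => 1 - Real.exp (-(k * t)) with hγ
  have hγc : ContDiff ℝ 2 γ := by fun_prop
  have hγ' : deriv γ = fun t => k * Real.exp (-(k * t)) := by
    ext t
    have : HasDerivAt γ (k * Real.exp (-(k * t))) t := by
      have := ((((hasDerivAt_id' t).const_mul k).fun_neg).exp).const_sub 1
      exact this.congr_deriv (by ring)
    exact this.deriv
  have hγ'' : deriv (deriv γ) = fun t => -(k ^ 2 * Real.exp (-(k * t))) := by
    rw [hγ']; ext t
    have : HasDerivAt (fun t => k * Real.exp (-(k * t))) (-(k ^ 2 * Real.exp (-(k * t)))) t := by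
      have := ((((hasDerivAt_id' t).const_mul k).fun_neg).exp).const_mul k
      exact this.congr_deriv (by ring)
    exact this.deriv
  set a : Euc N → ℝ := fun x => γ (ψ x) with ha
  have hac : ContDiff ℝ 2 a := hγc.comp hψ
  have hlapa : ∀ x ∈ frontier Ω, lap a x < 0 := by
    intro x hx
    rw [ha, lap_comp hγc hψ, hγ'', hγ']
    have h1 := hk x hx
    have h2 := Real.exp_pos (-(k * ψ x))
    have : 0 < k * Real.exp (-(k * ψ x)) := by positivity
    nlinarith
  have ha0 : ∀ x ∈ frontier Ω, a x = 0 := fun x hx => by simp [ha, hγ, hψ0 x hx]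
  have hapos : ∀ x ∈ Ω, 0 < a x := fun x hx => by
    have := hψpos x hx
    have : Real.exp (-(k * ψ x)) < 1 := by
      rw [Real.exp_lt_one_iff]; have := mul_pos hk0 this; linarith
    simp only [ha, hγ]; linarith
  obtain ⟨R, hR0, hR⟩ := exists_bound_of_continuous (f := fun x : Euc N => ‖x‖ ^ 2)
    (continuous_norm.pow 2) hclos.isBounded
  set b : Euc N → ℝ := fun x => (R + 1) - ‖x‖ ^ 2 with hb
  have hsq : ContDiff ℝ 2 fun x : Euc N => ‖x‖ ^ 2 := contDiff_norm_sq ℝ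
  have hbc : ContDiff ℝ 2 b := contDiff_const.sub hsq
  have hbpos : ∀ x ∈ closure Ω, 0 < b x := fun x hx => by
    have := (le_abs_self _).trans (hR x hx)
    simp only [hb]; linarith
  have hble : ∀ x, b x ≤ R + 1 := fun x => by simp only [hb]; nlinarith [sq_nonneg ‖x‖]
  have hlapb : ∀ x, lap b x < 0 := by
    intro x
    have h1 : lap b x = lap (fun _ : Euc N => R + 1) x - lap (fun y : Euc N => ‖y‖ ^ 2) x :=
      lap_sub contDiff_const hsq x
    have h2 : lap (fun _ : Euc N => R + 1) x = 0 := by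
      have := lap_const_mul (N := N) 0 (contDiff_const (c := R + 1)) x
      rw [lap_eq_sum_pd contDiff_const]
      refine Finset.sum_eq_zero fun i _ => ?_
      have : pd i (fun _ : Euc N => R + 1) = fun _ => 0 := by ext y; exact pd_const _ _ _
      rw [this, pd_const]
    rw [h1, h2, lap_sq_norm]
    have : (0:ℝ) < N := by exact_mod_cast Nat.pos_of_ne_zero (NeZero.ne N)
    linarith
  have hlapac := continuous_lap hac
  set K : Set (Euc N) := closure Ω ∩ {x | 0 ≤ lap a x} with hK
  have hKc : IsCompact K := hclos.inter_right (isClosed_le continuous_const hlapac)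
  have hKΩ : K ⊆ Ω := by
    rintro x ⟨hx1, hx2⟩
    rcases mem_or_mem_frontier hx1 with h | h
    · exact h
    · exact absurd (hlapa x h) (not_lt.2 hx2)
  obtain ⟨A, hA0, hA⟩ : ∃ A : ℝ, 0 < A ∧ ∀ x ∈ K, b x + 1 ≤ A * a x := by
    rcases K.eq_empty_or_nonempty with he | hKne
    · exact ⟨1, one_pos, by simp [he]⟩
    · obtain ⟨x0, hx0, hmin⟩ := hKc.exists_isMinOn hKne hac.continuous.continuousOn
      have h0 := hapos x0 (hKΩ hx0)
      refine ⟨(R + 2) / a x0, by positivity, fun x hx => ?_⟩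
      have h1 : a x0 ≤ a x := hmin hx
      calc b x + 1 ≤ R + 2 := by linarith [hble x]
        _ = (R + 2) / a x0 * a x0 := by field_simp
        _ ≤ _ := by gcongr
  have hAa : ContDiff ℝ 2 fun x => A * a x := contDiff_const.mul hac
  have hd : ContDiff ℝ 2 fun x => A * a x - b x := hAa.sub hbc
  set V : Euc N → ℝ := fun x => A * a x - cvx (A * a x - b x) with hV
  have hcd : ContDiff ℝ 2 fun x => cvx (A * a x - b x) := contDiff_cvx.comp hd
  have hVc : ContDiff ℝ 2 V := hAa.sub hcd
  have hlapV : ∀ x ∈ closure Ω, lap V x < 0 := by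
    intro x hx
    rw [hV, lap_sub hAa hcd, lap_comp contDiff_cvx hd, lap_sub hAa hbc, lap_const_mul A hac,
      deriv_cvx]
    have h2 := deriv_deriv_cvx_nonneg (A * a x - b x)
    rw [deriv_cvx] at h2
    generalize deriv Real.smoothTransition (A * a x - b x) = q at *
    have h3 : 0 ≤ ∑ i, (pd i (fun x => A * a x - b x) x) ^ 2 :=
      Finset.sum_nonneg fun i _ => sq_nonneg _
    have h4 := mul_nonneg h2 h3
    have h5 := Real.smoothTransition.nonneg (A * a x - b x)
    have h6 := Real.smoothTransition.le_one (A * a x - b x)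
    have h7 := hlapb x
    by_cases hxK : 0 ≤ lap a x
    · have h8 : Real.smoothTransition (A * a x - b x) = 1 :=
        Real.smoothTransition.one_of_one_le (by linarith [hA x ⟨hx, hxK⟩])
      rw [h8]
      linarith
    · push Not at hxK
      have h9 : A * lap a x < 0 := mul_neg_of_pos_of_neg hA0 hxK
      rcases h6.lt_or_eq with h | h
      · nlinarith
      · rw [h]; linarith
  obtain ⟨x0, hx0, hmax⟩ := hclos.exists_isMaxOn hne (continuous_lap hVc).continuousOn
  have hm := hlapV x0 hx0
  have hV0 : ∀ x ∈ frontier Ω, V x = 0 := by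
    intro x hx
    have := hbpos x (frontier_subset_closure hx)
    simp only [hV, ha0 x hx, mul_zero, zero_sub, neg_zero, zero_sub]
    rw [cvx_of_nonpos (by linarith)]; simp
  set c := 1 / (- lap V x0) with hc
  have hcpos : 0 < c := by rw [hc]; exact one_div_pos.2 (by linarith)
  refine ⟨fun x => c * V x, TestFun.const_mul c ⟨hVc, hV0⟩, fun x hx => ?_, fun x hx => ?_⟩
  · refine mul_nonneg hcpos.le ?_
    refine nonneg_of_lap_neg hclos hO subset_closure hVc
      (fun x hx => hlapV x (subset_closure hx)) (fun x hx => ?_) x (subset_closure hx)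
    rcases mem_or_mem_frontier hx.1 with h | h
    · exact absurd h hx.2
    · exact (hV0 x h).ge
  · rw [lap_const_mul c hVc]
    have h1 : lap V x ≤ lap V x0 := hmax (subset_closure hx)
    calc (1:ℝ) = c * (- lap V x0) := by rw [hc, one_div_mul_cancel (by linarith)]
      _ ≤ c * (- lap V x) := by gcongr
      _ = _ := by ring

/-- A linear functional dominated by `φ ↦ ∫ (T φ)⁺ dν` is represented by a density in `[0, 1]`. -/
theorem exists_density_of_le_integral_pos {α X : Type*} [MeasurableSpace α] {ν : Measure α}
    [IsFiniteMeasure ν] [AddCommGroup X] [Module ℝ X] (T : X →ₗ[ℝ] (α → ℝ)) (ℓ : X →ₗ[ℝ] ℝ)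
    (hT : ∀ φ, MemLp (T φ) 2 ν) (hℓ : ∀ φ, ℓ φ ≤ ∫ x, max (T φ x) 0 ∂ν) :
    ∃ θ : α → ℝ, Measurable θ ∧ (∀ x, 0 ≤ θ x) ∧ (∀ x, θ x ≤ 1) ∧
      ∀ φ, ∫ x, θ x * T φ x ∂ν = ℓ φ := by
  set T' : X →ₗ[ℝ] Lp ℝ 2 ν :=
    { toFun := fun φ => (hT φ).toLp (T φ)
      map_add' := fun φ χ => by
        rw [← MemLp.toLp_add]
        exact MemLp.toLp_congr _ _ (by rw [map_add])
      map_smul' := fun c φ => by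
        rw [RingHom.id_apply, ← MemLp.toLp_const_smul]
        exact MemLp.toLp_congr _ _ (by rw [map_smul]) } with hT'
  have hT'c : ∀ φ, T' φ =ᵐ[ν] T φ := fun φ => MemLp.coeFn_toLp (hT φ)
  have hint : ∀ h : Lp ℝ 2 ν, Integrable h ν := fun h => (Lp.memLp h).integrable (by norm_num)
  have hintp : ∀ h : Lp ℝ 2 ν, Integrable (fun x => max (h x) 0) ν := fun h => (hint h).pos_part
  set f : (X × Lp ℝ 2 ν) →ₗ.[ℝ] ℝ :=
    ⟨Submodule.prod ⊤ ⊥, (ℓ ∘ₗ LinearMap.fst ℝ X (Lp ℝ 2 ν)) ∘ₗ Submodule.subtype _⟩ with hf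
  obtain ⟨G, hG1, hG2⟩ := exists_extension_of_le_sublinear f
    (fun p => ∫ x, max ((p.2 + T' p.1) x) 0 ∂ν) (by
      intro c hc p
      rw [← integral_const_mul]
      refine integral_congr_ae ?_
      have h1 : (c • p).2 + T' (c • p).1 = c • (p.2 + T' p.1) := by
        rw [Prod.smul_snd, Prod.smul_fst, map_smul, smul_add]
      rw [h1]
      filter_upwards [Lp.coeFn_smul c (p.2 + T' p.1)] with x hx
      rw [hx, Pi.smul_apply, smul_eq_mul, mul_max_of_nonneg _ _ hc.le, mul_zero]) (by
      intro p q
      rw [← integral_add (hintp _) (hintp _)]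
      refine integral_mono_ae (hintp _) ((hintp _).add (hintp _)) ?_
      have h1 : (p + q).2 + T' (p + q).1 = (p.2 + T' p.1) + (q.2 + T' q.1) := by
        rw [Prod.snd_add, Prod.fst_add, map_add]; abel
      rw [h1]
      filter_upwards [Lp.coeFn_add (p.2 + T' p.1) (q.2 + T' q.1)] with x hx
      rw [hx, Pi.add_apply]
      exact max_le (add_le_add (le_max_left _ _) (le_max_left _ _)) (by positivity)) (by
      rintro ⟨⟨φ, h⟩, hp⟩
      have h0 : h = 0 := by simpa [hf] using hp
      subst h0
      have : f ⟨⟨φ, 0⟩, hp⟩ = ℓ φ := rfl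
      rw [this]
      refine (hℓ φ).trans (le_of_eq (integral_congr_ae ?_))
      simp only [zero_add]
      filter_upwards [hT'c φ] with x hx
      rw [hx])
  have hGφ : ∀ φ, G (φ, 0) = ℓ φ := fun φ => hG1 ⟨(φ, 0), by simp [hf]⟩
  have hle0 : ∀ φ, G (φ, - T' φ) ≤ 0 := by
    intro φ
    refine (hG2 _).trans (le_of_eq ?_)
    simp only [neg_add_cancel]
    rw [integral_eq_zero_of_ae]
    filter_upwards [Lp.coeFn_zero ℝ 2 ν] with x hx
    exact max_eq_right (le_of_eq hx)
  have hGT : ∀ φ, G (0, T' φ) = ℓ φ := by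
    intro φ
    have h1 := hle0 φ
    have h2 := hle0 (-φ)
    have e1 : ((φ, - T' φ) : X × Lp ℝ 2 ν) = (φ, 0) - (0, T' φ) := by simp
    have e2 : ((-φ, - T' (-φ)) : X × Lp ℝ 2 ν) = (0, T' φ) - (φ, 0) := by simp
    rw [e1, map_sub] at h1
    rw [e2, map_sub] at h2
    rw [← hGφ]; linarith
  set H : Lp ℝ 2 ν →ₗ[ℝ] ℝ := G ∘ₗ LinearMap.inr ℝ X (Lp ℝ 2 ν) with hH
  have hHle : ∀ h, H h ≤ ∫ x, max (h x) 0 ∂ν := by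
    intro h
    have := hG2 (0, h)
    simpa [hH] using this
  have hHn : ∀ h, H h ≤ (ν.real univ) ^ (1 / 2 : ℝ) * ‖h‖ := by
    intro h
    refine (hHle h).trans ?_
    have h1 : ∫ x, max (h x) 0 ∂ν ≤ ∫ x, ‖h x‖ ∂ν :=
      integral_mono (hintp h) (hint h).norm fun x => max_le (le_abs_self _) (abs_nonneg _)
    refine h1.trans ?_
    rw [integral_norm_eq_lintegral_enorm (hint h).1, Lp.norm_def, Measure.real,
      ENNReal.toReal_rpow, ← ENNReal.toReal_mul]
    have h2 := eLpNorm_le_eLpNorm_mul_rpow_measure_univ (p := 1) (q := 2) (μ := ν) (f := h)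
      (by norm_num) (Lp.aestronglyMeasurable h)
    rw [eLpNorm_one_eq_lintegral_enorm] at h2
    refine ENNReal.toReal_mono ?_ (h2.trans (le_of_eq ?_))
    · exact ENNReal.mul_ne_top (ENNReal.rpow_ne_top_of_nonneg (by norm_num) (measure_ne_top _ _))
        (Lp.eLpNorm_ne_top h)
    · rw [mul_comm]; norm_num
  have hHabs : ∀ h, ‖H h‖ ≤ (ν.real univ) ^ (1 / 2 : ℝ) * ‖h‖ := by
    intro h
    rw [Real.norm_eq_abs, abs_le]
    have := hHn (-h)
    rw [map_neg, norm_neg] at this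
    exact ⟨by linarith, hHn h⟩
  set Hc : StrongDual ℝ (Lp ℝ 2 ν) := H.mkContinuous _ hHabs with hHc
  set θ := (InnerProductSpace.toDual ℝ (Lp ℝ 2 ν)).symm Hc with hθ
  have hθH : ∀ h, inner ℝ θ h = H h := fun h => by
    rw [hθ, InnerProductSpace.toDual_symm_apply]; rfl
  have hset : ∀ s (hs : MeasurableSet s), ∫ x in s, θ x ∂ν =
      H (indicatorConstLp 2 hs (measure_ne_top ν s) (1:ℝ)) := by
    intro s hs
    rw [← hθH, real_inner_comm, L2.inner_indicatorConstLp_one]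
  have hθ0 : ∀ᵐ x ∂ν, 0 ≤ θ x := by
    refine ae_nonneg_of_forall_setIntegral_nonneg (hint θ) fun s hs _ => ?_
    rw [hset s hs, ← neg_nonpos, ← map_neg]
    refine (hHle _).trans (le_of_eq ?_)
    rw [integral_eq_zero_of_ae]
    filter_upwards [Lp.coeFn_neg (indicatorConstLp 2 (μ := ν) hs (measure_ne_top _ _) (1:ℝ)),
      indicatorConstLp_coeFn (p := 2) (hs := hs) (hμs := measure_ne_top ν s) (c := (1:ℝ))]
      with x hx hx2
    rw [hx, Pi.neg_apply, hx2]
    by_cases h : x ∈ s <;> simp [h]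
  have hθ1 : ∀ᵐ x ∂ν, θ x ≤ 1 := by
    refine ae_le_of_forall_setIntegral_le (hint θ) (integrable_const 1) fun s hs _ => ?_
    rw [hset s hs]
    refine (hHle _).trans (le_of_eq ?_)
    rw [← integral_indicator hs]
    refine integral_congr_ae ?_
    filter_upwards [
      indicatorConstLp_coeFn (p := 2) (hs := hs) (hμs := measure_ne_top ν s) (c := (1:ℝ))]
      with x hx2
    rw [hx2]
    by_cases h : x ∈ s <;> simp [h]
  set θm := (Lp.aestronglyMeasurable θ).mk θ with hθm
  have hmeas : Measurable θm := (Lp.aestronglyMeasurable θ).stronglyMeasurable_mk.measurable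
  refine ⟨fun x => max 0 (min 1 (θm x)), measurable_const.max (measurable_const.min hmeas),
    fun x => le_max_left _ _, fun x => max_le zero_le_one (min_le_left _ _), fun φ => ?_⟩
  · rw [← hGT φ]
    have : G (0, T' φ) = H (T' φ) := rfl
    rw [this, ← hθH, L2.inner_def]
    refine integral_congr_ae ?_
    filter_upwards [hT'c φ, hθ0, hθ1, (Lp.aestronglyMeasurable θ).ae_eq_mk] with x hx h0 h1 h2
    have h3 : θm x = θ x := h2.symm
    rw [hx, h3, min_eq_right h1, max_eq_right h0]; simp [mul_comm]

theorem integral_withDensity_ofReal {α : Type*} [MeasurableSpace α] {μ : Measure α} {w : α → ℝ}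
    (hw : AEMeasurable w μ) (hw0 : ∀ᵐ x ∂μ, 0 ≤ w x) (f : α → ℝ) :
    ∫ x, f x ∂(μ.withDensity fun x => ENNReal.ofReal (w x)) = ∫ x, w x * f x ∂μ := by
  rw [integral_withDensity_eq_integral_toReal_smul₀ hw.ennreal_ofReal
    (Eventually.of_forall fun _ => ENNReal.ofReal_lt_top)]
  refine integral_congr_ae ?_
  filter_upwards [hw0] with x hx
  rw [ENNReal.toReal_ofReal hx, smul_eq_mul]

theorem memMrho_withDensity {Ω : Set (Euc N)} (hΩ : IsOpen Ω) {f : Euc N → ℝ}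
    (hfm : AEMeasurable f (volume.restrict Ω))
    (hf : IntegrableOn (fun x => f x * rho Ω x) Ω) :
    MemMrho Ω ((volume.restrict Ω).withDensity fun x => ENNReal.ofReal (f x)) := by
  constructor
  · exact withDensity_absolutelyContinuous _ _ (by
      rw [Measure.restrict_apply hΩ.measurableSet.compl]; simp)
  · rw [lintegral_withDensity_eq_lintegral_mul₀ hfm.ennreal_ofReal
      (continuous_rho Ω).measurable.ennreal_ofReal.aemeasurable]
    refine lt_of_le_of_lt (lintegral_mono fun x => ?_) hf.2
    simp only [Pi.mul_apply]
    rw [← ENNReal.ofReal_mul' (rho_nonneg _ _)]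
    exact Real.ofReal_le_enorm _

theorem memMrho_add {Ω : Set (Euc N)} {μ ν : Measure (Euc N)} (hμ : MemMrho Ω μ)
    (hν : MemMrho Ω ν) : MemMrho Ω (μ + ν) := by
  refine ⟨by simp [hμ.1, hν.1], ?_⟩
  rw [lintegral_add_measure]
  exact ENNReal.add_lt_top.2 ⟨hμ.2, hν.2⟩

/-- The space of test functions. -/
def testSpace (Ω : Set (Euc N)) : Submodule ℝ (Euc N → ℝ) where
  carrier := {φ | TestFun Ω φ}
  add_mem' h1 h2 := TestFun.add h1 h2
  zero_mem' := ⟨contDiff_const, fun _ _ => rfl⟩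
  smul_mem' c _ h := TestFun.const_mul c h

/-- A supersolution with data `ν₁ + ν₂` dominates a solution with data `ν₁`. -/
theorem exists_split [NeZero N] {Ω : Set (Euc N)} (hΩ : IsBoundedC2Domain Ω) {w c : Euc N → ℝ}
    (hw : IntegrableOn w Ω) (hw0 : ∀ᵐ x ∂volume.restrict Ω, 0 ≤ w x) (hc : Measurable c)
    (hc0 : ∀ x, 0 ≤ c x) {C : ℝ} (hcC : ∀ x, c x ≤ C) {ν₁ ν₂ : Measure (Euc N)}
    (h1 : MemMrho Ω ν₁) (h2 : MemMrho Ω ν₂)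
    (h : ∀ φ, TestFun Ω φ → ∫ x in Ω, w x * (-lap φ x + c x * φ x) = ∫ x, φ x ∂ν₁ + ∫ x, φ x ∂ν₂) :
    ∃ v : Euc N → ℝ, AEStronglyMeasurable v (volume.restrict Ω) ∧
      (∀ᵐ x ∂volume.restrict Ω, 0 ≤ v x ∧ v x ≤ w x) ∧
      ∀ φ, TestFun Ω φ → ∫ x in Ω, v x * (-lap φ x + c x * φ x) = ∫ x, φ x ∂ν₁ := by
  have hO := hΩ.1
  have hwm : AEMeasurable w (volume.restrict Ω) := hw.aemeasurable
  set ν := (volume.restrict Ω).withDensity fun x => ENNReal.ofReal (w x) with hν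
  have hνac : ν ≪ volume.restrict Ω := withDensity_absolutelyContinuous _ _
  haveI : IsFiniteMeasure ν := isFiniteMeasure_withDensity_ofReal hw.2
  have hbd : ∀ φ, TestFun Ω φ → ∃ B, ∀ x ∈ Ω, |-lap φ x + c x * φ x| ≤ B := by
    intro φ hφ
    obtain ⟨B1, -, hB1⟩ := hφ.exists_lap_le hΩ
    obtain ⟨B2, hB20, hB2⟩ := exists_bound_of_continuous hφ.1.continuous hΩ.2.2.1
    refine ⟨B1 + C * B2, fun x hx => (abs_add_le _ _).trans (add_le_add ?_ ?_)⟩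
    · rw [abs_neg]; exact hB1 x hx
    · rw [abs_mul, abs_of_nonneg (hc0 x)]
      exact mul_le_mul (hcC x) (hB2 x hx) (abs_nonneg _) ((hc0 x).trans (hcC x))
  have hTm : ∀ φ, TestFun Ω φ → Measurable fun x => -lap φ x + c x * φ x := fun φ hφ =>
    (continuous_lap hφ.1).measurable.neg.add (hc.mul hφ.1.continuous.measurable)
  have hmem : ∀ᵐ x ∂volume.restrict Ω, x ∈ Ω := ae_restrict_mem hO.measurableSet
  have hwint : ∀ f : Euc N → ℝ, Measurable f → (∃ B, ∀ x ∈ Ω, |f x| ≤ B) →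
      IntegrableOn (fun x => w x * f x) Ω := by
    rintro f hf ⟨B, hB⟩
    refine Integrable.mul_bdd (c := B) hw hf.aestronglyMeasurable ?_
    filter_upwards [hmem] with x hx using hB x hx
  set T : testSpace Ω →ₗ[ℝ] (Euc N → ℝ) :=
    { toFun := fun φ x => -lap (φ : Euc N → ℝ) x + c x * (φ : Euc N → ℝ) x
      map_add' := fun φ χ => by
        ext x
        have : lap ((φ + χ : testSpace Ω) : Euc N → ℝ) x = _ := lap_add φ.2.1 χ.2.1 x
        rw [this]
        simp only [Submodule.coe_add, Pi.add_apply]; ring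
      map_smul' := fun a φ => by
        ext x
        have : lap ((a • φ : testSpace Ω) : Euc N → ℝ) x = _ := lap_const_mul a φ.2.1 x
        rw [this]
        simp only [Submodule.coe_smul, Pi.smul_apply, smul_eq_mul, RingHom.id_apply]; ring }
    with hT
  set ℓ : testSpace Ω →ₗ[ℝ] ℝ :=
    { toFun := fun φ => ∫ x, (φ : Euc N → ℝ) x ∂ν₁
      map_add' := fun φ χ => integral_add (φ.2.integrable hΩ h1) (χ.2.integrable hΩ h1)
      map_smul' := fun a φ => integral_const_mul a _ } with hℓ
  obtain ⟨θ, hθm, hθ0, hθ1, hθ⟩ := exists_density_of_le_integral_pos (ν := ν) T ℓ (by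
      intro φ
      obtain ⟨B, hB⟩ := hbd φ φ.2
      refine MemLp.of_bound (hTm φ φ.2).aestronglyMeasurable B ?_
      filter_upwards [hνac.ae_le hmem] with x hx using hB x hx) (by
      rintro ⟨φ, hφ⟩
      change ∫ x, φ x ∂ν₁ ≤ ∫ x, max (-lap φ x + c x * φ x) 0 ∂ν
      rw [integral_withDensity_ofReal hwm hw0]
      have hφi := hφ.integrable hΩ h1
      have hstep : ∀ n : ℕ, ∫ x, Ω.indicator (fun x => spos (1 / ((n:ℝ) + 1)) (φ x)) x ∂ν₁ ≤
          ∫ x in Ω, w x * max (-lap φ x + c x * φ x) 0 := by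
        intro n
        have hε : (0:ℝ) < 1 / ((n:ℝ) + 1) := by positivity
        set ε := 1 / ((n:ℝ) + 1)
        have hχ := TestFun.spos_comp hO hφ hε
        have hχ0 : ∀ x, 0 ≤ Ω.indicator (fun x => spos ε (φ x)) x := fun x =>
          indicator_nonneg (fun y _ => spos_nonneg hε _) x
        have h3 : 0 ≤ ∫ x, Ω.indicator (fun x => spos ε (φ x)) x ∂ν₂ := integral_nonneg hχ0
        have h4 := h _ hχ
        refine (le_add_of_nonneg_right h3).trans (h4.symm.le.trans ?_)
        refine integral_mono_ae (hwint _ (hTm _ hχ) (hbd _ hχ)) (hwint _ ((hTm _ hφ).max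
          measurable_const) ?_) ?_
        · obtain ⟨B, hB⟩ := hbd φ hφ
          refine ⟨B, fun x hx => ?_⟩
          rw [abs_of_nonneg (le_max_right _ _)]
          exact max_le ((le_abs_self _).trans (hB x hx)) ((abs_nonneg _).trans (hB x hx))
        · filter_upwards [hmem, hw0] with x hx hwx
          refine mul_le_mul_of_nonneg_left ?_ hwx
          rw [lap_indicator hO _ hx, indicator_of_mem hx, lap_comp (contDiff_spos ε) hφ.1]
          have g1 := deriv_deriv_spos_nonneg hε (φ x)
          have g2 : 0 ≤ ∑ i, (pd i φ x) ^ 2 := Finset.sum_nonneg fun i _ => sq_nonneg _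
          have g3 := mul_nonneg g1 g2
          have g4 := mul_le_mul_of_nonneg_left (spos_le_mul_deriv hε (φ x)) (hc0 x)
          have g5 : 0 ≤ deriv (spos ε) (φ x) := by
            rw [deriv_spos hε]; exact Real.smoothTransition.nonneg _
          have g6 : deriv (spos ε) (φ x) ≤ 1 := by
            rw [deriv_spos hε]; exact Real.smoothTransition.le_one _
          have g7 : deriv (spos ε) (φ x) * (-lap φ x + c x * φ x) ≤
              max (-lap φ x + c x * φ x) 0 := by
            rcases le_total 0 (-lap φ x + c x * φ x) with hs | hs
            · rw [max_eq_left hs]; nlinarith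
            · rw [max_eq_right hs]; exact mul_nonpos_of_nonneg_of_nonpos g5 hs
          refine le_trans ?_ g7
          nlinarith
      have hlim : Tendsto (fun n : ℕ =>
          ∫ x, Ω.indicator (fun x => spos (1 / ((n:ℝ) + 1)) (φ x)) x ∂ν₁) atTop
          (𝓝 (∫ x, max (φ x) 0 ∂ν₁)) := by
        refine tendsto_integral_of_dominated_convergence (fun x => |φ x|) (fun n => ?_) hφi.abs
          (fun n => Eventually.of_forall fun x => ?_) ?_
        · have hε : (0:ℝ) < 1 / ((n:ℝ) + 1) := by positivity
          exact (TestFun.spos_comp hO hφ hε).1.continuous.aestronglyMeasurable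
        · have hε : (0:ℝ) < 1 / ((n:ℝ) + 1) := by positivity
          by_cases hx : x ∈ Ω
          · rw [indicator_of_mem hx, Real.norm_eq_abs, abs_of_nonneg (spos_nonneg hε _)]
            exact (spos_le_pos hε _).trans (max_le (le_abs_self _) (abs_nonneg _))
          · rw [indicator_of_notMem hx]; simp
        · filter_upwards [h1.ae_mem] with x hx
          simp only [indicator_of_mem hx]
          exact tendsto_spos _
      refine le_trans (integral_mono hφi hφi.pos_part fun x => le_max_left _ _)
        (le_of_tendsto' hlim hstep))
  refine ⟨fun x => θ x * w x, hθm.aestronglyMeasurable.mul hw.1, ?_, fun φ hφ => ?_⟩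
  · filter_upwards [hw0] with x hx
    exact ⟨mul_nonneg (hθ0 x) hx, mul_le_of_le_one_left hx (hθ1 x)⟩
  · have := hθ ⟨φ, hφ⟩
    rw [integral_withDensity_ofReal hwm hw0] at this
    refine Eq.trans (integral_congr_ae (Eventually.of_forall fun x => ?_)) this
    simp only [hT, LinearMap.coe_mk, AddHom.coe_mk]
    ring

theorem hasCompactSupport_pd {f : Euc N → ℝ} (hf : HasCompactSupport f) (i : Fin N) :
    HasCompactSupport (pd i f) := hf.fderiv_apply (𝕜 := ℝ) (bv i)

theorem integral_mul_pd {f g : Euc N → ℝ} (hf : ContDiff ℝ 1 f) (hg : ContDiff ℝ 1 g)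
    (hc : HasCompactSupport f) (i : Fin N) :
    ∫ x, f x * pd i g x = - ∫ x, pd i f x * g x := by
  refine integral_mul_fderiv_eq_neg_fderiv_mul_of_integrable (v := bv i) ?_ ?_ ?_
    (fun x _ => hf.differentiable (by norm_num) x) (fun x _ => hg.differentiable (by norm_num) x)
  · exact ((continuous_pd hf i).mul hg.continuous).integrable_of_hasCompactSupport
      (hasCompactSupport_pd hc i).mul_right
  · exact (hf.continuous.mul (continuous_pd hg i)).integrable_of_hasCompactSupport hc.mul_right
  · exact (hf.continuous.mul hg.continuous).integrable_of_hasCompactSupport hc.mul_right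

theorem integral_mul_lap {f g : Euc N → ℝ} (hf : ContDiff ℝ 2 f) (hg : ContDiff ℝ 2 g)
    (hc : HasCompactSupport f) : ∫ x, f x * lap g x = ∫ x, lap f x * g x := by
  have e1 : ∀ i : Fin N, ∫ x, f x * pd i (pd i g) x = ∫ x, pd i (pd i f) x * g x := by
    intro i
    have hf1 := hf.pd (m := 1) (by norm_num) i
    rw [integral_mul_pd (hf.of_le (by norm_num)) (hg.pd (by norm_num) i) hc,
      integral_mul_pd hf1 (hg.of_le (by norm_num)) (hasCompactSupport_pd hc i), neg_neg]
  simp_rw [lap_eq_sum_pd hf, lap_eq_sum_pd hg, Finset.mul_sum, Finset.sum_mul]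
  rw [integral_finsetSum, integral_finsetSum]
  · exact Finset.sum_congr rfl fun i _ => e1 i
  · intro i _
    exact ((continuous_pd_pd hf i i).mul hg.continuous).integrable_of_hasCompactSupport
      (hasCompactSupport_pd (hasCompactSupport_pd hc i) i).mul_right
  · intro i _
    exact (hf.continuous.mul (continuous_pd_pd hg i i)).integrable_of_hasCompactSupport hc.mul_right

/-- Comparison with a strictly superharmonic function. -/
theorem le_mul_of_lap_le {Ω : Set (Euc N)} (hΩ : IsBoundedC2Domain Ω) {V : Euc N → ℝ}
    (hV : TestFun Ω V) (hV1 : ∀ x ∈ Ω, 1 ≤ - lap V x) {φ : Euc N → ℝ} (hφ : TestFun Ω φ) {C : ℝ}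
    (hC : ∀ x ∈ Ω, |lap φ x| < C) : ∀ x ∈ Ω, |φ x| ≤ C * V x := by
  have key : ∀ φ, TestFun Ω φ → (∀ x ∈ Ω, |lap φ x| < C) → ∀ x ∈ Ω, φ x ≤ C * V x := by
    intro φ hφ hC x hx
    have hCV := (TestFun.const_mul C hV).sub hφ
    have := nonneg_of_lap_neg hΩ.2.2.1.isCompact_closure hΩ.1 subset_closure hCV.1
      (fun y hy => by
        rw [lap_sub (TestFun.const_mul C hV).1 hφ.1, lap_const_mul C hV.1]
        have h1 := hC y hy
        have h2 := hV1 y hy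
        have h3 := neg_abs_le (lap φ y)
        have h4 := abs_nonneg (lap φ y)
        nlinarith) (fun y hy => by
        rcases mem_or_mem_frontier hy.1 with h | h
        · exact absurd h hy.2
        · exact (hCV.2 y h).ge) x (subset_closure hx)
    linarith
  intro x hx
  rw [abs_le]
  have := key _ hφ.neg (fun y hy => by rw [lap_neg hφ.1, abs_neg]; exact hC y hy) x hx
  exact ⟨by linarith, key φ hφ hC x hx⟩

theorem exists_le_mul_superharmonic {Ω : Set (Euc N)} (hΩ : IsBoundedC2Domain Ω) {V : Euc N → ℝ}
    (hV : TestFun Ω V) (hV1 : ∀ x ∈ Ω, 1 ≤ - lap V x) {φ : Euc N → ℝ} (hφ : TestFun Ω φ) :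
    ∃ C, 0 ≤ C ∧ ∀ x ∈ Ω, |φ x| ≤ C * V x := by
  obtain ⟨C, hC0, hC⟩ := hφ.exists_lap_le hΩ
  exact ⟨C + 1, by linarith, le_mul_of_lap_le hΩ hV hV1 hφ fun x hx => by linarith [hC x hx]⟩

theorem deriv_deriv_spos {ε : ℝ} (hε : 0 < ε) (t : ℝ) :
    deriv (deriv (spos ε)) t = deriv Real.smoothTransition (t / ε - 1) / ε := by
  rw [deriv_spos hε]
  have h1 : HasDerivAt Real.smoothTransition (deriv Real.smoothTransition (t / ε - 1)) (t / ε - 1) :=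
    ((Real.smoothTransition.contDiff (n := 1)).differentiable (by norm_num) _).hasDerivAt
  have h2 : HasDerivAt (fun t : ℝ => t / ε - 1) (1 / ε) t :=
    ((hasDerivAt_id' t).div_const ε).sub_const 1
  have := (h1.comp t h2).deriv
  simp only [Function.comp_def] at this
  rw [this]; ring

theorem deriv_smoothTransition_of_lt {t : ℝ} (ht : t < 0) : deriv Real.smoothTransition t = 0 := by
  have : Real.smoothTransition =ᶠ[𝓝 t] fun _ => 0 := by
    filter_upwards [gt_mem_nhds ht] with s hs using Real.smoothTransition.zero_of_nonpos hs.le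
  rw [this.deriv_eq]; simp

theorem deriv_smoothTransition_of_gt {t : ℝ} (ht : 1 < t) : deriv Real.smoothTransition t = 0 := by
  have : Real.smoothTransition =ᶠ[𝓝 t] fun _ => 1 := by
    filter_upwards [lt_mem_nhds ht] with s hs using Real.smoothTransition.one_of_one_le hs.le
  rw [this.deriv_eq]; simp

theorem exists_mul_deriv_deriv_spos_le : ∃ B : ℝ, ∀ ε : ℝ, 0 < ε → ∀ t : ℝ,
    |t * deriv (deriv (spos ε)) t| ≤ B := by
  have hc : Continuous (deriv Real.smoothTransition) :=
    (Real.smoothTransition.contDiff (n := 1)).continuous_deriv le_rfl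
  obtain ⟨B, hB⟩ := (isCompact_Icc (a := (0:ℝ)) (b := 1)).exists_bound_of_continuousOn hc.continuousOn
  have hB0 : 0 ≤ B := (norm_nonneg _).trans (hB 0 (by simp))
  refine ⟨2 * B, fun ε hε t => ?_⟩
  rw [deriv_deriv_spos hε]
  rcases lt_or_ge (t / ε - 1) 0 with h | h
  · rw [deriv_smoothTransition_of_lt h]; simpa using hB0
  rcases lt_or_ge 1 (t / ε - 1) with h' | h'
  · rw [deriv_smoothTransition_of_gt h']; simpa using hB0
  have h1 := hB (t / ε - 1) ⟨h, h'⟩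
  rw [Real.norm_eq_abs] at h1
  have h2 : |t / ε| ≤ 2 := abs_le.2 ⟨by linarith, by linarith⟩
  calc |t * (deriv Real.smoothTransition (t / ε - 1) / ε)|
      = |t / ε| * |deriv Real.smoothTransition (t / ε - 1)| := by rw [← abs_mul]; ring_nf
    _ ≤ 2 * B := by gcongr

/-- Green's identity for functions vanishing on the boundary, one of them superharmonic. -/
theorem integral_mul_lap_comm [NeZero N] {Ω : Set (Euc N)} (hΩ : IsBoundedC2Domain Ω)
    {V : Euc N → ℝ} (hV : TestFun Ω V) (hV0 : ∀ x ∈ Ω, 0 ≤ V x) (hV1 : ∀ x ∈ Ω, 1 ≤ - lap V x)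
    {φ : Euc N → ℝ} (hφ : TestFun Ω φ) :
    ∫ x in Ω, V x * lap φ x = ∫ x in Ω, lap V x * φ x := by
  have hO := hΩ.1
  haveI : IsFiniteMeasure (volume.restrict Ω) := ⟨by
    rw [Measure.restrict_apply_univ]; exact hΩ.volume_lt_top⟩
  obtain ⟨C, hC0, hC⟩ := exists_le_mul_superharmonic hΩ hV hV1 hφ
  obtain ⟨B, hB⟩ := exists_mul_deriv_deriv_spos_le
  have hmem : ∀ᵐ x ∂volume.restrict Ω, x ∈ Ω := ae_restrict_mem hO.measurableSet
  have hgc : Continuous fun x => ∑ i, (pd i V x) ^ 2 :=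
    continuous_finsetSum _ fun i _ => (continuous_pd (hV.1.of_le (by norm_num)) i).pow 2
  obtain ⟨b1, hb10, hb1⟩ := exists_bound_of_continuous hV.1.continuous hΩ.2.2.1
  obtain ⟨b2, hb20, hb2⟩ := exists_bound_of_continuous (continuous_lap hφ.1) hΩ.2.2.1
  obtain ⟨b3, hb30, hb3⟩ := exists_bound_of_continuous (continuous_lap hV.1) hΩ.2.2.1
  obtain ⟨b4, hb40, hb4⟩ := exists_bound_of_continuous hφ.1.continuous hΩ.2.2.1
  obtain ⟨b5, hb50, hb5⟩ := exists_bound_of_continuous hgc hΩ.2.2.1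
  set ε : ℕ → ℝ := fun n => 1 / ((n:ℝ) + 1) with hε
  have hεp : ∀ n, 0 < ε n := fun n => by simp only [hε]; positivity
  have hε0 : Tendsto ε atTop (𝓝 0) := tendsto_one_div_add_atTop_nhds_zero_nat
  have hlap : ∀ n, ∀ x ∈ Ω, lap (Ω.indicator fun x => spos (ε n) (V x)) x =
      deriv (spos (ε n)) (V x) * lap V x +
        deriv (deriv (spos (ε n))) (V x) * ∑ i, (pd i V x) ^ 2 := fun n x hx => by
    rw [lap_indicator hO _ hx, lap_comp (contDiff_spos _) hV.1]
  have heq : ∀ n, ∫ x in Ω, spos (ε n) (V x) * lap φ x =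
      ∫ x in Ω, (deriv (spos (ε n)) (V x) * lap V x +
        deriv (deriv (spos (ε n))) (V x) * ∑ i, (pd i V x) ^ 2) * φ x := by
    intro n
    have hχ := TestFun.spos_comp hO hV (hεp n)
    have hsub : tsupport (Ω.indicator fun x => spos (ε n) (V x)) ⊆ closure Ω :=
      closure_mono (fun x hx => by
        by_contra h
        exact hx (indicator_of_notMem h _))
    have hcs : HasCompactSupport (Ω.indicator fun x => spos (ε n) (V x)) :=
      HasCompactSupport.of_support_subset_isCompact hΩ.2.2.1.isCompact_closure
        ((subset_tsupport _).trans hsub)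
    have h1 := integral_mul_lap hχ.1 hφ.1 hcs
    have h2 : ∫ x, (Ω.indicator fun x => spos (ε n) (V x)) x * lap φ x =
        ∫ x in Ω, spos (ε n) (V x) * lap φ x := by
      rw [← integral_indicator hO.measurableSet]
      congr 1; ext x
      by_cases hx : x ∈ Ω <;> simp [hx]
    have h3 : ∫ x, lap (Ω.indicator fun x => spos (ε n) (V x)) x * φ x =
        ∫ x in Ω, (deriv (spos (ε n)) (V x) * lap V x +
        deriv (deriv (spos (ε n))) (V x) * ∑ i, (pd i V x) ^ 2) * φ x := by
      rw [← integral_indicator hO.measurableSet]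
      congr 1; ext x
      by_cases hx : x ∈ Ω
      · rw [indicator_of_mem hx, hlap n x hx]
      · rw [indicator_of_notMem hx]
        by_cases hxf : x ∈ frontier Ω
        · rw [hφ.2 x hxf, mul_zero]
        · have hncl : x ∉ closure Ω := fun h => (mem_or_mem_frontier h).elim hx hxf
          have : (Ω.indicator fun x => spos (ε n) (V x)) =ᶠ[𝓝 x] fun _ => 0 := by
            filter_upwards [isClosed_closure.isOpen_compl.mem_nhds hncl] with y hy
            exact indicator_of_notMem (fun h => hy (subset_closure h)) _
          rw [lap_congr this]
          have : lap (fun _ : Euc N => (0:ℝ)) x = 0 := by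
            simpa using lap_const_mul (N := N) 0 (contDiff_const (c := (0:ℝ))) x
          rw [this, zero_mul]
    rw [← h2, h1, h3]
  have hL : Tendsto (fun n => ∫ x in Ω, spos (ε n) (V x) * lap φ x) atTop
      (𝓝 (∫ x in Ω, V x * lap φ x)) := by
    refine tendsto_integral_of_dominated_convergence (fun _ => b1 * b2) (fun n => ?_)
      (integrable_const _) (fun n => ?_) ?_
    · exact (((contDiff_spos _).continuous.comp hV.1.continuous).mul
        (continuous_lap hφ.1)).aestronglyMeasurable
    · filter_upwards [hmem] with x hx
      rw [norm_mul, Real.norm_eq_abs, Real.norm_eq_abs, abs_of_nonneg (spos_nonneg (hεp n) _)]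
      refine mul_le_mul ?_ (hb2 x hx) (abs_nonneg _) hb10
      exact (spos_le_pos (hεp n) _).trans (max_le ((le_abs_self _).trans (hb1 x hx)) hb10)
    · filter_upwards [hmem] with x hx
      have := tendsto_spos (V x)
      rw [max_eq_left (hV0 x hx)] at this
      exact this.mul_const _
  have hR : Tendsto (fun n => ∫ x in Ω, (deriv (spos (ε n)) (V x) * lap V x +
        deriv (deriv (spos (ε n))) (V x) * ∑ i, (pd i V x) ^ 2) * φ x) atTop
      (𝓝 (∫ x in Ω, lap V x * φ x)) := by
    refine tendsto_integral_of_dominated_convergence (fun _ => b3 * b4 + C * B * b5) (fun n => ?_)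
      (integrable_const _) (fun n => ?_) ?_
    · have h1 : Continuous (deriv (spos (ε n))) :=
        (contDiff_spos _).continuous_deriv (by norm_num)
      have h2 : Continuous (deriv (deriv (spos (ε n)))) := by
        have : ContDiff ℝ 1 (deriv (spos (ε n))) :=
          (contDiff_succ_iff_deriv (n := 1)).1 (by rw [one_add_one_eq_two]; exact contDiff_spos (ε n)) |>.2.2
        exact this.continuous_deriv le_rfl
      exact ((((h1.comp hV.1.continuous).mul (continuous_lap hV.1)).add
        ((h2.comp hV.1.continuous).mul hgc)).mul hφ.1.continuous).aestronglyMeasurable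
    · filter_upwards [hmem] with x hx
      rw [add_mul, Real.norm_eq_abs]
      refine (abs_add_le _ _).trans (add_le_add ?_ ?_)
      · rw [abs_mul, abs_mul]
        refine mul_le_mul ?_ (hb4 x hx) (abs_nonneg _) hb30
        have g5 : 0 ≤ deriv (spos (ε n)) (V x) := by
          rw [deriv_spos (hεp n)]; exact Real.smoothTransition.nonneg _
        have g6 : deriv (spos (ε n)) (V x) ≤ 1 := by
          rw [deriv_spos (hεp n)]; exact Real.smoothTransition.le_one _
        rw [abs_of_nonneg g5]
        exact (mul_le_of_le_one_left (abs_nonneg _) g6).trans (hb3 x hx)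
      · have g1 := hB (ε n) (hεp n) (V x)
        rw [abs_mul, abs_of_nonneg (hV0 x hx)] at g1
        rw [abs_mul, abs_mul]
        have g2 := hC x hx
        have g3 := hb5 x hx
        calc |deriv (deriv (spos (ε n))) (V x)| * |∑ i, (pd i V x) ^ 2| * |φ x|
            ≤ |deriv (deriv (spos (ε n))) (V x)| * b5 * (C * V x) := by gcongr
          _ = C * (V x * |deriv (deriv (spos (ε n))) (V x)|) * b5 := by ring
          _ ≤ C * B * b5 := by gcongr
    · filter_upwards [hmem] with x hx
      rcases (hV0 x hx).eq_or_lt with h0 | hpos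
      · have : φ x = 0 := by
          have := hC x hx
          rw [← h0, mul_zero] at this
          exact abs_nonpos_iff.1 this
        simp [this]
      · refine tendsto_const_nhds.congr' ?_
        have : ∀ᶠ n in atTop, 2 * ε n < V x := by
          have : Tendsto (fun n => 2 * ε n) atTop (𝓝 0) := by simpa using hε0.const_mul 2
          exact this.eventually (gt_mem_nhds hpos)
        filter_upwards [this] with n hn
        have h1 : 1 < V x / ε n - 1 := by
          have : 2 < V x / ε n := by rw [lt_div_iff₀ (hεp n)]; exact hn
          linarith
        rw [deriv_deriv_spos (hεp n), deriv_smoothTransition_of_gt h1, deriv_spos (hεp n)]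
        simp only [Real.smoothTransition.one_of_one_le h1.le]; ring
  exact tendsto_nhds_unique hL (hR.congr fun n => (heq n).symm)

/-- Weak solution of the linear Dirichlet problem with bounded data. -/
theorem exists_weak_linear [NeZero N] {Ω : Set (Euc N)} (hΩ : IsBoundedC2Domain Ω)
    {V : Euc N → ℝ} (hV : TestFun Ω V) (hV0 : ∀ x ∈ Ω, 0 ≤ V x) (hV1 : ∀ x ∈ Ω, 1 ≤ - lap V x)
    {c θ : Euc N → ℝ} (hc : Measurable c) (hc0 : ∀ x, 0 ≤ c x) {C : ℝ} (hcC : ∀ x, c x ≤ C)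
    (hθ : Measurable θ) (hθ0 : ∀ x, 0 ≤ θ x) (hθ1 : ∀ x, θ x ≤ 1) :
    ∃ v : Euc N → ℝ, AEStronglyMeasurable v (volume.restrict Ω) ∧
      (∀ᵐ x ∂volume.restrict Ω, 0 ≤ v x ∧ v x ≤ V x) ∧
      ∀ φ, TestFun Ω φ → ∫ x in Ω, v x * (-lap φ x + c x * φ x) = ∫ x in Ω, θ x * φ x := by
  have hO := hΩ.1
  haveI : IsFiniteMeasure (volume.restrict Ω) := ⟨by
    rw [Measure.restrict_apply_univ]; exact hΩ.volume_lt_top⟩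
  have hmem : ∀ᵐ x ∂volume.restrict Ω, x ∈ Ω := ae_restrict_mem hO.measurableSet
  have hbc : ∀ f : Euc N → ℝ, Continuous f → ∃ B, ∀ x ∈ Ω, |f x| ≤ B := fun f hf => by
    obtain ⟨B, -, hB⟩ := exists_bound_of_continuous hf hΩ.2.2.1
    exact ⟨B, hB⟩
  have hint : ∀ f : Euc N → ℝ, Measurable f → (∃ B, ∀ x ∈ Ω, |f x| ≤ B) → IntegrableOn f Ω := by
    rintro f hf ⟨B, hB⟩
    refine Integrable.of_bound hf.aestronglyMeasurable B ?_
    filter_upwards [hmem] with x hx using hB x hx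
  have hmulb : ∀ f g : Euc N → ℝ, (∃ B, ∀ x ∈ Ω, |f x| ≤ B) → (∃ B, ∀ x ∈ Ω, |g x| ≤ B) →
      ∃ B, ∀ x ∈ Ω, |f x * g x| ≤ B := by
    rintro f g ⟨B1, h1⟩ ⟨B2, h2⟩
    exact ⟨B1 * B2, fun x hx => by
      rw [abs_mul]
      exact mul_le_mul (h1 x hx) (h2 x hx) (abs_nonneg _) ((abs_nonneg _).trans (h1 x hx))⟩
  have hcb : ∃ B, ∀ x ∈ Ω, |c x| ≤ B := ⟨C, fun x _ => by rw [abs_of_nonneg (hc0 x)]; exact hcC x⟩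
  have hθb : ∃ B, ∀ x ∈ Ω, |θ x| ≤ B := ⟨1, fun x _ => by rw [abs_of_nonneg (hθ0 x)]; exact hθ1 x⟩
  have hVm := hV.1.continuous.measurable
  have hlm := (continuous_lap hV.1).measurable
  have hρm := (continuous_rho Ω).measurable
  set q : Euc N → ℝ := fun x => - lap V x + c x * V x - θ x with hq
  have hqm : Measurable q := (hlm.neg.add (hc.mul hVm)).sub hθ
  have hq0 : ∀ᵐ x ∂volume.restrict Ω, 0 ≤ q x := by
    filter_upwards [hmem] with x hx
    have := mul_nonneg (hc0 x) (hV0 x hx)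
    have := hV1 x hx
    have := hθ1 x
    simp only [hq]; linarith
  have hI : ∀ f : Euc N → ℝ, Continuous f →
      IntegrableOn (fun x => lap V x * f x) Ω ∧ IntegrableOn (fun x => c x * V x * f x) Ω ∧
      IntegrableOn (fun x => θ x * f x) Ω := fun f hf =>
    ⟨hint _ (hlm.mul hf.measurable) (hmulb _ _ (hbc _ (continuous_lap hV.1)) (hbc f hf)),
      hint _ ((hc.mul hVm).mul hf.measurable)
        (hmulb _ _ (hmulb _ _ hcb (hbc _ hV.1.continuous)) (hbc f hf)),
      hint _ (hθ.mul hf.measurable) (hmulb _ _ hθb (hbc f hf))⟩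
  obtain ⟨v, hvm, hv, hvφ⟩ := exists_split hΩ
    (ν₁ := (volume.restrict Ω).withDensity fun x => ENNReal.ofReal (θ x))
    (ν₂ := (volume.restrict Ω).withDensity fun x => ENNReal.ofReal (q x))
    (hint V hVm (hbc V hV.1.continuous)) (by filter_upwards [hmem] with x hx using hV0 x hx) hc hc0 hcC
    (memMrho_withDensity hO hθ.aemeasurable (hI _ (continuous_rho Ω)).2.2)
    (memMrho_withDensity hO hqm.aemeasurable (by
      obtain ⟨h1, h2, h3⟩ := hI _ (continuous_rho Ω)
      refine ((h1.neg.add h2).sub h3).congr (Eventually.of_forall fun x => ?_)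
      simp only [hq, Pi.sub_apply, Pi.add_apply, Pi.neg_apply]; ring)) (by
    intro φ hφ
    rw [integral_withDensity_ofReal hθ.aemeasurable (Eventually.of_forall hθ0),
      integral_withDensity_ofReal hqm.aemeasurable hq0]
    obtain ⟨h1, h2, h3⟩ := hI φ hφ.1.continuous
    have hVl : IntegrableOn (fun x => V x * lap φ x) Ω :=
      hint _ (hVm.mul (continuous_lap hφ.1).measurable)
        (hmulb _ _ (hbc V hV.1.continuous) (hbc _ (continuous_lap hφ.1)))
    have e1 : ∫ x in Ω, V x * (-lap φ x + c x * φ x) =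
        -(∫ x in Ω, V x * lap φ x) + ∫ x in Ω, c x * V x * φ x := by
      have hVl' : IntegrableOn (fun x => -(V x * lap φ x)) Ω := hVl.neg
      rw [← integral_neg, ← integral_add hVl' h2]
      congr 1; ext x; ring
    have e2 : ∫ x in Ω, q x * φ x = -(∫ x in Ω, lap V x * φ x) + (∫ x in Ω, c x * V x * φ x) -
        ∫ x in Ω, θ x * φ x := by
      have h1' : IntegrableOn (fun x => -(lap V x * φ x)) Ω := h1.neg
      have h12 : IntegrableOn (fun x => -(lap V x * φ x) + c x * V x * φ x) Ω := h1'.add h2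
      rw [← integral_neg, ← integral_add h1' h2, ← integral_sub h12 h3]
      congr 1; ext x; simp only [hq]; ring
    rw [e1, e2, integral_mul_lap_comm hΩ hV hV0 hV1 hφ]; ring)
  refine ⟨v, hvm, hv, fun φ hφ => ?_⟩
  rw [hvφ φ hφ, integral_withDensity_ofReal hθ.aemeasurable (Eventually.of_forall hθ0)]

/-- The diagonal linear map with entries `c`. -/
def diagMap (c : Fin N → ℝ) : Euc N →L[ℝ] Euc N :=
  LinearMap.toContinuousLinearMap
    { toFun := fun x => WithLp.toLp 2 fun k => c k * x k
      map_add' := fun x y => by ext k; simp [mul_add]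
      map_smul' := fun a x => by ext k; simp; ring }

@[simp] theorem diagMap_apply (c : Fin N → ℝ) (x : Euc N) (k : Fin N) :
    diagMap c x k = c k * x k := rfl

theorem diagMap_bv (c : Fin N → ℝ) (k : Fin N) : diagMap c (bv k) = c k • bv k := by
  ext l
  by_cases h : l = k <;> simp [bv, h]

theorem pd_comp_diagMap {f : Euc N → ℝ} (a : Euc N) (c : Fin N → ℝ) {y : Euc N}
    (hf : DifferentiableAt ℝ f (a + diagMap c y)) (k : Fin N) :
    pd k (fun y => f (a + diagMap c y)) y = c k * pd k f (a + diagMap c y) := by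
  have h1 : HasFDerivAt (fun y => a + diagMap c y) (diagMap c) y :=
    (diagMap c).hasFDerivAt.const_add a
  have h2 := hf.hasFDerivAt.comp y h1
  unfold pd
  rw [show (fun y => f (a + diagMap c y)) = f ∘ fun y => a + diagMap c y from rfl, h2.fderiv]
  simp [diagMap_bv]

theorem contDiff_comp_diagMap {f : Euc N → ℝ} {n : WithTop ℕ∞} (hf : ContDiff ℝ n f) (a : Euc N)
    (c : Fin N → ℝ) : ContDiff ℝ n fun y => f (a + diagMap c y) :=
  hf.comp (contDiff_const.add (diagMap c).contDiff)

theorem pd_pd_comp_diagMap {f : Euc N → ℝ} (hf : ContDiff ℝ 2 f) (a : Euc N) (c : Fin N → ℝ)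
    (k l : Fin N) (y : Euc N) :
    pd k (pd l fun y => f (a + diagMap c y)) y = c k * c l * pd k (pd l f) (a + diagMap c y) := by
  have h1 : (pd l fun y => f (a + diagMap c y)) = fun y => c l * pd l f (a + diagMap c y) :=
    funext fun y => pd_comp_diagMap a c (hf.differentiable (by norm_num) _) l
  have h2 : ContDiff ℝ 1 (pd l f) := hf.pd (by norm_num) l
  rw [h1, pd_const_mul _ (((contDiff_comp_diagMap h2 a c).differentiable (by norm_num)) y),
    pd_comp_diagMap a c (h2.differentiable (by norm_num) _)]
  ring

theorem pd_coord (k l : Fin N) (x : Euc N) : pd k (fun x => x l) x = if k = l then 1 else 0 := by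
  have : HasFDerivAt (fun x : Euc N => x l) (EuclideanSpace.proj (𝕜 := ℝ) l) x :=
    (EuclideanSpace.proj (𝕜 := ℝ) l).hasFDerivAt
  unfold pd
  rw [this.fderiv]
  by_cases h : k = l
  · simp [bv, h]
  · simp [bv, h, Ne.symm h]

theorem contDiff_coord {n : WithTop ℕ∞} (l : Fin N) : ContDiff ℝ n fun x : Euc N => x l :=
  (EuclideanSpace.proj (𝕜 := ℝ) l).contDiff

theorem lap_coord (l : Fin N) (x : Euc N) : lap (fun x => x l) x = 0 := by
  rw [lap_eq_sum_pd (contDiff_coord l)]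
  refine Finset.sum_eq_zero fun k _ => ?_
  have : pd k (fun x : Euc N => x l) = fun _ => if k = l then 1 else 0 := funext (pd_coord k l)
  rw [this, pd_const]

theorem lap_coord_sq (l : Fin N) (x : Euc N) : lap (fun x => x l * x l) x = 2 := by
  rw [lap_mul (contDiff_coord l) (contDiff_coord l), lap_coord]
  simp [pd_coord]

theorem lap_sum {ι : Type*} (s : Finset ι) {f : ι → Euc N → ℝ} (hf : ∀ i ∈ s, ContDiff ℝ 2 (f i))
    (x : Euc N) : lap (fun y => ∑ i ∈ s, f i y) x = ∑ i ∈ s, lap (f i) x := by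
  classical
  induction s using Finset.induction_on with
  | empty =>
    simp only [Finset.sum_empty]
    have := lap_const_mul (N := N) 0 (f := fun _ => 0) contDiff_const x
    simpa using this
  | insert a s ha ih =>
    simp only [Finset.sum_insert ha]
    rw [lap_add (hf a (by simp)) (ContDiff.sum fun i hi => hf i (by simp [hi])),
      ih fun i hi => hf i (by simp [hi])]

/-- Half-cube barrier estimate for the gradient. -/
theorem abs_pd_le_of_cube {w : Euc N → ℝ} (hw : ContDiff ℝ 2 w) {a : Euc N} {d M Q : ℝ}
    (hd : 0 < d) (hM0 : 0 ≤ M) (hM : ∀ x : Euc N, (∀ k, |x k - a k| ≤ d) → |w x| ≤ M)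
    (hQ : ∀ x : Euc N, (∀ k, |x k - a k| ≤ d) → |lap w x| ≤ Q) (i : Fin N) :
    |pd i w a| ≤ N * M / d + Q * d / 2 := by
  refine le_of_forall_pos_le_add fun ε hε => ?_
  set q : ℝ := Q / 2 + ε / d with hq
  set cσ : Fin N → ℝ := fun k => if k = i then -1 else 1 with hcσ
  set b : Fin N → ℝ := fun k => if k = i then -(M / d ^ 2) * (N - 1) - q else M / d ^ 2 with hb
  set γ : ℝ := N * M / d + q * d with hγ
  set w1 : Euc N → ℝ := fun y => w (a + diagMap (fun _ => 1) y) with hw1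
  set w2 : Euc N → ℝ := fun y => w (a + diagMap cσ y) with hw2
  have hw1c : ContDiff ℝ 2 w1 := contDiff_comp_diagMap hw _ _
  have hw2c : ContDiff ℝ 2 w2 := contDiff_comp_diagMap hw _ _
  set h : Euc N → ℝ := fun y => w1 y - w2 y with hh
  have hhc : ContDiff ℝ 2 h := hw1c.sub hw2c
  set B : Euc N → ℝ := fun y => (∑ k, b k * (y k * y k)) + γ * y i with hB
  have hsqc : ∀ k, ContDiff ℝ 2 fun y : Euc N => b k * (y k * y k) := fun k =>
    contDiff_const.mul ((contDiff_coord k).mul (contDiff_coord k))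
  have hBc : ContDiff ℝ 2 B :=
    (ContDiff.sum fun k _ => hsqc k).add (contDiff_const.mul (contDiff_coord i))
  have hsumb : ∑ k, b k = -q := by
    have : ∀ k, b k = M / d ^ 2 + if k = i then -(M / d ^ 2) * N - q else 0 := fun k => by
      by_cases hk : k = i
      · simp only [hb, hk, if_true]; ring
      · simp [hb, hk]
    rw [Finset.sum_congr rfl fun k _ => this k, Finset.sum_add_distrib]
    simp
    ring
  have hlapB : ∀ x, lap B x = -(2 * q) := fun x => by
    rw [hB, lap_add (ContDiff.sum fun k _ => hsqc k) (contDiff_const.mul (contDiff_coord i)),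
      lap_sum _ fun k _ => hsqc k, lap_const_mul _ (contDiff_coord i), lap_coord,
      Finset.sum_congr rfl fun k _ => lap_const_mul (b k)
        ((contDiff_coord k).mul (contDiff_coord k)) x]
    simp only [lap_coord_sq]
    rw [← Finset.sum_mul, hsumb]; ring
  have hlapd : ∀ (c : Fin N → ℝ), (∀ k, c k * c k = 1) → ∀ y,
      lap (fun y => w (a + diagMap c y)) y = lap w (a + diagMap c y) := fun c hc y => by
    rw [lap_eq_sum_pd (contDiff_comp_diagMap hw _ _), lap_eq_sum_pd hw]
    exact Finset.sum_congr rfl fun k _ => by rw [pd_pd_comp_diagMap hw, hc, one_mul]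
  set K : Set (Euc N) := {y | (∀ k, |y k| ≤ d) ∧ 0 ≤ y i} with hK
  set U : Set (Euc N) := {y | (∀ k, |y k| < d) ∧ 0 < y i} with hU
  have hcσ1 : ∀ k, cσ k * cσ k = 1 := fun k => by by_cases hk : k = i <;> simp [hcσ, hk]
  have hcσ2 : ∀ k, |cσ k| = 1 := fun k => by by_cases hk : k = i <;> simp [hcσ, hk]
  have hcube1 : ∀ y ∈ K, ∀ k, |(a + diagMap (fun _ => 1) y) k - a k| ≤ d := fun y hy k => by
    simpa using hy.1 k
  have hcube2 : ∀ y ∈ K, ∀ k, |(a + diagMap cσ y) k - a k| ≤ d := fun y hy k => by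
    simpa [abs_mul, hcσ2] using hy.1 k
  have hQ0 : 0 ≤ Q := (abs_nonneg _).trans (hQ a fun k => by simp [hd.le])
  have hq0 : 0 < q := by positivity
  have hUK : U ⊆ K := fun y hy => ⟨fun k => (hy.1 k).le, hy.2.le⟩
  have hKc : IsCompact K := by
    refine Metric.isCompact_of_isClosed_isBounded ?_ ?_
    · have : K = (⋂ k, {y : Euc N | |y k| ≤ d}) ∩ {y | 0 ≤ y i} := by
        ext y; simp [hK]
      rw [this]
      exact (isClosed_iInter fun k => isClosed_le (by fun_prop) continuous_const).inter
        (isClosed_le continuous_const (by fun_prop))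
    · refine (isBounded_closedBall (x := (0 : Euc N)) (r := √(∑ k : Fin N, d ^ 2))).subset
        fun y hy => ?_
      rw [mem_closedBall_zero_iff, EuclideanSpace.norm_eq]
      refine Real.sqrt_le_sqrt (Finset.sum_le_sum fun k _ => ?_)
      rw [Real.norm_eq_abs]
      exact pow_le_pow_left₀ (abs_nonneg _) (hy.1 k) 2
  have hUo : IsOpen U := by
    have : U = (⋂ k, {y : Euc N | |y k| < d}) ∩ {y | 0 < y i} := by
      ext y; simp [hU]
    rw [this]
    exact (isOpen_iInter_of_finite fun k => isOpen_lt (by fun_prop) continuous_const).inter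
      (isOpen_lt continuous_const (by fun_prop))
  have hlaph : ∀ y ∈ K, |lap h y| ≤ 2 * Q := fun y hy => by
    rw [hh, lap_sub hw1c hw2c, hw1, hw2, hlapd _ (by simp), hlapd _ hcσ1]
    have h1 := hQ _ (hcube1 y hy)
    have h2 := hQ _ (hcube2 y hy)
    rw [abs_le] at *
    constructor <;> linarith [h1.1, h1.2, h2.1, h2.2]
  have hhM : ∀ y ∈ K, |h y| ≤ 2 * M := fun y hy => by
    have h1 := hM _ (hcube1 y hy)
    have h2 := hM _ (hcube2 y hy)
    rw [abs_le] at *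
    constructor <;> linarith [h1.1, h1.2, h2.1, h2.2]
  have hBeq : ∀ y, B y = (∑ k, M / d ^ 2 * (y k * y k)) - (M / d ^ 2 * N + q) * (y i * y i)
      + γ * y i := fun y => by
    have : ∀ k, b k * (y k * y k) = M / d ^ 2 * (y k * y k) +
        if k = i then -(M / d ^ 2 * N + q) * (y i * y i) else 0 := fun k => by
      by_cases hk : k = i
      · simp only [hb, hk, if_true]; ring
      · simp [hb, hk]
    rw [hB]
    simp only [this, Finset.sum_add_distrib]
    simp; ring
  have hM2 : 0 ≤ M / d ^ 2 := by positivity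
  have hlin : ∀ y ∈ K, 0 ≤ y i * (d - y i) := fun y hy =>
    mul_nonneg hy.2 (by linarith [le_abs_self (y i), hy.1 i])
  have hBi : ∀ y, B y = (∑ k, M / d ^ 2 * (y k * y k)) +
      (M / d ^ 2 * N + q) * (y i * (d - y i)) := fun y => by
    rw [hBeq, hγ]; field_simp; ring
  have hBbd : ∀ y ∈ K \ U, |h y| ≤ 2 * B y := by
    rintro y ⟨hyK, hyU⟩
    have hsum0 : ∀ k, M / d ^ 2 * (y k * y k) ≤ ∑ k, M / d ^ 2 * (y k * y k) := fun k =>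
      Finset.single_le_sum (f := fun k => M / d ^ 2 * (y k * y k))
        (fun l _ => mul_nonneg hM2 (mul_self_nonneg _)) (Finset.mem_univ k)
    have hr := mul_nonneg (add_nonneg (mul_nonneg hM2 (Nat.cast_nonneg N)) hq0.le) (hlin y hyK)
    by_cases hy0 : y i = 0
    · have : h y = 0 := by
        have : diagMap (fun _ => 1) y = diagMap cσ y := by
          ext k
          by_cases hk : k = i
          · simp [hk, hy0]
          · simp [hcσ, hk]
        simp only [hh, hw1, hw2, this, sub_self]
      rw [this, abs_zero, hBi]
      have := hsum0 i
      have := mul_nonneg hM2 (mul_self_nonneg (y i))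
      linarith
    · have : ∃ k, |y k| = d := by
        by_contra! hne
        exact hyU ⟨fun k => lt_of_le_of_ne (hyK.1 k) (hne k), lt_of_le_of_ne hyK.2 (Ne.symm hy0)⟩
      obtain ⟨k, hk⟩ := this
      have h2 : M / d ^ 2 * (y k * y k) = M := by
        rw [← abs_mul_abs_self, hk]; field_simp
      have := hsum0 k
      rw [hBi]
      linarith [hhM y hyK]
  have hlapsgn : ∀ y ∈ K, |lap h y| < 2 * (2 * q) := fun y hy => by
    have : 0 < ε / d := by positivity
    have := hlaph y hy
    rw [hq]; linarith
  have main : ∀ y ∈ K, |h y| ≤ 2 * B y := fun y hy => by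
    have hB2 : ContDiff ℝ 2 fun y => 2 * B y := contDiff_const.mul hBc
    have h1 := nonneg_of_lap_neg hKc hUo hUK (f := fun y => 2 * B y - h y) (hB2.sub hhc)
      (fun x hx => by
        rw [lap_sub hB2 hhc, lap_const_mul _ hBc, hlapB]
        linarith [(abs_lt.1 (hlapsgn x (hUK hx))).1])
      (fun x hx => by linarith [le_abs_self (h x), hBbd x hx]) y hy
    have h2 := nonneg_of_lap_neg hKc hUo hUK (f := fun y => 2 * B y + h y) (hB2.add hhc)
      (fun x hx => by
        rw [lap_add hB2 hhc, lap_const_mul _ hBc, hlapB]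
        linarith [(abs_lt.1 (hlapsgn x (hUK hx))).2])
      (fun x hx => by linarith [neg_abs_le (h x), hBbd x hx]) y hy
    rw [abs_le]; constructor <;> linarith
  have hd1 : ∀ f : Euc N → ℝ, ContDiff ℝ 2 f → HasDerivAt (fun t : ℝ => f (t • bv i)) (pd i f 0) 0 := by
    intro f hf
    have h1 : HasDerivAt (fun t : ℝ => t • (bv i : Euc N)) (bv i) 0 := by
      simpa using (hasDerivAt_id (0:ℝ)).smul_const (bv i : Euc N)
    have h2 := (hf.differentiable (by norm_num) ((0:ℝ) • bv i)).hasFDerivAt.comp_hasDerivAt _ h1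
    refine h2.congr_deriv ?_
    simp [pd]
  have hpdh : pd i h 0 = 2 * pd i w a := by
    rw [hh, pd_sub (hw1c.differentiable (by norm_num) _) (hw2c.differentiable (by norm_num) _),
      hw1, hw2, pd_comp_diagMap _ _ (hw.differentiable (by norm_num) _),
      pd_comp_diagMap _ _ (hw.differentiable (by norm_num) _)]
    simp [hcσ]; ring
  have hpdB : pd i B 0 = γ := by
    have h1 : HasDerivAt (fun t : ℝ => B (t • bv i)) γ 0 := by
      have : (fun t : ℝ => B (t • bv i)) = fun t => b i * (t * t) + γ * t := by
        funext t
        simp only [hB]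
        rw [Finset.sum_eq_single i]
        · simp [bv]
        · intro k _ hk
          simp [bv, hk]
        · simp
      rw [this]
      have h2 := (((hasDerivAt_id (0:ℝ)).mul (hasDerivAt_id (0:ℝ))).const_mul (b i)).add
        ((hasDerivAt_id (0:ℝ)).const_mul γ)
      exact h2.congr_deriv (by simp)
    exact (hd1 B hBc).unique h1
  have hmem : ∀ t : ℝ, 0 ≤ t → t ≤ d → t • (bv i : Euc N) ∈ K := fun t ht0 htd => by
    refine ⟨fun k => ?_, by simp [bv, ht0]⟩
    by_cases hk : k = i
    · simp [bv, hk, abs_of_nonneg ht0, htd]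
    · simp [bv, hk, hd.le]
  have h00 : h 0 = 0 := by simp [hh, hw1, hw2]
  have hB0 : B 0 = 0 := by simp [hB]
  have hfin : |pd i h 0| ≤ 2 * γ := by
    have key : ∀ f : Euc N → ℝ, ContDiff ℝ 2 f → f 0 = 0 → (∀ y ∈ K, 0 ≤ f y) → 0 ≤ pd i f 0 := by
      intro f hf hf0 hfK
      have h1 := (hd1 f hf).hasDerivWithinAt (s := Ioi 0)
      have h2 := hasDerivWithinAt_iff_tendsto_slope' (by simp) |>.1 h1
      refine ge_of_tendsto h2 ?_
      have : Ioo (0:ℝ) d ∈ 𝓝[>] (0:ℝ) := Ioo_mem_nhdsGT hd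
      filter_upwards [this] with t ht
      rw [slope_def_field]
      simp only [zero_smul, hf0, sub_zero]
      exact div_nonneg (hfK _ (hmem t ht.1.le ht.2.le)) ht.1.le
    have hB2 : ContDiff ℝ 2 fun y => 2 * B y := contDiff_const.mul hBc
    have e1 := key (fun y => 2 * B y - h y) (hB2.sub hhc) (by simp [h00, hB0])
      fun y hy => by linarith [le_abs_self (h y), main y hy]
    have e2 := key (fun y => 2 * B y + h y) (hB2.add hhc) (by simp [h00, hB0])
      fun y hy => by linarith [neg_abs_le (h y), main y hy]
    rw [pd_sub (hB2.differentiable (by norm_num) _) (hhc.differentiable (by norm_num) _),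
      pd_const_mul _ (hBc.differentiable (by norm_num) _), hpdB] at e1
    rw [pd_add (hB2.differentiable (by norm_num) _) (hhc.differentiable (by norm_num) _),
      pd_const_mul _ (hBc.differentiable (by norm_num) _), hpdB] at e2
    rw [abs_le]; constructor <;> linarith
  rw [hpdh, abs_mul, abs_two] at hfin
  have : γ = N * M / d + Q * d / 2 + ε := by rw [hγ, hq]; field_simp; ring
  linarith

theorem abs_pd_le_of_ball [NeZero N] {w : Euc N → ℝ} (hw : ContDiff ℝ 2 w) {a : Euc N} {r M Q : ℝ}
    (hr : 0 < r) (hM0 : 0 ≤ M) (hM : ∀ x ∈ closedBall a r, |w x| ≤ M)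
    (hQ : ∀ x ∈ closedBall a r, |lap w x| ≤ Q) (i : Fin N) :
    |pd i w a| ≤ N ^ 2 * M / r + Q * r := by
  have hN : (1:ℝ) ≤ N := by exact_mod_cast Nat.one_le_iff_ne_zero.2 (NeZero.ne N)
  have hQ0 : 0 ≤ Q := (abs_nonneg _).trans (hQ a (mem_closedBall_self hr.le))
  have hsub : ∀ x : Euc N, (∀ k, |x k - a k| ≤ r / N) → x ∈ closedBall a r := fun x hx => by
    rw [mem_closedBall, EuclideanSpace.dist_eq]
    refine Real.sqrt_le_iff.2 ⟨hr.le, ?_⟩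
    calc ∑ k, dist (x k) (a k) ^ 2 ≤ ∑ _k : Fin N, (r / N) ^ 2 :=
          Finset.sum_le_sum fun k _ => pow_le_pow_left₀ dist_nonneg (by rw [Real.dist_eq]; exact hx k) 2
      _ = r ^ 2 / N := by simp; field_simp
      _ ≤ r ^ 2 := div_le_self (by positivity) hN
  have := abs_pd_le_of_cube hw (d := r / N) (by positivity) hM0 (fun x hx => hM x (hsub x hx))
    (fun x hx => hQ x (hsub x hx)) i
  refine this.trans (add_le_add (le_of_eq (by field_simp)) ?_)
  rw [mul_div_assoc, div_div]
  refine mul_le_mul_of_nonneg_left (div_le_self hr.le ?_) hQ0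
  linarith

/-- The weighted average of translates of `k`. -/
def avg {E : Type*} [NormedAddCommGroup E] [NormedSpace ℝ E] (p : Euc N → ℝ) (τ : Euc N → Euc N)
    (k : Euc N → E) (x : Euc N) : E := ∫ t, p t • k (x + τ t)

section avg
variable {E : Type*} [NormedAddCommGroup E] [NormedSpace ℝ E] {p : Euc N → ℝ} {τ : Euc N → Euc N}

theorem integrable_avg (hp : Integrable p) (hτ : Continuous τ) {k : Euc N → E} (hk : Continuous k)
    (hc : HasCompactSupport k) (x : Euc N) : Integrable fun t => p t • k (x + τ t) := by
  obtain ⟨C, hC⟩ := hk.bounded_above_of_compact_support hc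
  exact hp.smul_bdd C (by fun_prop : Continuous fun t => k (x + τ t)).aestronglyMeasurable
    (Eventually.of_forall fun t => hC _)

theorem continuous_avg (hp : Integrable p) (hτ : Continuous τ) {k : Euc N → E} (hk : Continuous k)
    (hc : HasCompactSupport k) : Continuous (avg p τ k) := by
  obtain ⟨C, hC⟩ := hk.bounded_above_of_compact_support hc
  refine continuous_of_dominated (bound := fun t => ‖p t‖ * C)
    (fun x => (integrable_avg hp hτ hk hc x).aestronglyMeasurable)
    (fun x => Eventually.of_forall fun t => ?_) (hp.norm.mul_const C)
    (Eventually.of_forall fun t => by fun_prop)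
  rw [norm_smul]
  exact mul_le_mul_of_nonneg_left (hC _) (norm_nonneg _)

theorem hasFDerivAt_avg (hp : Integrable p) (hτ : Continuous τ) {k : Euc N → E}
    (hk : ContDiff ℝ 1 k) (hc : HasCompactSupport k) (x : Euc N) :
    HasFDerivAt (avg p τ k) (avg p τ (fderiv ℝ k) x) x := by
  have hk' : Continuous (fderiv ℝ k) := hk.continuous_fderiv (by norm_num)
  obtain ⟨C, hC⟩ := hk'.bounded_above_of_compact_support (hc.fderiv (𝕜 := ℝ))
  refine hasFDerivAt_integral_of_dominated_of_fderiv_le (bound := fun t => ‖p t‖ * C)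
    (F' := fun x t => p t • fderiv ℝ k (x + τ t)) univ_mem
    (Eventually.of_forall fun y =>
      (integrable_avg hp hτ hk.continuous hc y).aestronglyMeasurable)
    (integrable_avg hp hτ hk.continuous hc x)
    (integrable_avg hp hτ hk' (hc.fderiv (𝕜 := ℝ)) x).aestronglyMeasurable
    (Eventually.of_forall fun t y _ => ?_) (hp.norm.mul_const C)
    (Eventually.of_forall fun t y _ => ?_)
  · rw [norm_smul]
    exact mul_le_mul_of_nonneg_left (hC _) (norm_nonneg _)
  · have := (hk.differentiable (by norm_num) (y + τ t)).hasFDerivAt.comp y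
      ((hasFDerivAt_id y).add_const (τ t))
    exact (this.const_smul (p t))

theorem contDiff_avg (hp : Integrable p) (hτ : Continuous τ) {n : ℕ} {k : Euc N → E}
    (hk : ContDiff ℝ n k) (hc : HasCompactSupport k) : ContDiff ℝ n (avg p τ k) := by
  induction n generalizing E with
  | zero =>
    rw [Nat.cast_zero, contDiff_zero] at *
    exact continuous_avg hp hτ hk hc
  | succ n ih =>
    have h1 : ContDiff ℝ 1 k := hk.of_le (by exact_mod_cast Nat.succ_le_succ (Nat.zero_le n))
    push_cast at hk ⊢
    rw [contDiff_succ_iff_fderiv] at hk ⊢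
    refine ⟨fun x => (hasFDerivAt_avg hp hτ h1 hc x).differentiableAt, by simp, ?_⟩
    rw [show fderiv ℝ (avg p τ k) = avg p τ (fderiv ℝ k) from
      funext fun x => (hasFDerivAt_avg hp hτ h1 hc x).fderiv]
    exact ih hk.2.2 (hc.fderiv (𝕜 := ℝ))
end avg

theorem pd_avg {p : Euc N → ℝ} {τ : Euc N → Euc N} (hp : Integrable p) (hτ : Continuous τ)
    {k : Euc N → ℝ} (hk : ContDiff ℝ 1 k) (hc : HasCompactSupport k) (i : Fin N) :
    pd i (avg p τ k) = avg p τ (pd i k) := by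
  funext x
  unfold pd
  rw [(hasFDerivAt_avg hp hτ hk hc x).fderiv]
  unfold avg
  rw [ContinuousLinearMap.integral_apply
    (integrable_avg hp hτ (hk.continuous_fderiv (by norm_num)) (hc.fderiv (𝕜 := ℝ)) x)]
  rfl

theorem lap_avg {p : Euc N → ℝ} {τ : Euc N → Euc N} (hp : Integrable p) (hτ : Continuous τ)
    {k : Euc N → ℝ} (hk : ContDiff ℝ 2 k) (hc : HasCompactSupport k) :
    lap (avg p τ k) = avg p τ (lap k) := by
  funext x
  have h1 : ∀ i, ContDiff ℝ 1 (pd i k) := fun i => hk.pd (by norm_num) i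
  have hc1 : ∀ i, HasCompactSupport (pd i k) := hasCompactSupport_pd hc
  rw [lap_eq_sum_pd (contDiff_avg hp hτ (n := 2) hk hc)]
  have : ∀ i, pd i (pd i (avg p τ k)) x = avg p τ (pd i (pd i k)) x := fun i => by
    rw [pd_avg hp hτ (hk.of_le (by norm_num)) hc, pd_avg hp hτ (h1 i) (hc1 i)]
  rw [Finset.sum_congr rfl fun i _ => this i]
  unfold avg
  rw [← integral_finsetSum _ fun i _ => integrable_avg hp hτ (continuous_pd_pd hk i i)
    (hasCompactSupport_pd (hc1 i) i) x]
  refine integral_congr_ae (Eventually.of_forall fun t => ?_)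
  simp only [lap_eq_sum_pd hk, smul_eq_mul, Finset.mul_sum]

theorem abs_avg_le {p : Euc N → ℝ} {τ : Euc N → Euc N} {k : Euc N → ℝ} {x : Euc N} {C : ℝ}
    (hp : Integrable p) (hk : ∀ t, p t ≠ 0 → |k (x + τ t)| ≤ C) :
    |avg p τ k x| ≤ (∫ t, |p t|) * C := by
  rw [← Real.norm_eq_abs, avg, ← integral_mul_const]
  refine norm_integral_le_of_norm_le (hp.abs.mul_const C) (Eventually.of_forall fun t => ?_)
  rw [norm_smul, Real.norm_eq_abs, Real.norm_eq_abs]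
  by_cases h : p t = 0
  · simp [h]
  · exact mul_le_mul_of_nonneg_left (hk t h) (abs_nonneg _)

section mollify
variable {Ω : Set (Euc N)} {p q V : Euc N → ℝ}

theorem ContDiffBump.tsupport_comp_sub (b : ContDiffBump (0 : Euc N)) (ξ : Euc N) :
    tsupport (fun t => b.normed volume (ξ + diagMap (fun _ => -1) t)) ⊆ closedBall ξ b.rOut := by
  refine closure_minimal (fun t ht => ?_) isClosed_closedBall
  have h1 : ξ + diagMap (fun _ => -1) t ∈ Function.support (b.normed volume) := ht
  rw [b.support_normed_eq, mem_ball_zero_iff] at h1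
  have h2 : ξ + diagMap (fun _ => -1) t = -(t - ξ) := by
    ext k; simp; ring
  rw [h2, norm_neg] at h1
  rw [mem_closedBall, dist_eq_norm]
  exact h1.le

theorem avg_normed_bounds (hp : Integrable p)
    (b : ContDiffBump (0 : Euc N)) {ξ : Euc N} (hb : closedBall ξ b.rOut ⊆ Ω) {B : ℝ}
    (hpB : ∀ᵐ x ∂volume.restrict Ω, x ∈ closedBall ξ b.rOut → 0 ≤ p x ∧ p x ≤ B) :
    0 ≤ avg p (fun t => -t) (b.normed volume) ξ ∧ avg p (fun t => -t) (b.normed volume) ξ ≤ B := by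
  have hsub : ∀ t, t ∉ closedBall ξ b.rOut → b.normed volume (ξ + -t) = 0 := fun t ht => by
    by_contra h
    have h1 : ξ + -t ∈ Function.support (b.normed volume) := h
    rw [b.support_normed_eq, mem_ball_zero_iff] at h1
    refine ht ?_
    rw [mem_closedBall, dist_comm, dist_eq_norm, sub_eq_add_neg]
    exact h1.le
  have hae : ∀ᵐ t, t ∈ closedBall ξ b.rOut → 0 ≤ p t ∧ p t ≤ B := by
    rw [← ae_restrict_iff' isClosed_closedBall.measurableSet]
    have h1 := ae_restrict_of_ae_restrict_of_subset hb hpB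
    filter_upwards [h1, ae_restrict_mem isClosed_closedBall.measurableSet] with t h2 h3
    exact h2 h3
  have hint : ∫ t, b.normed volume (ξ + -t) = 1 := by
    simp_rw [← sub_eq_add_neg]
    rw [integral_sub_left_eq_self (b.normed volume) volume ξ]
    exact b.integral_normed
  have hi2 : Integrable fun t => b.normed volume (ξ + -t) := by
    simp_rw [← sub_eq_add_neg]
    exact (b.contDiff_normed (n := 0)).continuous.integrable_of_hasCompactSupport
      b.hasCompactSupport_normed |>.comp_sub_left ξ
  constructor
  · refine integral_nonneg_of_ae ?_
    filter_upwards [hae] with t ht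
    by_cases h : t ∈ closedBall ξ b.rOut
    · exact smul_nonneg (ht h).1 (b.nonneg_normed _)
    · simp [hsub t h]
  · calc avg p (fun t => -t) (b.normed volume) ξ ≤ ∫ t, B * b.normed volume (ξ + -t) := by
          refine integral_mono_ae (integrable_avg hp continuous_neg
            (b.contDiff_normed (n := 0)).continuous b.hasCompactSupport_normed ξ)
            (hi2.const_mul B) ?_
          filter_upwards [hae] with t ht
          by_cases h : t ∈ closedBall ξ b.rOut
          · exact mul_le_mul_of_nonneg_right (ht h).2 (b.nonneg_normed _)
          · simp [hsub t h]
      _ = B := by rw [integral_const_mul, hint, mul_one]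

theorem abs_lap_avg_normed_le (hΩ : IsOpen Ω) (hp : Integrable p) {Q : ℝ} (hq : ∀ x, |q x| ≤ Q)
    (hpq : ∀ φ, TestFun Ω φ → ∫ x in Ω, p x * (-lap φ x) = ∫ x in Ω, q x * φ x)
    (b : ContDiffBump (0 : Euc N)) {ξ : Euc N} (hb : closedBall ξ b.rOut ⊆ Ω) :
    |lap (avg p (fun t => -t) (b.normed volume)) ξ| ≤ Q := by
  have hc2 : ContDiff ℝ 2 (b.normed volume) := b.contDiff_normed
  set φ : Euc N → ℝ := fun t => b.normed volume (ξ + diagMap (fun _ => -1) t) with hφ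
  have hneg : ∀ t : Euc N, diagMap (fun _ => -1) t = -t := fun t => by ext k; simp
  have hφt : TestFun Ω φ := TestFun.of_tsupport_subset hΩ (contDiff_comp_diagMap hc2 _ _)
    ((b.tsupport_comp_sub ξ).trans hb)
  have hlapφ : ∀ t, lap φ t = lap (b.normed volume) (ξ + -t) := fun t => by
    rw [lap_eq_sum_pd hφt.1, lap_eq_sum_pd hc2, ← hneg]
    exact Finset.sum_congr rfl fun k _ => by rw [hφ, pd_pd_comp_diagMap hc2]; simp
  have hφeq : ∀ t, φ t = b.normed volume (ξ + -t) := fun t => by rw [hφ, ← hneg]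
  have hts := (b.tsupport_comp_sub ξ).trans hb
  have hlapz : ∀ t, t ∉ Ω → lap φ t = 0 := fun t ht => by
    have : φ =ᶠ[𝓝 t] fun _ => 0 * (0:ℝ) :=
      (notMem_tsupport_iff_eventuallyEq.1 fun h => ht (hts h)).trans
        (Eventually.of_forall fun _ => by simp)
    rw [lap_congr this, lap_const_mul 0 contDiff_const, zero_mul]
  have hφ0 : ∀ t, t ∉ Ω → φ t = 0 := fun t ht => image_eq_zero_of_notMem_tsupport fun h => ht (hts h)
  rw [lap_avg hp continuous_neg hc2 b.hasCompactSupport_normed]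
  have h1 : avg p (fun t => -t) (lap (b.normed volume)) ξ = - ∫ x in Ω, q x * φ x := by
    rw [← hpq φ hφt, setIntegral_eq_integral_of_forall_compl_eq_zero
      (fun t ht => by rw [hlapz t ht]; simp), ← integral_neg]
    exact integral_congr_ae (Eventually.of_forall fun t => by simp [hlapφ])
  have hint : ∫ t, φ t = 1 := by
    simp_rw [hφeq, ← sub_eq_add_neg]
    rw [integral_sub_left_eq_self (b.normed volume) volume ξ]
    exact b.integral_normed
  have hi2 : Integrable φ := by
    refine hφt.1.continuous.integrable_of_hasCompactSupport ?_
    exact (isCompact_closedBall ξ b.rOut).of_isClosed_subset (isClosed_tsupport _)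
      (b.tsupport_comp_sub ξ)
  rw [h1, abs_neg, ← Real.norm_eq_abs]
  calc ‖∫ x in Ω, q x * φ x‖ ≤ ∫ x in Ω, Q * φ x := by
        refine norm_integral_le_of_norm_le (hi2.integrableOn.const_mul Q)
          (Eventually.of_forall fun x => ?_)
        rw [norm_mul, Real.norm_eq_abs, Real.norm_eq_abs, abs_of_nonneg (a := φ x)
          (b.nonneg_normed _)]
        exact mul_le_mul_of_nonneg_right (hq x) (b.nonneg_normed _)
    _ = Q := by
        rw [integral_const_mul, setIntegral_eq_integral_of_forall_compl_eq_zero hφ0, hint, mul_one]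

theorem exists_mollification [NeZero N] (hΩ : IsBoundedC2Domain Ω) (hV : TestFun Ω V)
    (hp : Integrable p) (hpV : ∀ᵐ x ∂volume.restrict Ω, 0 ≤ p x ∧ p x ≤ V x) {Q : ℝ}
    (hq : ∀ x, |q x| ≤ Q)
    (hpq : ∀ φ, TestFun Ω φ → ∫ x in Ω, p x * (-lap φ x) = ∫ x in Ω, q x * φ x) :
    ∃ C, 0 ≤ C ∧ ∀ δ : ℕ → ℝ, (∀ n, 0 < δ n) → Tendsto δ atTop (𝓝 0) →
      ∃ P : ℕ → Euc N → ℝ, (∀ n, ContDiff ℝ 2 (P n)) ∧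
        (∀ n, ∀ x ∈ Ω, 4 * δ n ≤ rho Ω x → 0 ≤ P n x ∧ P n x ≤ C * rho Ω x ∧
          |lap (P n) x| ≤ C ∧ ∀ i, |pd i (P n) x| ≤ C) ∧
        ∀ᵐ x, Tendsto (fun n => P n x) atTop (𝓝 (p x)) := by
  obtain ⟨CV, hCV0, hCV⟩ := hV.exists_le_rho hΩ
  have hQ0 : 0 ≤ Q := (abs_nonneg _).trans (hq 0)
  obtain ⟨R, hR0, hR⟩ := exists_bound_of_continuous (continuous_rho Ω) hΩ.2.2.1
  have hRx : ∀ x ∈ Ω, rho Ω x ≤ R := fun x hx => (le_abs_self _).trans (hR x hx)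
  set C : ℝ := 2 * CV + Q + (16 * N ^ 2 * CV + Q * R) with hC
  refine ⟨C, by positivity, fun δ hδ hδ0 => ?_⟩
  let b : ℕ → ContDiffBump (0 : Euc N) := fun n =>
    ⟨δ n / 2, δ n, half_pos (hδ n), half_lt_self (hδ n)⟩
  refine ⟨fun n => avg p (fun t => -t) ((b n).normed volume), fun n =>
    contDiff_avg (n := 2) hp continuous_neg (b n).contDiff_normed (b n).hasCompactSupport_normed,
    fun n ξ hξ hδξ => ?_, ?_⟩
  · have hsub : ∀ x ∈ Ω, δ n < rho Ω x → closedBall x (b n).rOut ⊆ Ω := fun x hx h =>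
      (closedBall_subset_ball h).trans (ball_rho_subset hΩ.1 hx)
    have hbd : ∀ x ∈ Ω, δ n < rho Ω x →
        0 ≤ avg p (fun t => -t) ((b n).normed volume) x ∧
        avg p (fun t => -t) ((b n).normed volume) x ≤ 2 * CV * rho Ω x := fun x hx h => by
      refine avg_normed_bounds hp (b n) (hsub x hx h) ?_
      filter_upwards [hpV] with t ht htb
      refine ⟨ht.1, ht.2.trans ((le_abs_self _).trans ((hCV t (subset_closure
        (hsub x hx h htb))).trans ?_))⟩
      have h1 := rho_le_add Ω t x
      have h2 : dist t x ≤ δ n := htb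
      have : rho Ω t ≤ 2 * rho Ω x := by linarith
      nlinarith
    have hlap : ∀ x ∈ Ω, δ n < rho Ω x →
        |lap (avg p (fun t => -t) ((b n).normed volume)) x| ≤ Q := fun x hx h =>
      abs_lap_avg_normed_le hΩ.1 hp hq hpq (b n) (hsub x hx h)
    have hr := hΩ.rho_pos hξ
    have hδn := hδ n
    have h0 := hbd ξ hξ (by linarith)
    refine ⟨h0.1, h0.2.trans (mul_le_mul_of_nonneg_right ?_ hr.le),
      (hlap ξ hξ (by linarith)).trans ?_, fun i => ?_⟩
    · have : 0 ≤ Q + (16 * N ^ 2 * CV + Q * R) := by positivity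
      linarith
    · have : 0 ≤ 2 * CV + (16 * N ^ 2 * CV + Q * R) := by positivity
      linarith
    · have hball : ∀ x ∈ closedBall ξ (rho Ω ξ / 4), x ∈ Ω ∧ δ n < rho Ω x ∧
          rho Ω x ≤ 2 * rho Ω ξ := fun x hx => by
        have h1 : dist x ξ ≤ rho Ω ξ / 4 := hx
        have h2 := rho_le_add Ω ξ x
        have h3 := rho_le_add Ω x ξ
        rw [dist_comm] at h2
        exact ⟨ball_rho_subset hΩ.1 hξ (by rw [mem_ball]; linarith), by linarith, by linarith⟩
      have := abs_pd_le_of_ball (contDiff_avg (n := 2) hp continuous_neg (b n).contDiff_normed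
        (b n).hasCompactSupport_normed) (a := ξ) (r := rho Ω ξ / 4) (M := 4 * CV * rho Ω ξ)
        (Q := Q) (by positivity) (by positivity)
        (fun x hx => by
          obtain ⟨h1, h2, h3⟩ := hball x hx
          obtain ⟨h4, h5⟩ := hbd x h1 h2
          rw [abs_of_nonneg h4]
          nlinarith)
        (fun x hx => hlap x (hball x hx).1 (hball x hx).2.1) i
      refine this.trans ?_
      have e1 : (N:ℝ) ^ 2 * (4 * CV * rho Ω ξ) / (rho Ω ξ / 4) = 16 * N ^ 2 * CV := by
        field_simp; ring
      have e2 : Q * (rho Ω ξ / 4) ≤ Q * R := mul_le_mul_of_nonneg_left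
        (by linarith [hRx ξ hξ]) hQ0
      rw [e1]
      linarith
  · have := ContDiffBump.ae_convolution_tendsto_right_of_locallyIntegrable (μ := volume)
      (φ := b) (l := atTop) (K := 2) hδ0 (Eventually.of_forall fun n => by
        show δ n ≤ 2 * (δ n / 2); linarith) hp.locallyIntegrable
    filter_upwards [this] with x hx
    refine hx.congr fun n => ?_
    rw [convolution_lsmul_swap]
    unfold avg
    refine integral_congr_ae (Eventually.of_forall fun t => ?_)
    simp [sub_eq_add_neg, mul_comm]
end mollify

/-- `p` has interior approximations which are well behaved away from an arbitrarily thin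
boundary strip. -/
def HasMollification (Ω : Set (Euc N)) (p : Euc N → ℝ) : Prop :=
  ∃ C, 0 ≤ C ∧ ∀ δ : ℕ → ℝ, (∀ n, 0 < δ n) → Tendsto δ atTop (𝓝 0) →
    ∃ P : ℕ → Euc N → ℝ, (∀ n, ContDiff ℝ 2 (P n)) ∧
      (∀ n, ∀ x ∈ Ω, 4 * δ n ≤ rho Ω x → 0 ≤ P n x ∧ P n x ≤ C * rho Ω x ∧
        |lap (P n) x| ≤ C ∧ ∀ i, |pd i (P n) x| ≤ C) ∧
      ∀ᵐ x, Tendsto (fun n => P n x) atTop (𝓝 (p x))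

/-- `p` is an almost everywhere limit of test functions with bounded Laplacians and
asymptotically nonnegative. -/
def IsApproximable (Ω : Set (Euc N)) (p : Euc N → ℝ) : Prop :=
  ∃ (φ : ℕ → Euc N → ℝ) (C : ℝ) (η : ℕ → ℝ), (∀ n, TestFun Ω (φ n)) ∧
    (∀ n, ∀ x ∈ Ω, |lap (φ n) x| ≤ C) ∧ (∀ n, ∀ x ∈ Ω, -η n ≤ φ n x) ∧
    Tendsto η atTop (𝓝 0) ∧ ∀ᵐ x ∂volume.restrict Ω, Tendsto (fun n => φ n x) atTop (𝓝 (p x))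

theorem IsApproximable.add {Ω : Set (Euc N)} {p q : Euc N → ℝ} (hp : IsApproximable Ω p)
    (hq : IsApproximable Ω q) : IsApproximable Ω (fun x => p x + q x) := by
  obtain ⟨φ, C, η, h1, h2, h3, h4, h5⟩ := hp
  obtain ⟨φ', C', η', h1', h2', h3', h4', h5'⟩ := hq
  refine ⟨fun n x => φ n x + φ' n x, C + C', fun n => η n + η' n, fun n => (h1 n).add (h1' n),
    fun n x hx => ?_, fun n x hx => ?_, by simpa using h4.add h4', ?_⟩
  · rw [lap_add (h1 n).1 (h1' n).1]
    exact (abs_add_le _ _).trans (add_le_add (h2 n x hx) (h2' n x hx))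
  · linarith [h3 n x hx, h3' n x hx]
  · filter_upwards [h5, h5'] with x hx hx'
    exact hx.add hx'

theorem IsApproximable.congr {Ω : Set (Euc N)} {p q : Euc N → ℝ} (hp : IsApproximable Ω p)
    (h : ∀ᵐ x ∂volume.restrict Ω, p x = q x) : IsApproximable Ω q := by
  obtain ⟨φ, C, η, h1, h2, h3, h4, h5⟩ := hp
  refine ⟨φ, C, η, h1, h2, h3, h4, ?_⟩
  filter_upwards [h, h5] with x hx hx'
  rwa [← hx]

theorem isApproximable_zero (Ω : Set (Euc N)) : IsApproximable Ω fun _ => 0 :=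
  ⟨fun _ _ => 0, 0, fun _ => 0, fun _ => ⟨contDiff_const, fun _ _ => rfl⟩, fun n x _ => by
    have := lap_const_mul (N := N) 0 (f := fun _ => 0) contDiff_const x
    simp only [mul_zero, zero_mul] at this
    simp [this], fun _ _ _ => by simp, tendsto_const_nhds,
    Eventually.of_forall fun _ => tendsto_const_nhds⟩

theorem abs_lap_mul_le {f g : Euc N → ℝ} (hf : ContDiff ℝ 2 f) (hg : ContDiff ℝ 2 g) {x : Euc N}
    {A B : ℝ} (f0 : |f x| ≤ A) (f1 : ∀ i, |pd i f x| ≤ A) (f2 : |lap f x| ≤ A) (g0 : |g x| ≤ B)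
    (g1 : ∀ i, |pd i g x| ≤ B) (g2 : |lap g x| ≤ B) :
    |lap (fun y => f y * g y) x| ≤ (2 + 2 * N) * (A * B) := by
  have hA : 0 ≤ A := (abs_nonneg _).trans f0
  have hB : 0 ≤ B := (abs_nonneg _).trans g0
  rw [lap_mul hf hg]
  have e1 : |f x * lap g x| ≤ A * B := by rw [abs_mul]; gcongr
  have e2 : |g x * lap f x| ≤ A * B := by rw [abs_mul, mul_comm A]; gcongr
  have e3 : |2 * ∑ i, pd i f x * pd i g x| ≤ 2 * (N * (A * B)) := by
    rw [abs_mul, abs_two]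
    gcongr
    refine (Finset.abs_sum_le_sum_abs _ _).trans ?_
    calc ∑ i, |pd i f x * pd i g x| ≤ ∑ _i : Fin N, A * B :=
          Finset.sum_le_sum fun i _ => by rw [abs_mul]; gcongr; exacts [f1 i, g1 i]
      _ = N * (A * B) := by simp
  have := abs_add_three (f x * lap g x) (g x * lap f x) (2 * ∑ i, pd i f x * pd i g x)
  linarith

theorem exists_bound_derivs {f : Euc N → ℝ} (hf : ContDiff ℝ 2 f) {K : Set (Euc N)}
    (hK : Bornology.IsBounded K) :
    ∃ A, 0 ≤ A ∧ ∀ x ∈ K, |f x| ≤ A ∧ (∀ i, |pd i f x| ≤ A) ∧ |lap f x| ≤ A := by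
  obtain ⟨A0, h0, hA0⟩ := exists_bound_of_continuous hf.continuous hK
  obtain ⟨A2, h2, hA2⟩ := exists_bound_of_continuous (continuous_lap hf) hK
  choose A1 h1 hA1 using fun i : Fin N =>
    exists_bound_of_continuous (continuous_pd (hf.of_le (by norm_num)) i) hK
  have hs : ∀ i, A1 i ≤ ∑ i, A1 i := fun i =>
    Finset.single_le_sum (fun k _ => h1 k) (Finset.mem_univ i)
  have hs0 : 0 ≤ ∑ i, A1 i := Finset.sum_nonneg fun i _ => h1 i
  exact ⟨A0 + ∑ i, A1 i + A2, by positivity, fun x hx => ⟨by linarith [hA0 x hx],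
    fun i => by linarith [hA1 i x hx, hs i], by linarith [hA2 x hx]⟩⟩

theorem lap_eq_zero_of_notMem_tsupport {f : Euc N → ℝ} {x : Euc N} (hx : x ∉ tsupport f) :
    lap f x = 0 := by
  have : f =ᶠ[𝓝 x] fun _ => 0 * (0:ℝ) :=
    (notMem_tsupport_iff_eventuallyEq.1 hx).trans (Eventually.of_forall fun _ => by simp)
  rw [lap_congr this, lap_const_mul 0 contDiff_const, zero_mul]

theorem pd_eq_zero_of_notMem_tsupport {f : Euc N → ℝ} {x : Euc N} (hx : x ∉ tsupport f)
    (i : Fin N) : pd i f x = 0 := by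
  rw [pd_congr (notMem_tsupport_iff_eventuallyEq.1 hx)]
  exact pd_const 0 i x

theorem HasMollification.isApproximable_interior [NeZero N] {Ω : Set (Euc N)} {p : Euc N → ℝ}
    (hΩ : IsBoundedC2Domain Ω) (hp : HasMollification Ω p) {ζ : Euc N → ℝ} (hζ : ContDiff ℝ 2 ζ)
    (hζ0 : ∀ x, 0 ≤ ζ x) (hζc : HasCompactSupport ζ) (hζΩ : tsupport ζ ⊆ Ω) :
    IsApproximable Ω fun x => ζ x * p x := by
  obtain ⟨C, hC0, hC⟩ := hp
  obtain ⟨d, hd0, hd⟩ : ∃ d, 0 < d ∧ ∀ x ∈ tsupport ζ, d ≤ rho Ω x := by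
    rcases (tsupport ζ).eq_empty_or_nonempty with h | h
    · exact ⟨1, one_pos, by simp [h]⟩
    · obtain ⟨x, hx, hmin⟩ := IsCompact.exists_isMinOn hζc h (continuous_rho Ω).continuousOn
      exact ⟨rho Ω x, hΩ.rho_pos (hζΩ hx), fun y hy => hmin hy⟩
  obtain ⟨P, hP, hPb, hPl⟩ := hC (fun n => d / 4 * (1 / ((n:ℝ) + 1))) (fun n => by positivity)
    (by simpa using tendsto_one_div_add_atTop_nhds_zero_nat.const_mul (d / 4))
  obtain ⟨A, hA0, hA⟩ := exists_bound_derivs hζ hζc.isBounded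
  obtain ⟨R, hR0, hR⟩ := exists_bound_of_continuous (continuous_rho Ω) hΩ.2.2.1
  have hb : ∀ n, ∀ x ∈ tsupport ζ, 0 ≤ P n x ∧ P n x ≤ C * rho Ω x ∧
        |lap (P n) x| ≤ C ∧ ∀ i, |pd i (P n) x| ≤ C := fun n x hx => by
    refine hPb n x (hζΩ hx) (le_trans ?_ (hd x hx))
    have : 1 / ((n:ℝ) + 1) ≤ 1 := by
      rw [div_le_one (by positivity)]; linarith [(Nat.cast_nonneg n : (0:ℝ) ≤ n)]
    nlinarith
  have hts : ∀ n, tsupport (fun x => ζ x * P n x) ⊆ tsupport ζ := fun n =>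
    tsupport_mul_subset_left
  refine ⟨fun n x => ζ x * P n x, (2 + 2 * N) * (A * (C * R + C)), fun _ => 0, fun n =>
    TestFun.of_tsupport_subset hΩ.1 (hζ.mul (hP n)) ((hts n).trans hζΩ), fun n x _ => ?_,
    fun n x _ => ?_, tendsto_const_nhds, ?_⟩
  · by_cases hx : x ∈ tsupport ζ
    · obtain ⟨h1, h2, h3, h4⟩ := hb n x hx
      obtain ⟨k1, k2, k3⟩ := hA x hx
      have hCR : 0 ≤ C * R := mul_nonneg hC0 hR0
      have h5 : C * rho Ω x ≤ C * R :=
        mul_le_mul_of_nonneg_left ((le_abs_self _).trans (hR x (hζΩ hx))) hC0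
      exact abs_lap_mul_le hζ (hP n) k1 k2 k3 (by rw [abs_of_nonneg h1]; linarith)
        (fun i => by linarith [h4 i]) (by linarith)
    · rw [lap_eq_zero_of_notMem_tsupport fun h => hx (hts n h), abs_zero]
      positivity
  · rw [neg_zero]
    by_cases hx : x ∈ tsupport ζ
    · exact mul_nonneg (hζ0 x) (hb n x hx).1
    · simp [image_eq_zero_of_notMem_tsupport hx]
  · filter_upwards [ae_restrict_of_ae hPl] with x hx
    exact hx.const_mul _

/-- The projection onto the hyperplane `x j = 0`. -/
def flat (j : Fin N) : Euc N →L[ℝ] Euc N := diagMap fun k => if k = j then 0 else 1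

theorem flat_apply (j k : Fin N) (x : Euc N) : flat j x k = if k = j then 0 else x k := by
  simp [flat]

theorem flat_add_smul_bv (j : Fin N) (x : Euc N) : flat j x + x j • bv j = x := by
  ext k
  by_cases h : k = j <;> simp [flat_apply, bv, h]

theorem flat_bv (j : Fin N) : flat j (bv j) = 0 := by simp [flat, diagMap_bv]

theorem flat_flat (j : Fin N) (x : Euc N) : flat j (flat j x) = flat j x := by
  ext k
  by_cases h : k = j <;> simp [flat_apply, h]

theorem isInvertible_of_apply_one_ne_zero {L : ℝ →L[ℝ] ℝ} (h : L 1 ≠ 0) : L.IsInvertible := by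
  refine ⟨ContinuousLinearEquiv.unitsEquivAut ℝ (Units.mk0 _ h), ?_⟩
  ext
  simp

theorem exists_implicit_graph {f : Euc N → ℝ} {z : Euc N} {j : Fin N} (hf : ContDiffAt ℝ 2 f z)
    (hz : f z = 0) (hj : pd j f z ≠ 0) :
    ∃ ψ : Euc N → ℝ, ContDiff ℝ 2 ψ ∧ HasCompactSupport ψ ∧ ψ (flat j z) = z j ∧
      ∀ᶠ x in 𝓝 z, f (flat j x + ψ (flat j x) • bv j) = 0 := by
  let A : Euc N × ℝ →L[ℝ] Euc N :=
    (flat j).comp (ContinuousLinearMap.fst ℝ _ _) +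
      (ContinuousLinearMap.snd ℝ _ _).smulRight (bv j)
  have hA : ∀ x t, A (x, t) = flat j x + t • bv j := fun x t => by simp [A]
  let u : Euc N × ℝ := (flat j z, z j)
  have hAu : A u = z := by rw [hA, flat_flat, flat_add_smul_bv]
  have hG : ContDiffAt ℝ 2 (fun v => f (A v)) u :=
    ContDiffAt.comp u (by rwa [hAu]) A.contDiff.contDiffAt
  have hd : HasFDerivAt (fun v => f (A v)) ((fderiv ℝ f z).comp A) u :=
    HasFDerivAt.comp u (by rw [hAu]; exact (hf.differentiableAt (by norm_num)).hasFDerivAt)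
      A.hasFDerivAt
  have hinv : (fderiv ℝ (fun v => f (A v)) u ∘L .inr ℝ _ _).IsInvertible := by
    refine isInvertible_of_apply_one_ne_zero ?_
    rw [hd.fderiv]
    simpa [hA, pd] using hj
  set T := hG.implicitFunction (by norm_num) hinv with hT
  have h1 : ∀ᶠ x in 𝓝 (flat j z), f (A (x, T x)) = 0 := by
    have := hG.eventually_apply_implicitFunction (by norm_num) hinv
    rwa [hAu, hz] at this
  have h2 : ContDiffAt ℝ 2 T (flat j z) := hG.contDiffAt_implicitFunction (by norm_num) hinv
  have h3 : T (flat j z) = z j := hG.implicitFunction_apply_self (by norm_num) hinv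
  obtain ⟨U, hU, hUo, hzU⟩ := _root_.eventually_nhds_iff.1 (h2.eventually (by norm_num))
  obtain ⟨κ, hκ, hκc, hκU, -, -, hκ1⟩ := exists_cutoff (isCompact_singleton (x := flat j z)) hUo
    (singleton_subset_iff.2 hzU)
  have hκ1 := hκ1 _ rfl
  have hC : ContDiff ℝ 2 fun x => κ x * T x :=
    contDiff_mul_of_tsupport_subset hUo hκ.two_of_top
      (fun x hx => (hU x hx).contDiffWithinAt) hκU
  have hcont : Tendsto (flat j) (𝓝 z) (𝓝 (flat j z)) := (flat j).continuous.tendsto z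
  refine ⟨fun x => κ x * T x, hC, hκc.mul_right, ?_, ?_⟩
  · simp only [h3, hκ1.self_of_nhds, one_mul]
  · filter_upwards [hcont.eventually hκ1, hcont.eventually h1] with x hx hx'
    rw [hx, one_mul]
    simpa [hA, flat_flat] using hx'

theorem IsBoundedC2Domain.exists_graph {Ω : Set (Euc N)} (hΩ : IsBoundedC2Domain Ω) {z : Euc N}
    (hz : z ∈ frontier Ω) : ∃ (j : Fin N) (ψ : Euc N → ℝ) (s r : ℝ), 0 < r ∧ ContDiff ℝ 2 ψ ∧
      HasCompactSupport ψ ∧ (s = 1 ∨ s = -1) ∧ ∀ x ∈ ball z r,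
        (x ∈ Ω ↔ 0 < s * (x j - ψ (flat j x))) ∧ (x ∈ frontier Ω ↔ x j = ψ (flat j x)) := by
  obtain ⟨f, r0, hr0, hf, hdf, hO, hF⟩ := hΩ.exists_local_defining hz
  have hzr : z ∈ ball z r0 := mem_ball_self hr0
  have hfz : ContDiffAt ℝ 2 f z := hf.contDiffAt (isOpen_ball.mem_nhds hzr)
  obtain ⟨j, hj⟩ : ∃ j, pd j f z ≠ 0 := by
    by_contra! h
    exact hdf z hzr (by ext v; simp [fderiv_apply_eq_sum_pd, h])
  obtain ⟨ψ, hψ, hψc, hψz, hψ0⟩ := exists_implicit_graph hfz ((hF z hzr).1 hz) hj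
  have hdc : ContinuousAt (pd j f) z :=
    (hfz.fderiv_right (m := 1) (by norm_num)).continuousAt.clm_apply continuousAt_const
  obtain ⟨s, hs, hsz⟩ : ∃ s : ℝ, (s = 1 ∨ s = -1) ∧ s * pd j f z < 0 := by
    rcases lt_or_gt_of_ne hj with h | h
    · exact ⟨1, Or.inl rfl, by linarith⟩
    · exact ⟨-1, Or.inr rfl, by linarith⟩
  obtain ⟨r1, hr1, hb1⟩ := Metric.eventually_nhds_iff_ball.1
    ((continuousAt_const.mul hdc).eventually_lt_const hsz)
  obtain ⟨r2, hr2, hb2⟩ := Metric.eventually_nhds_iff_ball.1 hψ0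
  have hS : Tendsto (fun x => flat j x + ψ (flat j x) • bv j) (𝓝 z) (𝓝 z) := by
    have : Continuous fun x => flat j x + ψ (flat j x) • bv j :=
      (flat j).continuous.add ((hψ.continuous.comp (flat j).continuous).smul continuous_const)
    simpa [hψz, flat_add_smul_bv] using this.tendsto z
  obtain ⟨r3, hr3, hb3⟩ := Metric.eventually_nhds_iff_ball.1
    (hS.eventually (ball_mem_nhds z (lt_min hr0 hr1)))
  refine ⟨j, ψ, s, min (min r0 r1) (min r2 r3), by positivity, hψ, hψc, hs, fun x hx => ?_⟩
  simp only [mem_ball, lt_min_iff] at hx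
  obtain ⟨⟨hx0, hx1⟩, hx2, hx3⟩ := hx
  obtain ⟨ξ, hξ, hmv⟩ := domain_mvt (f := f) (f' := fderiv ℝ f) (s := ball z (min r0 r1))
    (x := flat j x + ψ (flat j x) • bv j) (y := x)
    (fun y hy => ((hf.contDiffAt (isOpen_ball.mem_nhds
      (ball_subset_ball (min_le_left _ _) hy))).differentiableAt
        (by norm_num)).hasFDerivAt.hasFDerivWithinAt)
    (convex_ball _ _) (hb3 x hx3) (lt_min hx0 hx1)
  have hξ1 : s * pd j f ξ < 0 := hb1 ξ (ball_subset_ball (min_le_right r0 r1)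
    ((convex_ball _ _).segment_subset (hb3 x hx3) (lt_min hx0 hx1) hξ))
  have he : x - (flat j x + ψ (flat j x) • bv j) = (x j - ψ (flat j x)) • bv j := by
    conv_lhs => enter [1]; rw [← flat_add_smul_bv j x]
    rw [sub_smul]; abel
  rw [he, hb2 x hx2, sub_zero, map_smul, smul_eq_mul] at hmv
  change f x = (x j - ψ (flat j x)) * pd j f ξ at hmv
  rw [hO x hx0, hF x hx0, hmv]
  constructor
  · rcases hs with rfl | rfl
    · rw [one_mul] at hξ1 ⊢
      constructor
      · intro h; nlinarith
      · intro h; nlinarith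
    · have : 0 < pd j f ξ := by linarith
      constructor
      · intro h; nlinarith
      · intro h; nlinarith
  · have : pd j f ξ ≠ 0 := by rintro h; simp [h] at hξ1
    simp [this, sub_eq_zero]

/-- Bounded `C¹` functions with bounded derivative. -/
def BddC1 (f : Euc N → ℝ) : Prop :=
  ContDiff ℝ 1 f ∧ ∃ K, 0 ≤ K ∧ ∀ x, |f x| ≤ K ∧ ‖fderiv ℝ f x‖ ≤ K

theorem bddC1_const (c : ℝ) : BddC1 fun _ : Euc N => c :=
  ⟨contDiff_const, |c|, abs_nonneg c, fun x => ⟨le_rfl, by simp⟩⟩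

theorem BddC1.add {f g : Euc N → ℝ} (hf : BddC1 f) (hg : BddC1 g) :
    BddC1 fun x => f x + g x := by
  obtain ⟨hf, K, hK0, hK⟩ := hf
  obtain ⟨hg, L, hL0, hL⟩ := hg
  refine ⟨hf.add hg, K + L, by positivity, fun x => ⟨?_, ?_⟩⟩
  · exact (abs_add_le _ _).trans (add_le_add (hK x).1 (hL x).1)
  · rw [fderiv_fun_add (hf.differentiable (by norm_num) x) (hg.differentiable (by norm_num) x)]
    exact (norm_add_le _ _).trans (add_le_add (hK x).2 (hL x).2)

theorem BddC1.mul {f g : Euc N → ℝ} (hf : BddC1 f) (hg : BddC1 g) :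
    BddC1 fun x => f x * g x := by
  obtain ⟨hf, K, hK0, hK⟩ := hf
  obtain ⟨hg, L, hL0, hL⟩ := hg
  refine ⟨hf.mul hg, K * L + L * K, by positivity, fun x => ⟨?_, ?_⟩⟩
  · rw [abs_mul]
    have := mul_le_mul (hK x).1 (hL x).1 (abs_nonneg _) hK0
    nlinarith
  · rw [fderiv_fun_mul (hf.differentiable (by norm_num) x) (hg.differentiable (by norm_num) x)]
    refine (norm_add_le _ _).trans ?_
    rw [norm_smul, norm_smul]
    exact add_le_add (mul_le_mul (hK x).1 (hL x).2 (norm_nonneg _) hK0)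
      (mul_le_mul (hL x).1 (hK x).2 (norm_nonneg _) hL0)

theorem BddC1.sum {ι : Type*} (s : Finset ι) {f : ι → Euc N → ℝ} (hf : ∀ i, BddC1 (f i)) :
    BddC1 fun x => ∑ i ∈ s, f i x := by
  classical
  induction s using Finset.induction_on with
  | empty => simpa using bddC1_const 0
  | insert a s ha ih => simpa [Finset.sum_insert ha] using (hf a).add ih

theorem BddC1.inv {f : Euc N → ℝ} (hf : BddC1 f) (h1 : ∀ x, 1 ≤ f x) :
    BddC1 fun x => (f x)⁻¹ := by
  obtain ⟨hf, K, hK0, hK⟩ := hf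
  have h0 : ∀ x, 0 < f x := fun x => zero_lt_one.trans_le (h1 x)
  refine ⟨hf.inv fun x => (h0 x).ne', max 1 K, by positivity, fun x => ⟨?_, ?_⟩⟩
  · rw [abs_of_pos (inv_pos.2 (h0 x))]
    exact (inv_le_one_of_one_le₀ (h1 x)).trans (le_max_left _ _)
  · have := ((hasDerivAt_inv (h0 x).ne').comp_hasFDerivAt x
      (hf.differentiable (by norm_num) x).hasFDerivAt)
    change ‖fderiv ℝ (Inv.inv ∘ f) x‖ ≤ _
    rw [this.fderiv, norm_smul, norm_neg, norm_inv, norm_pow, Real.norm_eq_abs,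
      abs_of_pos (h0 x)]
    have h2 : (f x ^ 2)⁻¹ ≤ 1 := inv_le_one_of_one_le₀ (one_le_pow₀ (h1 x))
    calc (f x ^ 2)⁻¹ * ‖fderiv ℝ f x‖ ≤ 1 * K :=
          mul_le_mul h2 (hK x).2 (norm_nonneg _) zero_le_one
      _ ≤ _ := by rw [one_mul]; exact le_max_right _ _

theorem BddC1.comp_diagMap {f : Euc N → ℝ} (hf : BddC1 f) (c : Fin N → ℝ) :
    BddC1 fun x => f (diagMap c x) := by
  obtain ⟨hf, K, hK0, hK⟩ := hf
  refine ⟨hf.comp (diagMap c).contDiff, K * max 1 ‖diagMap c‖, by positivity,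
    fun x => ⟨(hK _).1.trans (le_mul_of_one_le_right hK0 (le_max_left _ _)), ?_⟩⟩
  have := ((hf.differentiable (by norm_num) (diagMap c x)).hasFDerivAt).comp x
    (diagMap c).hasFDerivAt
  change ‖fderiv ℝ (f ∘ diagMap c) x‖ ≤ _
  rw [this.fderiv]
  exact (ContinuousLinearMap.opNorm_comp_le _ _).trans
    (mul_le_mul (hK _).2 (le_max_right _ _) (norm_nonneg _) hK0)

theorem bddC1_of_hasCompactSupport {f : Euc N → ℝ} (hf : ContDiff ℝ 1 f)
    (hc : HasCompactSupport f) : BddC1 f := by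
  obtain ⟨K, hK⟩ := hf.continuous.bounded_above_of_compact_support hc
  obtain ⟨L, hL⟩ := (hf.continuous_fderiv (by norm_num)).bounded_above_of_compact_support
    (hc.fderiv (𝕜 := ℝ))
  exact ⟨hf, max 0 (max K L), le_max_left _ _, fun x => ⟨(hK x).trans (by simp),
    (hL x).trans (by simp)⟩⟩

theorem abs_sub_le_of_fderiv_le {f : Euc N → ℝ} (hf : ContDiff ℝ 1 f) {K : ℝ}
    (hK : ∀ x, ‖fderiv ℝ f x‖ ≤ K) (x y : Euc N) : |f x - f y| ≤ K * ‖x - y‖ :=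
  convex_univ.norm_image_sub_le_of_norm_fderiv_le
    (fun x _ => hf.differentiable (by norm_num) x) (fun x _ => hK x) (mem_univ y) (mem_univ x)

theorem norm_diagMap_le {c : Fin N → ℝ} {ε : ℝ} (hε : 0 ≤ ε) (hc : ∀ k, |c k| ≤ ε) (z : Euc N) :
    ‖diagMap c z‖ ≤ ε * ‖z‖ := by
  refine (pow_le_pow_iff_left₀ (norm_nonneg _) (by positivity) two_ne_zero).1 ?_
  rw [mul_pow, EuclideanSpace.norm_sq_eq, EuclideanSpace.norm_sq_eq, Finset.mul_sum]
  refine Finset.sum_le_sum fun k _ => ?_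
  rw [diagMap_apply, norm_mul, mul_pow]
  gcongr
  exact hc k

/-- Scaled integration by parts in an averaged integral. -/
theorem integral_mul_pd_diagMap {h w : Euc N → ℝ} (hh : ContDiff ℝ 1 h) (hc : HasCompactSupport h)
    (hw : ContDiff ℝ 1 w) (y : Euc N) (c : Fin N → ℝ) (i : Fin N) :
    c i * ∫ z, h z * pd i w (y + diagMap c z) = -∫ z, pd i h z * w (y + diagMap c z) := by
  rw [← integral_mul_pd hh (contDiff_comp_diagMap hw y c) hc, ← integral_const_mul]
  refine integral_congr_ae (Eventually.of_forall fun z => ?_)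
  simp only
  rw [pd_comp_diagMap y c (hw.differentiable (by norm_num) _)]
  ring

theorem abs_integral_mul_le {h k : Euc N → ℝ} {C : ℝ} (hh : Integrable h)
    (hk : ∀ z, h z ≠ 0 → |k z| ≤ C) : |∫ z, h z * k z| ≤ (∫ z, |h z|) * C := by
  rw [← Real.norm_eq_abs, ← integral_mul_const]
  refine norm_integral_le_of_norm_le (hh.abs.mul_const C) (Eventually.of_forall fun t => ?_)
  rw [norm_mul, Real.norm_eq_abs, Real.norm_eq_abs]
  by_cases h0 : h t = 0
  · simp [h0]
  · exact mul_le_mul_of_nonneg_left (hk t h0) (abs_nonneg _)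

/-- Commutator estimate for anisotropic averages. -/
theorem exists_commutator_bound {h B : Euc N → ℝ} (hh : ContDiff ℝ 1 h)
    (hc : HasCompactSupport h) (hB : BddC1 B) (i : Fin N) :
    ∃ C, 0 ≤ C ∧ ∀ (ε : ℝ) (c : Fin N → ℝ) (w : Euc N → ℝ) (y : Euc N) (M : ℝ), 0 < ε →
      (∀ k, |c k| ≤ ε) → c i = ε → ContDiff ℝ 1 w → 0 ≤ M →
      (∀ z ∈ tsupport h, |w (y + diagMap c z)| ≤ M) →
      |∫ z, h z * ((B (y + diagMap c z) - B y) * pd i w (y + diagMap c z))| ≤ C * M := by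
  obtain ⟨hB, K, hK0, hK⟩ := hB
  obtain ⟨R, hR0, hR⟩ : ∃ R, 0 ≤ R ∧ ∀ z ∈ tsupport h, ‖z‖ ≤ R := by
    obtain ⟨R, hR⟩ := hc.isBounded.exists_norm_le
    exact ⟨max R 0, le_max_right _ _, fun z hz => (hR z hz).trans (le_max_left _ _)⟩
  have hi0 : Integrable h := hh.continuous.integrable_of_hasCompactSupport hc
  have hi1 : Integrable (pd i h) :=
    (continuous_pd hh i).integrable_of_hasCompactSupport (hasCompactSupport_pd hc i)
  have n0 : 0 ≤ ∫ z, |h z| := integral_nonneg fun _ => abs_nonneg _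
  have n1 : 0 ≤ ∫ z, |pd i h z| := integral_nonneg fun _ => abs_nonneg _
  refine ⟨(∫ z, |pd i h z|) * (K * R) + (∫ z, |h z|) * K, by positivity,
    fun ε c w y M hε hck hci hw hM hwM => ?_⟩
  have hBy : ContDiff ℝ 1 fun z => B (y + diagMap c z) := contDiff_comp_diagMap hB y c
  have hwy : Continuous fun z => w (y + diagMap c z) := (contDiff_comp_diagMap hw y c).continuous
  have hBs : ContDiff ℝ 1 fun z => B (y + diagMap c z) - B y := hBy.sub contDiff_const
  have hG : ContDiff ℝ 1 fun z => h z * (B (y + diagMap c z) - B y) := hh.mul hBs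
  have hGc : HasCompactSupport fun z => h z * (B (y + diagMap c z) - B y) := hc.mul_right
  have key := integral_mul_pd_diagMap hG hGc hw y c i
  have hpd : ∀ z, pd i (fun z => h z * (B (y + diagMap c z) - B y)) z =
      h z * (ε * pd i B (y + diagMap c z)) + pd i h z * (B (y + diagMap c z) - B y) := fun z => by
    rw [pd_mul (hh.differentiable (by norm_num) z) (hBs.differentiable (by norm_num) z),
      pd_sub (hBy.differentiable (by norm_num) z) (differentiableAt_const _), pd_const,
      pd_comp_diagMap y c (hB.differentiable (by norm_num) _), hci]
    ring
  have e1 : |∫ z, h z * (ε * pd i B (y + diagMap c z) * w (y + diagMap c z))| ≤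
      (∫ z, |h z|) * (ε * K * M) := abs_integral_mul_le hi0 fun z hz => by
    rw [abs_mul, abs_mul, abs_of_pos hε]
    gcongr
    · exact (abs_pd_le_norm _ _ _).trans (hK _).2
    · exact hwM z (subset_tsupport h hz)
  have e2 : |∫ z, pd i h z * ((B (y + diagMap c z) - B y) * w (y + diagMap c z))| ≤
      (∫ z, |pd i h z|) * (K * (ε * R) * M) := abs_integral_mul_le hi1 fun z hz => by
    have hz' : z ∈ tsupport h := by
      by_contra hn; exact hz (pd_eq_zero_of_notMem_tsupport hn i)
    rw [abs_mul]
    gcongr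
    · refine (abs_sub_le_of_fderiv_le hB (fun x => (hK x).2) _ _).trans ?_
      rw [add_sub_cancel_left]
      gcongr
      exact (norm_diagMap_le hε.le hck z).trans (by gcongr; exact hR z hz')
    · exact hwM z hz'
  have hsplit : ∫ z, pd i (fun z => h z * (B (y + diagMap c z) - B y)) z * w (y + diagMap c z) =
      (∫ z, h z * (ε * pd i B (y + diagMap c z) * w (y + diagMap c z))) +
      ∫ z, pd i h z * ((B (y + diagMap c z) - B y) * w (y + diagMap c z)) := by
    rw [← integral_add]
    · refine integral_congr_ae (Eventually.of_forall fun z => ?_)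
      simp only [hpd]; ring
    · refine Continuous.integrable_of_hasCompactSupport ?_ hc.mul_right
      have : Continuous fun z => pd i B (y + diagMap c z) :=
        (continuous_pd hB i).comp (continuous_const.add (diagMap c).continuous)
      exact hh.continuous.mul ((continuous_const.mul this).mul hwy)
    · exact Continuous.integrable_of_hasCompactSupport
        ((continuous_pd hh i).mul (hBs.continuous.mul hwy)) (hasCompactSupport_pd hc i).mul_right
  rw [hsplit, hci] at key
  have e3 : |ε * ∫ z, h z * (B (y + diagMap c z) - B y) * pd i w (y + diagMap c z)| ≤
      ε * (((∫ z, |pd i h z|) * (K * R) + (∫ z, |h z|) * K) * M) := by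
    rw [key, abs_neg]
    refine (abs_add_le _ _).trans ((add_le_add e1 e2).trans (le_of_eq ?_))
    ring
  rw [abs_mul, abs_of_pos hε] at e3
  have := le_of_mul_le_mul_left e3 hε
  simpa only [mul_assoc] using this

theorem norm_fderiv_le_of_abs_pd_le {f : Euc N → ℝ} {x : Euc N} {C : ℝ} (hC : 0 ≤ C)
    (h : ∀ i, |pd i f x| ≤ C) : ‖fderiv ℝ f x‖ ≤ N * C := by
  refine ContinuousLinearMap.opNorm_le_bound _ (by positivity) fun v => ?_
  rw [fderiv_apply_eq_sum_pd, Real.norm_eq_abs]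
  refine (Finset.abs_sum_le_sum_abs _ _).trans ?_
  calc ∑ i, |v i * pd i f x| ≤ ∑ _i : Fin N, ‖v‖ * C := by
        refine Finset.sum_le_sum fun i _ => ?_
        rw [abs_mul]
        exact mul_le_mul (PiLp.norm_apply_le v i) (h i) (abs_nonneg _) (norm_nonneg _)
    _ = N * C * ‖v‖ := by simp; ring

theorem exists_bump_slab (j : Fin N) : ∃ h : Euc N → ℝ, ContDiff ℝ 2 h ∧ HasCompactSupport h ∧
    (∀ z, 0 ≤ h z) ∧ ∫ z, h z = 1 ∧ ∀ z ∈ tsupport h, 1 ≤ z j ∧ z j ≤ 2 := by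
  let β : ContDiffBump ((3 / 2 : ℝ) • bv j : Euc N) := ⟨1 / 4, 1 / 2, by norm_num, by norm_num⟩
  refine ⟨β.normed volume, β.contDiff_normed.two_of_top, β.hasCompactSupport_normed,
    fun z => β.nonneg_normed z, β.integral_normed, fun z hz => ?_⟩
  rw [β.tsupport_normed_eq, mem_closedBall, dist_eq_norm] at hz
  have := (PiLp.norm_apply_le (z - (3 / 2 : ℝ) • bv j) j).trans hz
  rw [Real.norm_eq_abs, abs_le] at this
  simp [β, bv] at this
  constructor <;> linarith [this.1, this.2]

/-- Anisotropic scaling, of order `ε` tangentially and `ε ^ 2` in the normal direction. -/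
def aniso (j : Fin N) (s ε : ℝ) : Fin N → ℝ := fun k => if k = j then s * ε ^ 2 else ε

/-- The principal part of the Laplacian in sheared coordinates. -/
def shearOp (j : Fin N) (b : Fin N → ℝ) (v : Euc N → ℝ) (y : Euc N) : ℝ :=
  ∑ i, (pd i (pd i v) y - 2 * b i * pd i (pd j v) y + b i ^ 2 * pd j (pd j v) y)

theorem sum_shear_eq (j : Fin N) {b X Y : Fin N → ℝ} (hb : b j = 0) :
    ∑ i, (X i - 2 * b i * Y i + b i ^ 2 * X j) = (1 + ∑ i, b i ^ 2) *
      (X j + ∑ i, ((if i = j then 0 else 1) * (1 + ∑ i, b i ^ 2)⁻¹ * X i +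
        2 * (-b i * (1 + ∑ i, b i ^ 2)⁻¹ * Y i))) := by
  set a := 1 + ∑ i, b i ^ 2 with ha
  have ha0 : a ≠ 0 := by
    have : 0 ≤ ∑ i, b i ^ 2 := Finset.sum_nonneg fun i _ => sq_nonneg _
    linarith
  have e1 : ∑ i, (if i = j then 0 else 1) * X i = ∑ i, X i - X j := by
    rw [← Finset.add_sum_erase _ X (Finset.mem_univ j), add_sub_cancel_left,
      ← Finset.add_sum_erase _ _ (Finset.mem_univ j)]
    simp only [↓reduceIte, zero_mul, zero_add]
    exact Finset.sum_congr rfl fun i hi => by simp [Finset.ne_of_mem_erase hi]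
  have e2 : a * ∑ i, ((if i = j then 0 else 1) * a⁻¹ * X i + 2 * (-b i * a⁻¹ * Y i)) =
      ∑ i, ((if i = j then 0 else 1) * X i - 2 * b i * Y i) := by
    rw [Finset.mul_sum]
    refine Finset.sum_congr rfl fun i _ => ?_
    field_simp
    ring
  rw [mul_add, e2, Finset.sum_add_distrib, Finset.sum_sub_distrib, Finset.sum_sub_distrib, e1,
    ← Finset.sum_mul, ha]
  ring

theorem integral_mul_freeze {h B w : Euc N → ℝ} (hh : Continuous h) (hc : HasCompactSupport h)
    (hB : Continuous B) (hw : Continuous w) (β : ℝ) :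
    ∫ z, h z * (B z * w z) = (∫ z, h z * ((B z - β) * w z)) + β * ∫ z, h z * w z := by
  rw [← integral_const_mul, ← integral_add]
  · exact integral_congr_ae (Eventually.of_forall fun z => by simp only; ring)
  · exact (hh.mul ((hB.sub continuous_const).mul hw)).integrable_of_hasCompactSupport hc.mul_right
  · exact ((hh.mul hw).integrable_of_hasCompactSupport hc.mul_right).const_mul _

theorem integral_mul_principal {ι : Type*} (s : Finset ι) {h w : Euc N → ℝ}
    {A B X Y : ι → Euc N → ℝ} (hh : Continuous h) (hc : HasCompactSupport h) (hw : Continuous w)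
    (hA : ∀ i, Continuous (A i)) (hB : ∀ i, Continuous (B i)) (hX : ∀ i, Continuous (X i))
    (hY : ∀ i, Continuous (Y i)) (α β : ι → ℝ) :
    ∫ z, h z * (w z + ∑ i ∈ s, (A i z * X i z + 2 * (B i z * Y i z))) =
      ((∫ z, h z * w z) + ∑ i ∈ s, (α i * (∫ z, h z * X i z) + 2 * (β i * ∫ z, h z * Y i z))) +
      ∑ i ∈ s, ((∫ z, h z * ((A i z - α i) * X i z)) +
        2 * ∫ z, h z * ((B i z - β i) * Y i z)) := by
  have hI : ∀ k : Euc N → ℝ, Continuous k → Integrable fun z => h z * k z := fun k hk =>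
    (hh.mul hk).integrable_of_hasCompactSupport hc.mul_right
  have h1 : ∀ i, Integrable fun z => h z * (A i z * X i z) := fun i => hI _ ((hA i).mul (hX i))
  have h2 : ∀ i, Integrable fun z => 2 * (h z * (B i z * Y i z)) := fun i =>
    (hI _ ((hB i).mul (hY i))).const_mul 2
  have h12 : ∀ i, Integrable fun z => h z * (A i z * X i z) + 2 * (h z * (B i z * Y i z)) :=
    fun i => (h1 i).add (h2 i)
  have h3 : Integrable fun z => ∑ i ∈ s, (h z * (A i z * X i z) + 2 * (h z * (B i z * Y i z))) :=
    integrable_finsetSum _ fun i _ => h12 i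
  calc ∫ z, h z * (w z + ∑ i ∈ s, (A i z * X i z + 2 * (B i z * Y i z)))
      = ∫ z, (h z * w z + ∑ i ∈ s, (h z * (A i z * X i z) + 2 * (h z * (B i z * Y i z)))) := by
        refine integral_congr_ae (Eventually.of_forall fun z => ?_)
        simp only [mul_add, Finset.mul_sum]
        refine congrArg _ (Finset.sum_congr rfl fun i _ => by ring)
    _ = (∫ z, h z * w z) + ∑ i ∈ s, ((∫ z, h z * (A i z * X i z)) +
          2 * ∫ z, h z * (B i z * Y i z)) := by
        rw [integral_add (hI _ hw) h3, integral_finsetSum _ fun i _ => h12 i]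
        refine congrArg _ (Finset.sum_congr rfl fun i _ => ?_)
        rw [integral_add (h1 i) (h2 i), integral_const_mul]
    _ = _ := by
        rw [add_assoc, ← Finset.sum_add_distrib]
        refine congrArg _ (Finset.sum_congr rfl fun i _ => ?_)
        rw [integral_mul_freeze hh hc (hA i) (hX i) (α i),
          integral_mul_freeze hh hc (hB i) (hY i) (β i)]
        ring

theorem abs_aniso_le {j : Fin N} {s ε : ℝ} (hs : s = 1 ∨ s = -1) (hε : 0 < ε) (hε1 : ε ≤ 1)
    (k : Fin N) : |aniso j s ε k| ≤ ε := by
  unfold aniso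
  split_ifs
  · rcases hs with rfl | rfl <;> simp [abs_of_pos (pow_pos hε 2)] <;> nlinarith
  · rw [abs_of_pos hε]

theorem mul_aniso_apply {j : Fin N} {s : ℝ} (hs : s = 1 ∨ s = -1) (ε : ℝ) (y z : Euc N) :
    s * (y + diagMap (aniso j s ε) z) j = s * y j + ε ^ 2 * z j := by
  rcases hs with rfl | rfl <;> simp [aniso] <;> ring

/-- Bounds for the anisotropic regularization of a function controlled away from a thin strip. -/
theorem exists_aniso_bound {j : Fin N} {s : ℝ} (hs : s = 1 ∨ s = -1) {h : Euc N → ℝ}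
    (hh : ContDiff ℝ 2 h) (hc : HasCompactSupport h) (h0 : ∀ z, 0 ≤ h z) (h1 : ∫ z, h z = 1)
    (hj : ∀ z ∈ tsupport h, 1 ≤ z j ∧ z j ≤ 2) {b : Fin N → Euc N → ℝ} (hb : ∀ i, BddC1 (b i))
    (hbj : ∀ x, b j x = 0) {C : ℝ} (hC : 0 ≤ C) :
    ∃ C', 0 ≤ C' ∧ ∀ ε, 0 < ε → ε ≤ 1 → ∀ v : Euc N → ℝ, ContDiff ℝ 2 v → HasCompactSupport v →
      (∀ y, ε ^ 2 ≤ s * y j → 0 ≤ v y ∧ v y ≤ C * (s * y j) ∧ (∀ i, |pd i v y| ≤ C) ∧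
        |shearOp j (fun i => b i y) v y| ≤ C) →
      ∃ V : Euc N → ℝ, ContDiff ℝ 2 V ∧
        (∀ y, 0 ≤ s * y j → 0 ≤ V y ∧ V y ≤ C' * (s * y j + ε ^ 2) ∧ (∀ i, |pd i V y| ≤ C') ∧
          |shearOp j (fun i => b i y) V y| ≤ C') ∧
        (∀ y, y j = 0 → ∀ i, i ≠ j → |pd i (pd i V) y| ≤ C') ∧
        ∀ y, ε ^ 2 ≤ s * y j → |V y - v y| ≤ C' * ε := by
  have hh1 : ContDiff ℝ 1 h := hh.of_le (by norm_num)
  have hi0 : Integrable h := hh.continuous.integrable_of_hasCompactSupport hc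
  have habs : ∫ z, |h z| = 1 := by simp_rw [abs_of_nonneg (h0 _)]; exact h1
  have ha : BddC1 fun x => 1 + ∑ i, b i x ^ 2 := (bddC1_const 1).add
    (BddC1.sum _ fun i => by simpa only [sq] using (hb i).mul (hb i))
  have ha1 : ∀ x, 1 ≤ 1 + ∑ i, b i x ^ 2 := fun x =>
    le_add_of_nonneg_right (Finset.sum_nonneg fun i _ => sq_nonneg _)
  have hinv := ha.inv ha1
  set A : Fin N → Euc N → ℝ := fun i x =>
    (if i = j then 0 else 1) * (1 + ∑ i, b i x ^ 2)⁻¹ with hAdef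
  set B : Fin N → Euc N → ℝ := fun i x => -b i x * (1 + ∑ i, b i x ^ 2)⁻¹ with hBdef
  have hA : ∀ i, BddC1 (A i) := fun i => (bddC1_const _).mul hinv
  have hB : ∀ i, BddC1 (B i) := fun i => by
    simpa only [neg_one_mul] using ((bddC1_const (-1)).mul (hb i)).mul hinv
  choose K1 hK10 hK1 using fun i => exists_commutator_bound hh1 hc (hA i) i
  choose K2 hK20 hK2 using fun i => exists_commutator_bound hh1 hc (hB i) i
  obtain ⟨R, hR0, hR⟩ : ∃ R, 0 ≤ R ∧ ∀ z ∈ tsupport h, ‖z‖ ≤ R := by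
    obtain ⟨R, hR⟩ := hc.isBounded.exists_norm_le
    exact ⟨max R 0, le_max_right _ _, fun z hz => (hR z hz).trans (le_max_left _ _)⟩
  obtain ⟨Ka, hKa0, hKa⟩ := ha.2
  set T := ∑ i, (K1 i * C + 2 * (K2 i * C)) with hTdef
  have hT0 : 0 ≤ T := Finset.sum_nonneg fun i _ => by
    have := hK10 i; have := hK20 i; positivity
  set I2 := ∑ i, ∫ z, |pd i (pd i h) z| with hI2def
  have hI20 : 0 ≤ I2 := Finset.sum_nonneg fun i _ => integral_nonneg fun _ => abs_nonneg _
  have hNC : 0 ≤ N * C * R := by positivity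
  refine ⟨C + Ka * (C + T) + 2 * C + I2 * (C * 2) + N * C * R, by positivity,
    fun ε hε hε1 v hv hvc hvb => ?_⟩
  set D := diagMap (aniso j s ε) with hD
  have hDc : Continuous D := D.continuous
  have hck := abs_aniso_le (j := j) hs hε hε1
  have hsy : ∀ y z : Euc N, s * (y + D z) j = s * y j + ε ^ 2 * z j := mul_aniso_apply hs ε
  have hv1 : ContDiff ℝ 1 v := hv.of_le (by norm_num)
  have hvi : ∀ i, ContDiff ℝ 1 (pd i v) := fun i => hv.pd (by norm_num) i
  have hpd : ∀ i, pd i (avg h D v) = avg h D (pd i v) := pd_avg hi0 hDc hv1 hvc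
  have hpd2 : ∀ i k, pd i (pd k (avg h D v)) = avg h D (pd i (pd k v)) := fun i k => by
    rw [hpd k, pd_avg hi0 hDc (hvi k) (hasCompactSupport_pd hvc k)]
  have hgood : ∀ y, 0 ≤ s * y j → ∀ z ∈ tsupport h, ε ^ 2 ≤ s * (y + D z) j := fun y hy z hz => by
    rw [hsy]; nlinarith [(hj z hz).1, sq_nonneg ε]
  have hup : ∀ y, 0 ≤ s * y j → ∀ z ∈ tsupport h, |v (y + D z)| ≤ C * (s * y j + 2 * ε ^ 2) :=
    fun y hy z hz => by
      obtain ⟨g1, g2, -⟩ := hvb _ (hgood y hy z hz)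
      rw [abs_of_nonneg g1]
      refine g2.trans (mul_le_mul_of_nonneg_left ?_ hC)
      rw [hsy]
      nlinarith [(hj z hz).2, sq_nonneg ε]
  have hcomm : ∀ (F : Fin N → Euc N → ℝ) (K : Fin N → ℝ), (∀ i, 0 ≤ K i) → (∀ x, F j x = 0) →
      (∀ (i : Fin N) (ε : ℝ) (c : Fin N → ℝ) (w : Euc N → ℝ) (y : Euc N) (M : ℝ), 0 < ε →
        (∀ k, |c k| ≤ ε) → c i = ε → ContDiff ℝ 1 w → 0 ≤ M →
        (∀ z ∈ tsupport h, |w (y + diagMap c z)| ≤ M) →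
        |∫ z, h z * ((F i (y + diagMap c z) - F i y) * pd i w (y + diagMap c z))| ≤ K i * M) →
      ∀ y, 0 ≤ s * y j → ∀ i k, |∫ z, h z * ((F i (y + D z) - F i y) *
        pd i (pd k v) (y + D z))| ≤ K i * C := fun F K hK0 hFj hK y hy i k => by
    by_cases hij : i = j
    · subst hij
      simpa [hFj] using mul_nonneg (hK0 i) hC
    · exact hK i ε _ (pd k v) y C hε hck (by simp [aniso, hij]) (hvi k) hC
        fun z hz => (hvb _ (hgood y hy z hz)).2.2.1 k
  refine ⟨avg h D v, contDiff_avg (n := 2) hi0 hDc hv hvc, fun y hy => ⟨?_, ?_, fun i => ?_, ?_⟩,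
    fun y hy i hij => ?_, fun y hy => ?_⟩
  · refine integral_nonneg fun z => ?_
    by_cases hz : h z = 0
    · simp [hz]
    · exact mul_nonneg (h0 z) (hvb _ (hgood y hy z (subset_tsupport h hz))).1
  · have := abs_avg_le (x := y) (τ := D) (k := v) hi0 fun z hz =>
      hup y hy z (subset_tsupport h hz)
    rw [habs, one_mul] at this
    refine (le_abs_self _).trans (this.trans ?_)
    have h6 : 0 ≤ C + Ka * (C + T) + I2 * (C * 2) + N * C * R := by positivity
    nlinarith [mul_nonneg h6 (add_nonneg hy (sq_nonneg ε)), mul_nonneg hC hy]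
  · rw [hpd]
    have := abs_avg_le (x := y) (τ := D) (k := pd i v) (C := C) hi0 fun z hz =>
      (hvb _ (hgood y hy z (subset_tsupport h hz))).2.2.1 i
    rw [habs, one_mul] at this
    exact this.trans (by nlinarith [mul_nonneg hKa0 (add_nonneg hC hT0), mul_nonneg hI20 hC, hNC])
  · have hca : Continuous fun z => y + D z := continuous_const.add hDc
    have hp := integral_mul_principal Finset.univ (h := h)
      (w := fun z => pd j (pd j v) (y + D z)) (A := fun i z => A i (y + D z))
      (B := fun i z => B i (y + D z)) (X := fun i z => pd i (pd i v) (y + D z))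
      (Y := fun i z => pd i (pd j v) (y + D z)) hh.continuous hc
      ((continuous_pd_pd hv _ _).comp hca) (fun i => (hA i).1.continuous.comp hca)
      (fun i => (hB i).1.continuous.comp hca) (fun i => (continuous_pd_pd hv _ _).comp hca)
      (fun i => (continuous_pd_pd hv _ _).comp hca) (fun i => A i y) (fun i => B i y)
    have hl : |∫ z, h z * (pd j (pd j v) (y + D z) + ∑ i, (A i (y + D z) * pd i (pd i v) (y + D z)
        + 2 * (B i (y + D z) * pd i (pd j v) (y + D z))))| ≤ C := by
      have := abs_integral_mul_le (C := C) (k := fun z => pd j (pd j v) (y + D z) +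
        ∑ i, (A i (y + D z) * pd i (pd i v) (y + D z)
        + 2 * (B i (y + D z) * pd i (pd j v) (y + D z)))) hi0 fun z hz => by
          have h3 := (hvb _ (hgood y hy z (subset_tsupport h hz))).2.2.2
          unfold shearOp at h3
          rw [sum_shear_eq j (hbj _), abs_mul,
            abs_of_pos (zero_lt_one.trans_le (ha1 (y + D z)))] at h3
          exact (le_mul_of_one_le_left (abs_nonneg _) (ha1 _)).trans h3
      rwa [habs, one_mul] at this
    have hr : |∑ i, ((∫ z, h z * ((A i (y + D z) - A i y) * pd i (pd i v) (y + D z))) +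
        2 * ∫ z, h z * ((B i (y + D z) - B i y) * pd i (pd j v) (y + D z)))| ≤ T := by
      refine (Finset.abs_sum_le_sum_abs _ _).trans (Finset.sum_le_sum fun i _ => ?_)
      refine (abs_add_le _ _).trans (add_le_add ?_ ?_)
      · exact hcomm A K1 hK10 (fun x => by simp [hAdef]) hK1 y hy i i
      · rw [abs_mul, abs_two]
        exact mul_le_mul_of_nonneg_left
          (hcomm B K2 hK20 (fun x => by simp [hBdef, hbj]) hK2 y hy i j) zero_le_two
    have hPV : |pd j (pd j (avg h D v)) y + ∑ i, (A i y * pd i (pd i (avg h D v)) y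
        + 2 * (B i y * pd i (pd j (avg h D v)) y))| ≤ C + T := by
      simp_rw [hpd2]
      have e := eq_sub_of_add_eq hp.symm
      simp only [avg, smul_eq_mul]
      rw [e]
      exact (abs_sub _ _).trans (add_le_add hl hr)
    unfold shearOp
    rw [sum_shear_eq j (hbj y), abs_mul]
    have h5 := mul_le_mul (hKa y).1 hPV (abs_nonneg _) hKa0
    exact h5.trans (by nlinarith [mul_nonneg hI20 hC, hNC])
  · have hcii : aniso j s ε i = ε := by simp [aniso, hij]
    have hhi : ContDiff ℝ 1 (pd i h) := hh.pd (by norm_num) i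
    have e1 := integral_mul_pd_diagMap hh1 hc (hvi i) y (aniso j s ε) i
    have e2 := integral_mul_pd_diagMap hhi (hasCompactSupport_pd hc i) hv1 y (aniso j s ε) i
    rw [hcii] at e1 e2
    have e3 : |∫ z, pd i (pd i h) z * v (y + D z)| ≤
        (∫ z, |pd i (pd i h) z|) * (C * (2 * ε ^ 2)) := by
      refine abs_integral_mul_le ((continuous_pd hhi i).integrable_of_hasCompactSupport
        (hasCompactSupport_pd (hasCompactSupport_pd hc i) i)) fun z hz => ?_
      have hup' := hup y (by simp [hy]) z
      rw [hy, mul_zero, zero_add] at hup'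
      refine hup' ?_
      by_contra hn
      refine hz (pd_eq_zero_of_notMem_tsupport (fun h' => hn ?_) i)
      exact closure_minimal (fun x hx => by
        by_contra hn'; exact hx (pd_eq_zero_of_notMem_tsupport hn' i)) (isClosed_tsupport h) h'
    rw [hpd2]
    simp only [avg, smul_eq_mul]
    have e4 : ε ^ 2 * ∫ z, h z * pd i (pd i v) (y + D z) =
        ∫ z, pd i (pd i h) z * v (y + D z) := by
      rw [sq, mul_assoc, e1, mul_neg, e2, neg_neg]
    have e5 : ε ^ 2 * |∫ z, h z * pd i (pd i v) (y + D z)| ≤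
        ε ^ 2 * ((∫ z, |pd i (pd i h) z|) * (C * 2)) := by
      rw [← abs_of_pos (pow_pos hε 2), ← abs_mul, abs_of_pos (pow_pos hε 2), e4]
      exact e3.trans (le_of_eq (by ring))
    have e6 := le_of_mul_le_mul_left e5 (pow_pos hε 2)
    have e7 : ∫ z, |pd i (pd i h) z| ≤ I2 :=
      Finset.single_le_sum (f := fun i => ∫ z, |pd i (pd i h) z|)
        (fun i _ => integral_nonneg fun _ => abs_nonneg _) (Finset.mem_univ i)
    have e8 := mul_le_mul_of_nonneg_right e7 (mul_nonneg hC zero_le_two)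
    have h6 : 0 ≤ C + Ka * (C + T) + 2 * C + N * C * R := by positivity
    linarith
  · have hhalf : Convex ℝ {x : Euc N | ε ^ 2 ≤ s * x j} := by
      intro x hx x' hx' a a' ha ha' haa
      simp only [mem_ofPred_eq, PiLp.add_apply, PiLp.smul_apply, smul_eq_mul] at *
      have := add_le_add (mul_le_mul_of_nonneg_left hx ha) (mul_le_mul_of_nonneg_left hx' ha')
      rw [← add_mul, haa, one_mul] at this
      linarith
    have hy0 : 0 ≤ s * y j := (sq_nonneg ε).trans hy
    have e1 : avg h D v y - v y = ∫ z, h z * (v (y + D z) - v y) := by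
      have e2 : v y = ∫ z, h z * v y := by rw [integral_mul_const, h1, one_mul]
      have i1 := integrable_avg hi0 hDc hv.continuous hvc y
      simp only [smul_eq_mul] at i1
      simp only [avg, smul_eq_mul]
      conv_lhs => rw [e2]
      rw [← integral_sub i1 (hi0.mul_const _)]
      exact integral_congr_ae (Eventually.of_forall fun z => by simp only; ring)
    rw [e1]
    have e3 := abs_integral_mul_le (k := fun z => v (y + D z) - v y) (C := N * C * (ε * R)) hi0
      fun z hz => by
        have hz' := subset_tsupport h hz
        have := hhalf.norm_image_sub_le_of_norm_fderiv_le (f := v) (C := N * C)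
          (fun x _ => hv.differentiable (by norm_num) x)
          (fun x hx => norm_fderiv_le_of_abs_pd_le hC (hvb x hx).2.2.1) hy (hgood y hy0 z hz')
        rw [Real.norm_eq_abs, add_sub_cancel_left] at this
        refine this.trans (mul_le_mul_of_nonneg_left ?_ (by positivity))
        exact (norm_diagMap_le hε.le hck z).trans (by gcongr; exact hR z hz')
    rw [habs, one_mul] at e3
    refine e3.trans ?_
    have h6 : 0 ≤ C + Ka * (C + T) + 2 * C + I2 * (C * 2) := by positivity
    nlinarith [mul_nonneg h6 hε.le]

/-- Translation in the direction of the `j`-th axis by `ψ`. -/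
def shear (j : Fin N) (ψ : Euc N → ℝ) (x : Euc N) : Euc N := x + ψ x • bv j

theorem shear_apply_self (j : Fin N) (ψ : Euc N → ℝ) (x : Euc N) :
    shear j ψ x j = x j + ψ x := by simp [shear]

theorem ContDiff.shear {j : Fin N} {ψ : Euc N → ℝ} {n : WithTop ℕ∞} (hψ : ContDiff ℝ n ψ) :
    ContDiff ℝ n (shear j ψ) := contDiff_id.add (hψ.smul contDiff_const)

theorem shear_neg_shear {j : Fin N} {ψ : Euc N → ℝ} (hψ : ∀ x, ψ (shear j ψ x) = ψ x) (x : Euc N) :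
    shear j (fun y => -ψ y) (shear j ψ x) = x := by
  change shear j ψ x + -ψ (shear j ψ x) • bv j = x
  rw [hψ, shear, neg_smul, add_neg_cancel_right]

theorem pd_comp_shear {j : Fin N} {ψ v : Euc N → ℝ} (hv : ContDiff ℝ 1 v) (hψ : ContDiff ℝ 1 ψ)
    (i : Fin N) (x : Euc N) : pd i (fun x => v (shear j ψ x)) x =
      pd i v (shear j ψ x) + pd i ψ x * pd j v (shear j ψ x) := by
  have h1 : HasFDerivAt (shear j ψ) (ContinuousLinearMap.id ℝ _ +
      (fderiv ℝ ψ x).smulRight (bv j)) x :=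
    (hasFDerivAt_id x).add (((hψ.differentiable (by norm_num) x).hasFDerivAt).smul_const (bv j))
  have h2 := ((hv.differentiable (by norm_num) (shear j ψ x)).hasFDerivAt).comp x h1
  change fderiv ℝ (v ∘ shear j ψ) x (bv i) = _
  rw [h2.fderiv]
  simp [pd]

theorem lap_comp_shear {j : Fin N} {ψ v : Euc N → ℝ} (hv : ContDiff ℝ 2 v) (hψ : ContDiff ℝ 2 ψ)
    (x : Euc N) : lap (fun x => v (shear j ψ x)) x =
      shearOp j (fun i => -pd i ψ x) v (shear j ψ x) +
        ∑ i, pd i (pd i ψ) x * pd j v (shear j ψ x) := by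
  have hv1 : ContDiff ℝ 1 v := hv.of_le (by norm_num)
  have hψ1 : ContDiff ℝ 1 ψ := hψ.of_le (by norm_num)
  have hvi : ∀ i, ContDiff ℝ 1 (pd i v) := fun i => hv.pd (by norm_num) i
  have hψi : ∀ i, ContDiff ℝ 1 (pd i ψ) := fun i => hψ.pd (by norm_num) i
  have hvS : ContDiff ℝ 2 fun x => v (shear j ψ x) := hv.comp hψ.shear
  rw [lap_eq_sum_pd hvS, shearOp, ← Finset.sum_add_distrib]
  refine Finset.sum_congr rfl fun i _ => ?_
  have hd : ∀ k, DifferentiableAt ℝ (fun x => pd k v (shear j ψ x)) x := fun k =>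
    ((hvi k).comp hψ1.shear).differentiable (by norm_num) x
  have hd' : DifferentiableAt ℝ (fun x => pd i ψ x * pd j v (shear j ψ x)) x :=
    ((hψi i).differentiable (by norm_num) x).mul (hd j)
  rw [show pd i (fun x => v (shear j ψ x)) = fun x => pd i v (shear j ψ x) +
      pd i ψ x * pd j v (shear j ψ x) from funext fun x => pd_comp_shear hv1 hψ1 i x,
    pd_add (hd i) hd',
    pd_mul ((hψi i).differentiable (by norm_num) x) (hd j), pd_comp_shear (hvi i) hψ1,
    pd_comp_shear (hvi j) hψ1, pd_comm hv j i]
  ring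

theorem lap_comp_flat {V : Euc N → ℝ} (hV : ContDiff ℝ 2 V) (j : Fin N) (x : Euc N) :
    lap (fun x => V (flat j x)) x = ∑ i, (if i = j then 0 else pd i (pd i V) (flat j x)) := by
  have hVf : ContDiff ℝ 2 fun x => V (flat j x) := hV.comp (flat j).contDiff
  rw [lap_eq_sum_pd hVf]
  refine Finset.sum_congr rfl fun i _ => ?_
  have := pd_pd_comp_diagMap hV 0 (fun k => if k = j then 0 else 1) i i x
  simp only [zero_add] at this
  change pd i (pd i fun x => V (diagMap _ x)) x = _
  rw [this]
  by_cases h : i = j <;> simp [h, flat]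

theorem pd_comp_flat {V : Euc N → ℝ} (hV : ContDiff ℝ 1 V) (i j : Fin N) (x : Euc N) :
    pd i (fun x => V (flat j x)) x = (if i = j then 0 else 1) * pd i V (flat j x) := by
  have := pd_comp_diagMap (f := V) 0 (fun k => if k = j then 0 else 1) (y := x)
    (hV.differentiable (by norm_num) _) i
  simp only [zero_add] at this
  exact this

theorem bddC1_pd_comp_flat {V : Euc N → ℝ} (hV : ContDiff ℝ 2 V) (hc : HasCompactSupport V)
    (i j : Fin N) : BddC1 (pd i fun x => V (flat j x)) := by
  rw [show (pd i fun x => V (flat j x)) = fun x => (if i = j then 0 else 1) * pd i V (flat j x)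
    from funext fun x => pd_comp_flat (hV.of_le (by norm_num)) i j x]
  exact (bddC1_const _).mul ((bddC1_of_hasCompactSupport (hV.pd (by norm_num) i)
    (hasCompactSupport_pd hc i)).comp_diagMap _)

/-- Near a graph boundary, the height above the graph is comparable to `rho`. -/
theorem rho_comparable [NeZero N] {Ω : Set (Euc N)} (hΩ : IsBoundedC2Domain Ω) {z : Euc N}
    (hz : z ∈ frontier Ω) {j : Fin N} {Ψ : Euc N → ℝ} {s R L : ℝ} (hL0 : 0 ≤ L)
    (hL : ∀ x y, |Ψ (flat j x) - Ψ (flat j y)| ≤ L * ‖x - y‖) (hs : s = 1 ∨ s = -1)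
    (hF : ∀ x ∈ ball z R, x ∈ frontier Ω ↔ x j = Ψ (flat j x)) {x : Euc N}
    (hx : x ∈ ball z (R / 4)) (hxp : 0 < s * (x j - Ψ (flat j x))) :
    s * (x j - Ψ (flat j x)) ≤ (1 + L) * rho Ω x ∧ rho Ω x ≤ s * (x j - Ψ (flat j x)) := by
  have habs : s * (x j - Ψ (flat j x)) = |x j - Ψ (flat j x)| := by
    rw [← abs_of_pos hxp, abs_mul]
    rcases hs with rfl | rfl <;> simp
  rw [habs]
  have hxz : rho Ω x ≤ dist x z := infDist_le_dist_of_mem hz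
  rw [mem_ball] at hx
  have hR : 0 < R := by linarith [dist_nonneg (x := x) (y := z)]
  constructor
  · obtain ⟨w, hw, hwd⟩ := hΩ.exists_frontier_dist x
    have hwz : w ∈ ball z R := by
      rw [mem_ball]
      have := dist_triangle_left w z x
      linarith
    have e1 := (hF w hwz).1 hw
    have e2 : |x j - w j| ≤ dist x w := by
      have := PiLp.norm_apply_le (x - w) j
      rwa [← dist_eq_norm] at this
    have e3 := hL x w
    rw [← dist_eq_norm] at e3
    rw [hwd]
    calc |x j - Ψ (flat j x)| = |(x j - w j) - (Ψ (flat j x) - Ψ (flat j w))| := by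
          rw [← e1]; ring_nf
      _ ≤ dist x w + L * dist x w := (abs_sub _ _).trans (add_le_add e2 e3)
      _ = _ := by ring
  · set x' := flat j x + Ψ (flat j x) • bv j with hx'
    have hfx : flat j x' = flat j x := by simp [hx', flat_flat, flat_bv]
    have hd : dist x x' = |x j - Ψ (flat j x)| := by
      have : x - x' = (x j - Ψ (flat j x)) • bv j := by
        conv_lhs => enter [1]; rw [← flat_add_smul_bv j x]
        rw [hx', sub_smul]; abel
      rw [dist_eq_norm, this, norm_smul]
      simp
    by_cases hb : x' ∈ ball z R
    · rw [← hd]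
      refine infDist_le_dist_of_mem ((hF x' hb).2 ?_)
      rw [hfx]
      simp [hx', flat_apply]
    · rw [mem_ball, not_lt] at hb
      have := dist_triangle_left x' z x
      rw [← hd]
      linarith

theorem pd_add_smul_bv {j : Fin N} {ψ : Euc N → ℝ} (hψ : ∀ (c : ℝ) x, ψ (x + c • bv j) = ψ x)
    (i : Fin N) (c : ℝ) (x : Euc N) : pd i ψ (x + c • bv j) = pd i ψ x := by
  rw [pd, ← fderiv_comp_add_right, show (fun y => ψ (y + c • bv j)) = ψ from funext (hψ c), pd]

theorem pd_neg (i : Fin N) (f : Euc N → ℝ) (x : Euc N) :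
    pd i (fun y => -f y) x = -pd i f x := by simp [pd]

theorem shear_shear_neg {j : Fin N} {ψ : Euc N → ℝ} (hψ : ∀ (c : ℝ) x, ψ (x + c • bv j) = ψ x)
    (x : Euc N) : shear j ψ (shear j (fun y => -ψ y) x) = x := by
  simp only [shear, hψ, add_assoc, ← add_smul, neg_add_cancel, zero_smul, add_zero]

theorem abs_sum_mul_le {a : Fin N → ℝ} {K M c : ℝ} (ha : ∀ i, |a i| ≤ K) (hc : |c| ≤ M) :
    |∑ i, a i * c| ≤ N * (K * M) := by
  refine (Finset.abs_sum_le_sum_abs _ _).trans ?_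
  calc ∑ i, |a i * c| ≤ ∑ _i : Fin N, K * M := Finset.sum_le_sum fun i _ => by
        rw [abs_mul]
        exact mul_le_mul (ha i) hc (abs_nonneg _) ((abs_nonneg _).trans (ha i))
    _ = N * (K * M) := by simp

theorem shearOp_bound {j : Fin N} {ψ W : Euc N → ℝ} {K M : ℝ} {y : Euc N} (hψ : ContDiff ℝ 2 ψ)
    (hinv : ∀ (c : ℝ) x, ψ (x + c • bv j) = ψ x)
    (hK : ∀ i x, |pd i ψ x| ≤ K ∧ |pd i (pd i ψ) x| ≤ K) (hW : ContDiff ℝ 2 W)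
    (h1 : ∀ i, |pd i W (shear j ψ y)| ≤ M) (h2 : |lap W (shear j ψ y)| ≤ M) :
    (∀ i, |pd i (fun x => W (shear j ψ x)) y| ≤ M + K * M) ∧
      |shearOp j (fun i => pd i ψ y) (fun x => W (shear j ψ x)) y| ≤
        M + N * (K * (M + K * M)) := by
  have hp : ∀ i, |pd i (fun x => W (shear j ψ x)) y| ≤ M + K * M := fun i => by
    rw [pd_comp_shear (hW.of_le (by norm_num)) (hψ.of_le (by norm_num))]
    refine (abs_add_le _ _).trans (add_le_add (h1 i) ?_)
    rw [abs_mul]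
    exact mul_le_mul (hK i y).1 (h1 j) (abs_nonneg _) ((abs_nonneg _).trans (hK i y).1)
  refine ⟨hp, ?_⟩
  have hv : ContDiff ℝ 2 fun x => W (shear j ψ x) := hW.comp hψ.shear
  have key := lap_comp_shear (j := j) hv hψ.neg (shear j ψ y)
  have hW' : (fun x => W (shear j ψ (shear j (fun z => -ψ z) x))) = W := by
    simp [shear_shear_neg hinv]
  have hy : shear j (fun z => -ψ z) (shear j ψ y) = y :=
    shear_neg_shear (fun x => by simp [shear, hinv]) y
  have hpn : ∀ i, pd i (fun x => -ψ x) = fun x => -pd i ψ x := fun i => funext (pd_neg i ψ)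
  have hb : ∀ i, pd i ψ (shear j ψ y) = pd i ψ y := fun i => pd_add_smul_bv hinv i _ _
  simp only [hpn, hW', hy, hb, neg_neg] at key
  have hpp : ∀ i, |pd i (fun x => -pd i ψ x) (shear j ψ y)| ≤ K := fun i => by
    rw [pd_neg, abs_neg]
    exact (hK i _).2
  have h3 := abs_sum_mul_le hpp (hp j)
  rw [abs_le] at h2 h3 ⊢
  constructor <;> linarith [h2.1, h2.2, h3.1, h3.2]

theorem lap_shear_bound {j : Fin N} {ψ V : Euc N → ℝ} {K M : ℝ} {x : Euc N} (hψ : ContDiff ℝ 2 ψ)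
    (hinv : ∀ (c : ℝ) x, ψ (x + c • bv j) = ψ x)
    (hK : ∀ i x, |pd i ψ x| ≤ K ∧ |pd i (pd i ψ) x| ≤ K) (hV : ContDiff ℝ 2 V)
    (h1 : ∀ i, |pd i V (shear j (fun z => -ψ z) x)| ≤ M)
    (h2 : |shearOp j (fun i => pd i ψ (shear j (fun z => -ψ z) x)) V
      (shear j (fun z => -ψ z) x)| ≤ M) :
    (∀ i, |pd i (fun x => V (shear j (fun z => -ψ z) x)) x| ≤ M + K * M) ∧
      |lap (fun x => V (shear j (fun z => -ψ z) x)) x| ≤ M + N * (K * M) := by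
  have hpn : ∀ i, pd i (fun x => -ψ x) = fun x => -pd i ψ x := fun i => funext (pd_neg i ψ)
  constructor
  · intro i
    rw [pd_comp_shear (hV.of_le (by norm_num)) (hψ.neg.of_le (by norm_num)), hpn]
    refine (abs_add_le _ _).trans (add_le_add (h1 i) ?_)
    rw [abs_mul, abs_neg]
    exact mul_le_mul (hK i x).1 (h1 j) (abs_nonneg _) ((abs_nonneg _).trans (hK i x).1)
  · rw [lap_comp_shear hV hψ.neg]
    have hb : ∀ i, pd i ψ (shear j (fun z => -ψ z) x) = pd i ψ x :=
      fun i => pd_add_smul_bv hinv i _ _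
    simp only [hb] at h2
    simp only [hpn, neg_neg]
    refine (abs_add_le _ _).trans (add_le_add h2 (abs_sum_mul_le (fun i => ?_) (h1 j)))
    rw [pd_neg, abs_neg]
    exact (hK i _).2

theorem exists_bound_pd_comp_flat {Ψ : Euc N → ℝ} (hΨ : ContDiff ℝ 2 Ψ) (hc : HasCompactSupport Ψ)
    (j : Fin N) : ∃ K, 0 ≤ K ∧ ∀ i x, |pd i (fun x => Ψ (flat j x)) x| ≤ K ∧
      |pd i (pd i fun x => Ψ (flat j x)) x| ≤ K := by
  choose _ K hK0 hK using fun i => bddC1_pd_comp_flat hΨ hc i j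
  have hs : ∀ i, K i ≤ ∑ i, K i := fun i =>
    Finset.single_le_sum (fun k _ => hK0 k) (Finset.mem_univ i)
  exact ⟨∑ i, K i, Finset.sum_nonneg fun i _ => hK0 i, fun i x => ⟨(hK i x).1.trans (hs i),
    (abs_pd_le_norm _ i x).trans ((hK i x).2.trans (hs i))⟩⟩

theorem mul_derivs_bound {ζ P : Euc N → ℝ} (hζ : ContDiff ℝ 2 ζ) (hP : ContDiff ℝ 2 P) {x : Euc N}
    {A C r R : ℝ} (hC : 0 ≤ C) (hζ0 : 0 ≤ ζ x) (f0 : |ζ x| ≤ A) (f1 : ∀ i, |pd i ζ x| ≤ A)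
    (f2 : |lap ζ x| ≤ A) (g0 : 0 ≤ P x) (g0' : P x ≤ C * r) (g1 : ∀ i, |pd i P x| ≤ C)
    (g2 : |lap P x| ≤ C) (hr0 : 0 ≤ r) (hrR : r ≤ R) :
    0 ≤ ζ x * P x ∧ ζ x * P x ≤ (2 + 2 * N) * (A * (C * R + C)) * r ∧
      (∀ i, |pd i (fun y => ζ y * P y) x| ≤ (2 + 2 * N) * (A * (C * R + C))) ∧
      |lap (fun y => ζ y * P y) x| ≤ (2 + 2 * N) * (A * (C * R + C)) := by
  have hA : 0 ≤ A := (abs_nonneg _).trans f0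
  have hR : 0 ≤ R := hr0.trans hrR
  have hCR : C * r ≤ C * R := by gcongr
  have hCR0 : 0 ≤ C * R := by positivity
  have hB : 0 ≤ A * (C * R + C) := by positivity
  have hNB : 0 ≤ (N : ℝ) * (A * (C * R + C)) := by positivity
  have hP0 : |P x| ≤ C * R + C := by rw [abs_of_nonneg g0]; linarith
  have hPi : ∀ i, |pd i P x| ≤ C * R + C := fun i => by linarith [g1 i]
  refine ⟨mul_nonneg hζ0 g0, ?_, fun i => ?_, abs_lap_mul_le hζ hP f0 f1 f2 hP0 hPi (by linarith)⟩
  · have h1 : ζ x * P x ≤ A * (C * r) := mul_le_mul ((le_abs_self _).trans f0) g0' g0 hA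
    have h2 : A * C ≤ (2 + 2 * N) * (A * (C * R + C)) := by
      have : 0 ≤ A * (C * R) := by positivity
      have : 0 ≤ A * C := by positivity
      linarith
    nlinarith
  · rw [pd_mul (hζ.differentiable (by norm_num) x) (hP.differentiable (by norm_num) x)]
    have e1 : |ζ x * pd i P x| ≤ A * (C * R + C) := by
      rw [abs_mul]; exact mul_le_mul f0 (hPi i) (abs_nonneg _) hA
    have e2 : |P x * pd i ζ x| ≤ A * (C * R + C) := by
      rw [abs_mul, mul_comm]; exact mul_le_mul (f1 i) hP0 (abs_nonneg _) hA
    linarith [abs_add_le (ζ x * pd i P x) (P x * pd i ζ x)]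

theorem HasMollification.exists_isApproximable_boundary [NeZero N] {Ω : Set (Euc N)}
    {p : Euc N → ℝ} (hΩ : IsBoundedC2Domain Ω) (hp : HasMollification Ω p) {z : Euc N}
    (hz : z ∈ frontier Ω) : ∃ r, 0 < r ∧ ∀ ζ : Euc N → ℝ, ContDiff ℝ 2 ζ → (∀ x, 0 ≤ ζ x) →
      HasCompactSupport ζ → tsupport ζ ⊆ ball z r → IsApproximable Ω fun x => ζ x * p x := by
  obtain ⟨j, Ψ, s, R, hR, hΨ, hΨc, hs, hG⟩ := hΩ.exists_graph hz
  obtain ⟨hψ1, L, hL0, hLb⟩ : BddC1 fun x => Ψ (flat j x) :=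
    (bddC1_of_hasCompactSupport (hΨ.of_le (by norm_num)) hΨc).comp_diagMap _
  have hL := abs_sub_le_of_fderiv_le hψ1 fun x => (hLb x).2
  obtain ⟨K, hK0, hK⟩ := exists_bound_pd_comp_flat hΨ hΨc j
  refine ⟨R / 4, by positivity, fun ζ hζ hζ0 hζc hζR => ?_⟩
  set ψ : Euc N → ℝ := fun x => Ψ (flat j x) with hψdef
  have hψ : ContDiff ℝ 2 ψ := hΨ.comp (flat j).contDiff
  have hinv : ∀ (c : ℝ) x, ψ (x + c • bv j) = ψ x := fun c x => by simp [hψdef, flat_bv]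
  obtain ⟨C, hC0, hC⟩ := hp
  have hs2 : s * s = 1 := by rcases hs with rfl | rfl <;> norm_num
  set ε : ℕ → ℝ := fun n => 1 / ((n:ℝ) + 1) with hε
  have hε0 : ∀ n, 0 < ε n := fun n => by positivity
  have hε1 : ∀ n, ε n ≤ 1 := fun n => by
    rw [hε, div_le_one (by positivity)]; linarith [(Nat.cast_nonneg n : (0:ℝ) ≤ n)]
  have hεl : Tendsto ε atTop (𝓝 0) := tendsto_one_div_add_atTop_nhds_zero_nat
  have hεl2 : Tendsto (fun n => ε n ^ 2) atTop (𝓝 0) := by simpa using hεl.pow 2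
  obtain ⟨P, hP, hPb, hPl⟩ := hC (fun n => ε n ^ 2 / (4 * (1 + L)))
    (fun n => by have := hε0 n; positivity) (by simpa using hεl2.div_const (4 * (1 + L)))
  obtain ⟨A, hA0, hA⟩ := exists_bound_derivs hζ hζc.isBounded
  set M := (2 + 2 * (N:ℝ)) * (A * (C * (R / 4) + C)) with hM
  have hM0 : 0 ≤ M := by positivity
  set W : ℕ → Euc N → ℝ := fun n x => ζ x * P n x with hW
  have hWC : ∀ n, ContDiff ℝ 2 (W n) := fun n => hζ.mul (hP n)
  have hWs : ∀ n, tsupport (W n) ⊆ tsupport ζ := fun n => tsupport_mul_subset_left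
  have hWb : ∀ n x, ε n ^ 2 ≤ s * (x j - ψ x) → 0 ≤ W n x ∧ W n x ≤ M * (s * (x j - ψ x)) ∧
      (∀ i, |pd i (W n) x| ≤ M) ∧ |lap (W n) x| ≤ M := by
    intro n x hx
    have hpos : 0 < s * (x j - ψ x) := (pow_pos (hε0 n) 2).trans_le hx
    by_cases hxs : x ∈ tsupport ζ
    · have hxR := hζR hxs
      obtain ⟨h1, h2⟩ := rho_comparable hΩ hz hL0 hL hs (fun y hy => (hG y hy).2) hxR hpos
      have hxΩ : x ∈ Ω := ((hG x (ball_subset_ball (by linarith) hxR)).1).2 hpos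
      obtain ⟨g1, g2, g3, g4⟩ := hPb n x hxΩ (by
        rw [← mul_div_assoc, div_le_iff₀ (by positivity)]; linarith)
      obtain ⟨f0, f1, f2⟩ := hA x hxs
      have hρ : rho Ω x ≤ R / 4 :=
        (infDist_le_dist_of_mem hz : rho Ω x ≤ dist x z).trans (mem_ball.1 hxR).le
      obtain ⟨k1, k2, k3, k4⟩ := mul_derivs_bound hζ (hP n) hC0 (hζ0 x) f0 f1 f2 g1 g2 g4 g3
        (rho_nonneg Ω x) hρ
      exact ⟨k1, k2.trans (mul_le_mul_of_nonneg_left h2 hM0), k3, k4⟩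
    · have hx0 : W n x = 0 := by simp [hW, image_eq_zero_of_notMem_tsupport hxs]
      have hxW : x ∉ tsupport (W n) := fun h => hxs (hWs n h)
      rw [hx0, lap_eq_zero_of_notMem_tsupport hxW]
      refine ⟨le_rfl, by positivity, fun i => ?_, by simpa⟩
      rw [pd_eq_zero_of_notMem_tsupport hxW]
      simpa
  obtain ⟨h, hh, hhc, hh0, hh1, hhj⟩ := exists_bump_slab j
  have hbj : ∀ x, pd j ψ x = 0 := fun x => by
    rw [hψdef, pd_comp_flat (hΨ.of_le (by norm_num))]; simp
  obtain ⟨C', hC'0, hV⟩ := exists_aniso_bound hs hh hhc hh0 hh1 hhj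
    (fun i => bddC1_pd_comp_flat hΨ hΨc i j) hbj
    (C := M + K * M + N * (K * (M + K * M))) (by positivity)
  have hex : ∀ n, _ := fun n => hV (ε n) (hε0 n) (hε1 n) (fun y => W n (shear j ψ y))
    ((hWC n).comp hψ.shear)
    (HasCompactSupport.intro (hζc.isCompact.image (hψ.neg.shear (j := j)).continuous)
      fun y hy => image_eq_zero_of_notMem_tsupport fun hy' => hy
        ⟨_, hWs n hy', shear_neg_shear (fun x => hinv _ x) y⟩)
    fun y hy => by
      have hSy : shear j ψ y j - ψ (shear j ψ y) = y j := by
        rw [shear_apply_self, shear, hinv]; ring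
      obtain ⟨k1, k2, k3, k4⟩ := hWb n (shear j ψ y) (by rwa [hSy])
      rw [hSy] at k2
      obtain ⟨l1, l2⟩ := shearOp_bound hψ hinv hK (hWC n) k3 k4
      have hy0 : 0 ≤ s * y j := (sq_nonneg _).trans hy
      have e1 : 0 ≤ K * M := by positivity
      have e2 : 0 ≤ N * (K * (M + K * M)) := by positivity
      exact ⟨k1, k2.trans (by gcongr; linarith), fun i => (l1 i).trans (by linarith),
        l2.trans (by linarith)⟩
  choose V hVC hVb hVf hVv using hex
  set Φ : Euc N → Euc N := shear j fun x => -ψ x with hΦ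
  have hΦC : ContDiff ℝ 2 Φ := hψ.neg.shear
  have hΦj : ∀ x, Φ x j = x j - ψ x := fun x => by rw [hΦ, shear_apply_self]; ring
  obtain ⟨χ, hχ, hχc, hχR, hχ0, hχ1, hχe⟩ := exists_cutoff hζc.isCompact (isOpen_ball (x := z))
    (hζR.trans (ball_subset_ball (by linarith : R / 4 ≤ R)))
  obtain ⟨A', hA'0, hA'⟩ := exists_bound_derivs hχ.two_of_top hχc.isBounded
  have hGC : ∀ n, ContDiff ℝ 2 fun x => V n (Φ x) - V n (flat j x) := fun n =>
    ((hVC n).comp hΦC).sub ((hVC n).comp (flat j).contDiff)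
  have hflat : ∀ x, flat j x j = 0 := fun x => by simp [flat_apply]
  have hVflat : ∀ n x, 0 ≤ V n (flat j x) ∧ V n (flat j x) ≤ C' * ε n ^ 2 := fun n x => by
    have := hVb n (flat j x) (by rw [hflat, mul_zero])
    rw [hflat, mul_zero, zero_add] at this
    exact ⟨this.1, this.2.1⟩
  set D := C' * ((1 + L) * R + 1) + C' + (C' + K * C' + C') + (C' + N * (K * C') + N * C') with hD
  have hts : ∀ n, tsupport (fun x => χ x * (V n (Φ x) - V n (flat j x))) ⊆ tsupport χ := fun n =>
    tsupport_mul_subset_left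
  refine ⟨fun n x => χ x * (V n (Φ x) - V n (flat j x)), (2 + 2 * N) * (A' * D),
    fun n => C' * ε n ^ 2, fun n => ⟨hχ.two_of_top.mul (hGC n), fun x hx => ?_⟩, fun n x hx => ?_,
    fun n x hx => ?_, by simpa using hεl2.const_mul C', ?_⟩
  · by_cases hxs : x ∈ tsupport χ
    · have hxj : x j = ψ x := ((hG x (hχR hxs)).2).1 hx
      have : Φ x = flat j x := by
        conv_rhs => rw [← add_sub_cancel_right (flat j x) (x j • bv j), flat_add_smul_bv]
        rw [hΦ, shear, hxj]
        module
      simp [this]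
    · simp [image_eq_zero_of_notMem_tsupport hxs]
  · by_cases hxs : x ∈ tsupport χ
    · have hxR := hχR hxs
      have hpos : 0 < s * (x j - ψ x) := ((hG x hxR).1).1 hx
      have hle : s * (x j - ψ x) ≤ (1 + L) * R := by
        have hzj : z j = ψ z := ((hG z (mem_ball_self hR)).2).1 hz
        have e1 : |x j - z j| ≤ ‖x - z‖ := PiLp.norm_apply_le (x - z) j
        have e2 := hL x z
        have e3 : ‖x - z‖ ≤ R := by rw [← dist_eq_norm]; exact (mem_ball.1 hxR).le
        have e4 : s * (x j - ψ x) ≤ |(x j - z j) - (ψ x - ψ z)| := by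
          rw [show (x j - z j) - (ψ x - ψ z) = x j - ψ x by rw [hzj]; ring]
          rcases hs with rfl | rfl
          · rw [one_mul]; exact le_abs_self _
          · rw [neg_one_mul]; exact neg_le_abs _
        have e5 := abs_sub (x j - z j) (ψ x - ψ z)
        have e6 : L * ‖x - z‖ ≤ L * R := by gcongr
        linarith
      obtain ⟨b1, b2, b3, b4⟩ := hVb n (Φ x) (by rw [hΦj]; exact hpos.le)
      rw [hΦj] at b2
      obtain ⟨l1, l2⟩ := lap_shear_bound hψ hinv hK (hVC n) b3 b4
      obtain ⟨a0, a1, a2⟩ := hA' x hxs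
      obtain ⟨c1, c2⟩ := hVflat n x
      have hε2 : ε n ^ 2 ≤ 1 := pow_le_one₀ (hε0 n).le (hε1 n)
      have hVΦ : V n (Φ x) ≤ C' * ((1 + L) * R + 1) := b2.trans (by gcongr)
      have hVfl : V n (flat j x) ≤ C' := c2.trans (mul_le_of_le_one_right hC'0 hε2)
      have d1 : 0 ≤ C' * ((1 + L) * R + 1) := by positivity
      have d2 : 0 ≤ K * C' := by positivity
      have d3 : 0 ≤ N * (K * C') := by positivity
      have d4 : 0 ≤ N * C' := by positivity
      have hf1 : ContDiff ℝ 2 fun x => V n (Φ x) := (hVC n).comp hΦC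
      have hf2 : ContDiff ℝ 2 fun x => V n (flat j x) := (hVC n).comp (flat j).contDiff
      refine abs_lap_mul_le hχ.two_of_top (hGC n) a0 a1 a2 ?_ (fun i => ?_) ?_
      · rw [abs_le]; constructor <;> linarith
      · rw [pd_sub (hf1.differentiable (by norm_num) x) (hf2.differentiable (by norm_num) x)]
        have : |pd i (fun x => V n (flat j x)) x| ≤ C' := by
          rw [pd_comp_flat ((hVC n).of_le (by norm_num)), abs_mul]
          have := (hVb n (flat j x) (by rw [hflat, mul_zero])).2.2.1 i
          by_cases h : i = j <;> simp [h, hC'0] at this ⊢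
          exact this
        have := abs_sub (pd i (fun x => V n (Φ x)) x) (pd i (fun x => V n (flat j x)) x)
        linarith [l1 i]
      · rw [lap_sub hf1 hf2]
        have : |lap (fun x => V n (flat j x)) x| ≤ N * C' := by
          rw [lap_comp_flat (hVC n)]
          refine (Finset.abs_sum_le_sum_abs _ _).trans ?_
          calc _ ≤ ∑ _i : Fin N, C' := Finset.sum_le_sum fun i _ => by
                by_cases h : i = j
                · simp [h, hC'0]
                · simpa [h] using hVf n (flat j x) (hflat x) i h
            _ = N * C' := by simp
        have := abs_sub (lap (fun x => V n (Φ x)) x) (lap (fun x => V n (flat j x)) x)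
        linarith
    · rw [lap_eq_zero_of_notMem_tsupport fun h => hxs (hts n h), abs_zero]
      positivity
  · by_cases hxs : x ∈ tsupport χ
    · have hpos : 0 < s * (x j - ψ x) := ((hG x (hχR hxs)).1).1 hx
      have b1 := (hVb n (Φ x) (by rw [hΦj]; exact hpos.le)).1
      obtain ⟨c1, c2⟩ := hVflat n x
      nlinarith [hχ0 x, hχ1 x, mul_nonneg (hχ0 x) b1, mul_nonneg (sub_nonneg.2 (hχ1 x)) c1]
    · have := hε0 n
      simp only [image_eq_zero_of_notMem_tsupport hxs, zero_mul]
      exact neg_nonpos.2 (by positivity)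
  · rw [ae_restrict_iff' hΩ.1.measurableSet]
    filter_upwards [hPl] with x hx hxΩ
    have hχζ : ζ x ≠ 0 → χ x = 1 := fun h => (hχe x (subset_tsupport _ h)).self_of_nhds
    by_cases hxs : x ∈ tsupport χ
    · have hpos : 0 < s * (x j - ψ x) := ((hG x (hχR hxs)).1).1 hxΩ
      have h1 : Tendsto (fun n => V n (Φ x) - W n x) atTop (𝓝 0) := by
        refine squeeze_zero_norm' ?_ (by simpa using hεl.const_mul C')
        filter_upwards [hεl2.eventually (ge_mem_nhds hpos)] with n hn
        have := hVv n (Φ x) (by rw [hΦj]; exact hn)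
        rwa [hΦ, shear_shear_neg hinv] at this
      have h2 : Tendsto (fun n => V n (flat j x)) atTop (𝓝 0) :=
        squeeze_zero (fun n => (hVflat n x).1) (fun n => (hVflat n x).2)
          (by simpa using hεl2.const_mul C')
      have h3 : Tendsto (fun n => W n x) atTop (𝓝 (ζ x * p x)) := hx.const_mul _
      have h4 := ((h1.add h3).sub h2).const_mul (χ x)
      have h5 : χ x * (0 + ζ x * p x - 0) = ζ x * p x := by
        by_cases h : ζ x = 0
        · simp [h]
        · simp [hχζ h]
      rw [h5] at h4
      exact h4.congr fun n => by ring
    · have hχx := image_eq_zero_of_notMem_tsupport hxs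
      have hζx : ζ x = 0 := by
        by_contra h
        rw [hχζ h] at hχx
        exact one_ne_zero hχx
      simp [hχx, hζx]

theorem HasMollification.isApproximable [NeZero N] {Ω : Set (Euc N)} {p : Euc N → ℝ}
    (hΩ : IsBoundedC2Domain Ω) (hp : HasMollification Ω p) : IsApproximable Ω p := by
  have hloc : ∀ x ∈ closure Ω, ∃ r, 0 < r ∧ ∀ ζ : Euc N → ℝ, ContDiff ℝ 2 ζ → (∀ x, 0 ≤ ζ x) →
      HasCompactSupport ζ → tsupport ζ ⊆ ball x r → IsApproximable Ω fun x => ζ x * p x := by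
    intro x hx
    by_cases hxΩ : x ∈ Ω
    · obtain ⟨r, hr, hb⟩ := Metric.isOpen_iff.1 hΩ.1 x hxΩ
      exact ⟨r, hr, fun ζ h1 h2 h3 h4 => hp.isApproximable_interior hΩ h1 h2 h3 (h4.trans hb)⟩
    · exact hp.exists_isApproximable_boundary hΩ ⟨hx, by rwa [hΩ.1.interior_eq]⟩
  have hcomp : IsCompact (closure Ω) := hΩ.2.2.1.isCompact_closure
  obtain ⟨ζ, -, -, -, h1, h⟩ := hcomp.induction_on
    (p := fun S => ∃ ζ : Euc N → ℝ, ContDiff ℝ 2 ζ ∧ (∀ x, 0 ≤ ζ x) ∧ (∀ x, ζ x ≤ 1) ∧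
      (∀ x ∈ S, ζ x = 1) ∧ ∀ η : Euc N → ℝ, ContDiff ℝ 2 η → (∀ x, 0 ≤ η x) →
        IsApproximable Ω fun x => η x * ζ x * p x)
    ⟨fun _ => 0, contDiff_const, by simp, by simp, by simp, fun η _ _ => by
      simpa using isApproximable_zero Ω⟩
    (fun S T hST ⟨ζ, h1, h2, h3, h4, h5⟩ => ⟨ζ, h1, h2, h3, fun x hx => h4 x (hST hx), h5⟩)
    (fun S T ⟨ζ, h1, h2, h3, h4, h5⟩ ⟨ξ, k1, k2, k3, k4, k5⟩ =>
      ⟨fun x => ζ x + (1 - ζ x) * ξ x, h1.add ((contDiff_const.sub h1).mul k1),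
        fun x => add_nonneg (h2 x) (mul_nonneg (sub_nonneg.2 (h3 x)) (k2 x)),
        fun x => by nlinarith [h3 x, k3 x, h2 x, k2 x],
        fun x hx => by
          rcases hx with hx | hx
          · simp [h4 x hx]
          · simp [k4 x hx],
        fun η hη hη0 => ((h5 η hη hη0).add (k5 (fun x => η x * (1 - ζ x))
          (hη.mul (contDiff_const.sub h1))
          fun x => mul_nonneg (hη0 x) (sub_nonneg.2 (h3 x)))).congr
          (Eventually.of_forall fun x => by ring)⟩)
    (fun x hx => by
      obtain ⟨r, hr, h⟩ := hloc x hx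
      obtain ⟨χ, hχ, hχc, hχR, hχ0, hχ1, hχe⟩ := exists_cutoff (isCompact_closedBall x (r / 2))
        (isOpen_ball (x := x) (ε := r)) (closedBall_subset_ball (by linarith))
      refine ⟨closedBall x (r / 2), mem_nhdsWithin_of_mem_nhds
        (closedBall_mem_nhds x (by positivity)), χ, hχ.two_of_top, hχ0, hχ1,
        fun y hy => (hχe y hy).self_of_nhds, fun η hη hη0 => h _ (hη.mul hχ.two_of_top)
          (fun y => mul_nonneg (hη0 y) (hχ0 y)) (hχc.mul_left) ?_⟩
      exact tsupport_mul_subset_right.trans hχR)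
  refine (h (fun _ => 1) contDiff_const fun _ => zero_le_one).congr ?_
  rw [ae_restrict_iff' hΩ.1.measurableSet]
  exact Eventually.of_forall fun x hx => by rw [h1 x (subset_closure hx)]; ring

theorem exists_cutoff_seq [NeZero N] {Ω : Set (Euc N)} (hΩ : IsBoundedC2Domain Ω) :
    ∃ ξ : ℕ → Euc N → ℝ, (∀ n, ContDiff ℝ 2 (ξ n)) ∧ (∀ n, HasCompactSupport (ξ n)) ∧
      (∀ n, tsupport (ξ n) ⊆ Ω) ∧ (∀ n x, 0 ≤ ξ n x) ∧ (∀ n x, ξ n x ≤ 1) ∧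
      ∀ x ∈ Ω, ∀ᶠ n in atTop, ξ n x = 1 := by
  have h : ∀ n : ℕ, ∃ χ : Euc N → ℝ, ContDiff ℝ (⊤ : ℕ∞) χ ∧ HasCompactSupport χ ∧
      tsupport χ ⊆ Ω ∧ (∀ x, 0 ≤ χ x) ∧ (∀ x, χ x ≤ 1) ∧
      ∀ x ∈ closure Ω ∩ {x | 1 / ((n:ℝ) + 1) ≤ rho Ω x}, ∀ᶠ y in 𝓝 x, χ y = 1 := fun n => by
    refine exists_cutoff (hΩ.2.2.1.isCompact_closure.inter_right
      (isClosed_le continuous_const (continuous_rho Ω))) hΩ.1 fun x hx => ?_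
    rcases mem_or_mem_frontier hx.1 with h | h
    · exact h
    · have h0 : rho Ω x = 0 := infDist_zero_of_mem h
      have h1 : 1 / ((n:ℝ) + 1) ≤ rho Ω x := hx.2
      have : 0 < 1 / ((n:ℝ) + 1) := by positivity
      linarith
  choose ξ h1 h2 h3 h4 h5 h6 using h
  refine ⟨ξ, fun n => (h1 n).two_of_top, h2, h3, h4, h5, fun x hx => ?_⟩
  filter_upwards [tendsto_one_div_add_atTop_nhds_zero_nat.eventually
    (ge_mem_nhds (hΩ.rho_pos hx))] with n hn
  exact (h6 n x ⟨subset_closure hx, hn⟩).self_of_nhds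

theorem exists_contDiff_integral_sub_le [NeZero N] {Ω : Set (Euc N)} (hΩ : IsBoundedC2Domain Ω)
    {z : Euc N → ℝ} (hz : IntegrableOn z Ω) {ε : ℝ} (hε : 0 < ε) :
    ∃ χ : Euc N → ℝ, ContDiff ℝ 2 χ ∧ HasCompactSupport χ ∧ tsupport χ ⊆ Ω ∧
      ∫ x in Ω, |z x - χ x| ≤ ε := by
  have hO := hΩ.1
  obtain ⟨g, hgc, hg, hge⟩ := MemLp.exist_eLpNorm_sub_le (p := 1) one_ne_top le_rfl
    (memLp_one_iff_integrable.2 ((integrable_indicator_iff hO.measurableSet).2 hz))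
    (half_pos hε)
  have hg2 : ContDiff ℝ 2 g := hg.two_of_top
  have hgi : Integrable g := hg2.continuous.integrable_of_hasCompactSupport hgc
  have h1 : ∫ x in Ω, |z x - g x| ≤ ε / 2 := by
    have e1 : ∫ x in Ω, |z x - g x| = ∫ x in Ω, |(Ω.indicator z - g) x| :=
      setIntegral_congr_fun hO.measurableSet fun x hx => by simp [indicator_of_mem hx]
    have hi : Integrable (Ω.indicator z - g) :=
      ((integrable_indicator_iff hO.measurableSet).2 hz).sub hgi
    rw [e1]
    refine (setIntegral_le_integral hi.abs (ae_of_all _ fun x => abs_nonneg _)).trans ?_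
    rw [eLpNorm_one_eq_lintegral_enorm] at hge
    have := toReal_mono ofReal_ne_top hge
    rwa [toReal_ofReal (by positivity), ← integral_norm_eq_lintegral_enorm
      hi.aestronglyMeasurable] at this
  obtain ⟨ξ, k1, k2, k3, k4, k5, k6⟩ := exists_cutoff_seq hΩ
  have h2 : Tendsto (fun n => ∫ x in Ω, |g x - ξ n x * g x|) atTop (𝓝 (∫ x in Ω, (0:ℝ))) := by
    refine tendsto_integral_of_dominated_convergence (fun x => |g x|)
      (fun n => (hg2.continuous.sub
        ((k1 n).continuous.mul hg2.continuous)).abs.aestronglyMeasurable)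
      hgi.abs.integrableOn (fun n => ae_of_all _ fun x => ?_) ?_
    · rw [Real.norm_eq_abs, abs_abs, show g x - ξ n x * g x = (1 - ξ n x) * g x by ring, abs_mul,
        abs_of_nonneg (sub_nonneg.2 (k5 n x))]
      exact mul_le_of_le_one_left (abs_nonneg _) (by linarith [k4 n x])
    · rw [ae_restrict_iff' hO.measurableSet]
      refine ae_of_all _ fun x hx => tendsto_const_nhds.congr' ?_
      filter_upwards [k6 x hx] with n hn
      simp [hn]
  rw [integral_zero] at h2
  obtain ⟨n, hn⟩ := (h2.eventually (ge_mem_nhds (half_pos hε))).exists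
  refine ⟨fun x => ξ n x * g x, (k1 n).mul hg2, (k2 n).mul_right,
    tsupport_mul_subset_left.trans (k3 n), ?_⟩
  have hi1 : IntegrableOn (fun x => |z x - g x|) Ω := (hz.sub hgi.integrableOn).abs
  have hξi : Integrable fun x => ξ n x * g x :=
    ((k1 n).mul hg2).continuous.integrable_of_hasCompactSupport (k2 n).mul_right
  have hi2 : IntegrableOn (fun x => |g x - ξ n x * g x|) Ω := (hgi.sub hξi).abs.integrableOn
  calc ∫ x in Ω, |z x - ξ n x * g x| ≤ ∫ x in Ω, (|z x - g x| + |g x - ξ n x * g x|) :=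
        integral_mono_of_nonneg (ae_of_all _ fun x => abs_nonneg _) (hi1.add hi2)
          (ae_of_all _ fun x => abs_sub_le _ _ _)
    _ ≤ ε := by rw [integral_add hi1 hi2]; linarith

/-- Weak-* convergence in `L^∞` follows from convergence against smooth compactly supported
functions. -/
theorem tendsto_integral_mul_of_bounded [NeZero N] {Ω : Set (Euc N)} (hΩ : IsBoundedC2Domain Ω)
    {z q : Euc N → ℝ} {h : ℕ → Euc N → ℝ} (hz : IntegrableOn z Ω) {C : ℝ}
    (hhm : ∀ n, AEStronglyMeasurable (h n) (volume.restrict Ω))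
    (hh : ∀ n, ∀ᵐ x ∂volume.restrict Ω, |h n x| ≤ C)
    (hqm : AEStronglyMeasurable q (volume.restrict Ω)) (hq : ∀ᵐ x ∂volume.restrict Ω, |q x| ≤ C)
    (hχ : ∀ χ : Euc N → ℝ, ContDiff ℝ 2 χ → HasCompactSupport χ → tsupport χ ⊆ Ω →
      Tendsto (fun n => ∫ x in Ω, χ x * h n x) atTop (𝓝 (∫ x in Ω, χ x * q x))) :
    Tendsto (fun n => ∫ x in Ω, z x * h n x) atTop (𝓝 (∫ x in Ω, z x * q x)) := by
  have key : ∀ χ, IntegrableOn χ Ω → ∀ k, AEStronglyMeasurable k (volume.restrict Ω) →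
      (∀ᵐ x ∂volume.restrict Ω, |k x| ≤ C) →
      |(∫ x in Ω, z x * k x) - ∫ x in Ω, χ x * k x| ≤ |C| * ∫ x in Ω, |z x - χ x| := by
    intro χ hχi k hkm hk
    have i1 : Integrable (fun x => z x * k x) (volume.restrict Ω) := Integrable.mul_bdd hz hkm hk
    have i2 : Integrable (fun x => χ x * k x) (volume.restrict Ω) := Integrable.mul_bdd hχi hkm hk
    rw [← integral_sub i1 i2, ← integral_const_mul]
    refine (abs_integral_le_integral_abs).trans
      (integral_mono_of_nonneg (ae_of_all _ fun x => abs_nonneg _)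
        ((hz.sub hχi).abs.const_mul _) ?_)
    filter_upwards [hk] with x hx
    rw [← sub_mul, abs_mul, mul_comm]
    exact mul_le_mul_of_nonneg_right (hx.trans (le_abs_self C)) (abs_nonneg _)
  rw [Metric.tendsto_atTop]
  intro ε hε
  obtain ⟨χ, h1, h2, h3, h4⟩ := exists_contDiff_integral_sub_le hΩ hz
    (ε := ε / (4 * (|C| + 1))) (by positivity)
  have hχi : IntegrableOn χ Ω :=
    (h1.continuous.integrable_of_hasCompactSupport h2).integrableOn
  obtain ⟨n0, hn0⟩ := Metric.tendsto_atTop.1 (hχ χ h1 h2 h3) (ε / 2) (half_pos hε)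
  refine ⟨n0, fun n hn => ?_⟩
  have e1 := key χ hχi (h n) (hhm n) (hh n)
  have e2 := key χ hχi q hqm hq
  have e3 := hn0 n hn
  have e4 : |C| * ∫ x in Ω, |z x - χ x| ≤ ε / 4 := by
    calc _ ≤ |C| * (ε / (4 * (|C| + 1))) := by gcongr
      _ ≤ (|C| + 1) * (ε / (4 * (|C| + 1))) := by gcongr; linarith
      _ = ε / 4 := by field_simp
  rw [Real.dist_eq] at e3 ⊢
  rw [abs_le] at e1 e2
  rw [abs_lt] at e3 ⊢
  constructor <;> linarith [e1.1, e1.2, e2.1, e2.2, e3.1, e3.2]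

theorem integral_test_le [NeZero N] {Ω : Set (Euc N)} (hΩ : IsBoundedC2Domain Ω)
    {z f : Euc N → ℝ} {ν : Measure (Euc N)} (hz : IntegrableOn z Ω)
    (hf : IntegrableOn (fun x => f x * rho Ω x) Ω) (hν : MemMrho Ω ν)
    (h : ∀ φ, TestFun Ω φ →
      ∫ x in Ω, z x * (-lap φ x) = (∫ x in Ω, f x * φ x) - ∫ x, φ x ∂ν)
    {V : Euc N → ℝ} (hV : TestFun Ω V) (hV0 : ∀ x ∈ Ω, 0 ≤ V x) (hV1 : ∀ x ∈ Ω, 1 ≤ - lap V x)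
    {c θ v : Euc N → ℝ} (hc : Measurable c) (hc0 : ∀ x, 0 ≤ c x) {C : ℝ} (hcC : ∀ x, c x ≤ C)
    (hθ : Measurable θ) (hθ0 : ∀ x, 0 ≤ θ x) (hθ1 : ∀ x, θ x ≤ 1)
    (hvm : AEStronglyMeasurable v (volume.restrict Ω))
    (hvV : ∀ᵐ x ∂volume.restrict Ω, 0 ≤ v x ∧ v x ≤ V x)
    (hv : ∀ φ, TestFun Ω φ → ∫ x in Ω, v x * (-lap φ x + c x * φ x) = ∫ x in Ω, θ x * φ x) :
    ∫ x in Ω, z x * (θ x - c x * v x) ≤ ∫ x in Ω, f x * v x := by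
  have hO := hΩ.1
  haveI : IsFiniteMeasure (volume.restrict Ω) := ⟨by
    rw [Measure.restrict_apply_univ]; exact hΩ.volume_lt_top⟩
  obtain ⟨B, hB0, hB⟩ := exists_bound_of_continuous hV.1.continuous hΩ.2.2.1
  have hC0 : 0 ≤ C := (hc0 0).trans (hcC 0)
  have hmem : ∀ᵐ x ∂volume.restrict Ω, x ∈ Ω := ae_restrict_mem hO.measurableSet
  have hvB : ∀ᵐ x ∂volume.restrict Ω, ‖v x‖ ≤ B := by
    filter_upwards [hvV, hmem] with x hx hxΩ
    rw [Real.norm_eq_abs, abs_of_nonneg hx.1]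
    exact hx.2.trans ((le_abs_self _).trans (hB x hxΩ))
  have hvi : IntegrableOn v Ω := Integrable.of_bound hvm B hvB
  have hci : ∀ᵐ x ∂volume.restrict Ω, ‖c x‖ ≤ C := ae_of_all _ fun x => by
    rw [Real.norm_eq_abs, abs_of_nonneg (hc0 x)]; exact hcC x
  have hcv : IntegrableOn (fun x => v x * c x) Ω :=
    Integrable.mul_bdd hvi hc.aestronglyMeasurable hci
  have hθi : IntegrableOn θ Ω := Integrable.of_bound hθ.aestronglyMeasurable 1
    (ae_of_all _ fun x => by rw [Real.norm_eq_abs, abs_of_nonneg (hθ0 x)]; exact hθ1 x)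
  set q : Euc N → ℝ := Ω.indicator fun x => θ x - c x * max 0 (min (v x) (V x)) with hq
  have hqv : ∀ᵐ x ∂volume.restrict Ω, q x = θ x - c x * v x := by
    filter_upwards [hvV, hmem] with x hx hxΩ
    rw [hq, indicator_of_mem hxΩ, min_eq_left hx.2, max_eq_right hx.1]
  have hqb : ∀ x, |q x| ≤ 1 + C * B := fun x => by
    by_cases hx : x ∈ Ω
    · rw [hq, indicator_of_mem hx]
      have h1 : 0 ≤ max 0 (min (v x) (V x)) := le_max_left _ _
      have h2 : max 0 (min (v x) (V x)) ≤ B :=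
        max_le hB0 ((min_le_right _ _).trans ((le_abs_self _).trans (hB x hx)))
      have h3 := mul_le_mul (hcC x) h2 h1 hC0
      have h4 := mul_nonneg (hc0 x) h1
      rw [abs_le]
      constructor <;> linarith [hθ0 x, hθ1 x]
    · rw [hq, indicator_of_notMem hx, abs_zero]; positivity
  have hqm : AEStronglyMeasurable q (volume.restrict Ω) :=
    (hθ.aestronglyMeasurable.sub (hc.aestronglyMeasurable.mul hvm)).congr
      (hqv.mono fun x hx => by rw [hx]; rfl)
  have hqint : ∀ φ, TestFun Ω φ → ∫ x in Ω, v x * (-lap φ x) = ∫ x in Ω, q x * φ x := by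
    intro φ hφ
    have i1 : IntegrableOn (fun x => v x * (-lap φ x)) Ω :=
      integrableOn_mul_of_continuous hΩ hvi (continuous_lap hφ.1).neg
    have i2 : IntegrableOn (fun x => v x * c x * φ x) Ω :=
      integrableOn_mul_of_continuous hΩ hcv hφ.1.continuous
    have i3 : IntegrableOn (fun x => θ x * φ x) Ω :=
      integrableOn_mul_of_continuous hΩ hθi hφ.1.continuous
    have e1 : ∫ x in Ω, q x * φ x = ∫ x in Ω, (θ x * φ x - v x * c x * φ x) :=
      integral_congr_ae (hqv.mono fun x hx => by simp only [hx]; ring)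
    have e2 : ∫ x in Ω, v x * (-lap φ x + c x * φ x) =
        ∫ x in Ω, (v x * (-lap φ x) + v x * c x * φ x) := by congr 1; ext x; ring
    have e3 := hv φ hφ
    rw [e2, integral_add i1 i2] at e3
    rw [e1, integral_sub i3 i2]
    linarith
  have happ : IsApproximable Ω (Ω.indicator v) := by
    refine HasMollification.isApproximable hΩ (exists_mollification (q := q) hΩ hV
      ((integrable_indicator_iff hO.measurableSet).2 hvi) ?_ hqb fun φ hφ => ?_)
    · filter_upwards [hvV, hmem] with x hx hxΩ
      rwa [indicator_of_mem hxΩ]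
    · rw [← hqint φ hφ]
      exact setIntegral_congr_fun hO.measurableSet fun x hx => by simp [indicator_of_mem hx]
  obtain ⟨φ, C1, η, hφ, hφl, hφη, hη, hφv⟩ := happ
  replace hφv : ∀ᵐ x ∂volume.restrict Ω, Tendsto (fun n => φ n x) atTop (𝓝 (v x)) := by
    filter_upwards [hφv, hmem] with x hx hxΩ
    rwa [indicator_of_mem hxΩ] at hx
  obtain ⟨CV, hCV0, hCV⟩ := hV.exists_le_rho hΩ
  set E := (|C1| + 1) * CV with hE
  have hE0 : 0 ≤ E := by positivity
  have hφE : ∀ n, ∀ x ∈ Ω, |φ n x| ≤ E * rho Ω x := fun n x hx => by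
    have h1 := le_mul_of_lap_le hΩ hV hV1 (hφ n) (C := |C1| + 1)
      (fun y hy => by linarith [hφl n y hy, le_abs_self C1]) x hx
    have h2 := (le_abs_self _).trans (hCV x (subset_closure hx))
    rw [hE, mul_assoc]
    exact h1.trans (by gcongr)
  have hmin : Tendsto (fun n => ∫ x, min (E * rho Ω x) |η n| ∂ν) atTop (𝓝 0) := by
    rw [show (0:ℝ) = ∫ x, (0:ℝ) ∂ν by simp]
    have hρ0 : ∀ x, 0 ≤ E * rho Ω x := fun x => mul_nonneg hE0 (rho_nonneg Ω x)
    refine tendsto_integral_of_dominated_convergence (fun x => E * rho Ω x) (fun n =>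
      ((continuous_const.mul (continuous_rho Ω)).min continuous_const).aestronglyMeasurable)
      ((integrable_rho_of_memMrho hν).const_mul E) (fun n => ae_of_all _ fun x => ?_)
      (ae_of_all _ fun x => ?_)
    · rw [Real.norm_eq_abs, abs_of_nonneg (le_min (hρ0 x) (abs_nonneg _))]
      exact min_le_left _ _
    · exact squeeze_zero (fun n => le_min (hρ0 x) (abs_nonneg _)) (fun n => min_le_right _ _)
        (by simpa using hη.abs)
  have hfl : Tendsto (fun n => ∫ x in Ω, f x * φ n x) atTop (𝓝 (∫ x in Ω, f x * v x)) := by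
    refine tendsto_integral_of_dominated_convergence (fun x => |f x * rho Ω x| * E)
      (fun n => (integrableOn_mul_of_rho hΩ hf (hφ n)).aestronglyMeasurable)
      (hf.abs.mul_const E) (fun n => ?_) (hφv.mono fun x hx => hx.const_mul _)
    filter_upwards [hmem] with x hx
    rw [Real.norm_eq_abs, abs_mul, abs_mul, abs_of_nonneg (rho_nonneg Ω x), mul_assoc,
      mul_comm _ E]
    exact mul_le_mul_of_nonneg_left (hφE n x hx) (abs_nonneg _)
  have hzl : Tendsto (fun n => ∫ x in Ω, z x * (-lap (φ n) x)) atTop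
      (𝓝 (∫ x in Ω, z x * q x)) := by
    refine tendsto_integral_mul_of_bounded hΩ hz (C := |C1| + (1 + C * B))
      (fun n => (continuous_lap (hφ n).1).neg.aestronglyMeasurable) (fun n => ?_) hqm
      (ae_of_all _ fun x => (hqb x).trans (by linarith [abs_nonneg C1])) fun χ h1 h2 h3 => ?_
    · filter_upwards [hmem] with x hx
      rw [abs_neg]
      have : 0 ≤ C * B := by positivity
      linarith [hφl n x hx, le_abs_self C1]
    · have hχT : TestFun Ω χ := TestFun.of_tsupport_subset hO h1 h3
      have e1 : ∀ n, ∫ x in Ω, χ x * (-lap (φ n) x) = ∫ x in Ω, φ n x * (-lap χ x) := fun n => by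
        rw [setIntegral_eq_integral_of_forall_compl_eq_zero fun x hx => by
            rw [image_eq_zero_of_notMem_tsupport fun h => hx (h3 h), zero_mul],
          setIntegral_eq_integral_of_forall_compl_eq_zero fun x hx => by
            rw [lap_eq_zero_of_notMem_tsupport fun h => hx (h3 h), neg_zero, mul_zero]]
        have := integral_mul_lap h1 (hφ n).1 h2
        simp only [mul_neg, integral_neg, this, mul_comm]
      have e2 : ∫ x in Ω, χ x * q x = ∫ x in Ω, v x * (-lap χ x) := by
        rw [hqint χ hχT]; simp only [mul_comm]
      simp only [e1, e2]
      obtain ⟨A, hA0, hA⟩ := exists_bound_of_continuous (continuous_lap h1) hΩ.2.2.1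
      obtain ⟨R, hR0, hR⟩ := exists_bound_of_continuous (continuous_rho Ω) hΩ.2.2.1
      refine tendsto_integral_of_dominated_convergence (fun x => E * R * A)
        (fun n => ((hφ n).1.continuous.mul (continuous_lap h1).neg).aestronglyMeasurable)
        (integrable_const _) (fun n => ?_) (hφv.mono fun x hx => hx.mul_const _)
      filter_upwards [hmem] with x hx
      rw [Real.norm_eq_abs, abs_mul, abs_neg]
      have := (le_abs_self _).trans (hR x hx)
      exact mul_le_mul ((hφE n x hx).trans (by gcongr)) (hA x hx) (abs_nonneg _) (by positivity)
  have hle : ∀ n, ∫ x in Ω, z x * (-lap (φ n) x) ≤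
      (∫ x in Ω, f x * φ n x) + ∫ x, min (E * rho Ω x) |η n| ∂ν := fun n => by
    rw [h (φ n) (hφ n), sub_eq_add_neg, ← integral_neg]
    have hmc : AEStronglyMeasurable (fun x => min (E * rho Ω x) |η n|) ν :=
      ((continuous_const.mul (continuous_rho Ω)).min continuous_const).aestronglyMeasurable
    have hmi : Integrable (fun x => min (E * rho Ω x) |η n|) ν := by
      refine integrable_of_le_rho hν hmc (C := E) fun x _ => ?_
      rw [abs_of_nonneg (le_min (mul_nonneg hE0 (rho_nonneg Ω x)) (abs_nonneg _))]
      exact min_le_left _ _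
    refine add_le_add_right (integral_mono_ae ((hφ n).integrable hΩ hν).neg hmi ?_) _
    filter_upwards [hν.ae_mem] with x hx
    change -(φ n x) ≤ _
    exact le_min ((neg_le_abs _).trans (hφE n x hx))
      (by linarith [hφη n x hx, le_abs_self (η n)])
  have hfin := le_of_tendsto_of_tendsto' hzl (hfl.add hmin) hle
  rw [add_zero] at hfin
  refine (integral_congr_ae ?_).trans_le hfin
  exact hqv.mono fun x hx => by simp only [hx]

/-- A one-sided Kato comparison principle for `-Δz = f - ν` with `ν ≥ 0`. -/
theorem ae_nonpos_of_weak_subsolution [NeZero N] {Ω : Set (Euc N)} (hΩ : IsBoundedC2Domain Ω)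
    {z f : Euc N → ℝ} {ν : Measure (Euc N)} (hz : IntegrableOn z Ω)
    (hfm : AEStronglyMeasurable f (volume.restrict Ω))
    (hf : IntegrableOn (fun x => f x * rho Ω x) Ω) (hν : MemMrho Ω ν)
    (h : ∀ φ, TestFun Ω φ →
      ∫ x in Ω, z x * (-lap φ x) = (∫ x in Ω, f x * φ x) - ∫ x, φ x ∂ν)
    (hfz : ∀ᵐ x ∂volume.restrict Ω, 0 ≤ z x → f x ≤ 0) :
    ∀ᵐ x ∂volume.restrict Ω, z x ≤ 0 := by
  have hO := hΩ.1
  haveI : IsFiniteMeasure (volume.restrict Ω) := ⟨by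
    rw [Measure.restrict_apply_univ]; exact hΩ.volume_lt_top⟩
  have hmem : ∀ᵐ x ∂volume.restrict Ω, x ∈ Ω := ae_restrict_mem hO.measurableSet
  obtain ⟨V, hV, hV0, hV1⟩ := hΩ.exists_superharmonic
  obtain ⟨B, hB0, hB⟩ := exists_bound_of_continuous hV.1.continuous hΩ.2.2.1
  obtain ⟨z', hz'm, hz'⟩ := hz.aestronglyMeasurable
  obtain ⟨f', hf'm, hf'⟩ := hfm
  have hz'M := hz'm.measurable
  have hf'M := hf'm.measurable
  have hneg : MeasurableSet {x | z' x < 0} := measurableSet_lt hz'M measurable_const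
  have hpos : MeasurableSet {x | 0 < z' x} := measurableSet_lt measurable_const hz'M
  set θ : Euc N → ℝ := {x | 0 < z' x}.indicator fun _ => 1 with hθ
  set c : ℕ → Euc N → ℝ := fun k => {x | z' x < 0}.indicator
    fun x => min (k : ℝ) (max (f' x) 0 / |z' x|) with hcdef
  have hcm : ∀ k, Measurable (c k) := fun k =>
    (measurable_const.min ((hf'M.max measurable_const).div hz'M.abs)).indicator hneg
  have hc0 : ∀ k x, 0 ≤ c k x := fun k => indicator_nonneg fun x _ =>
    le_min k.cast_nonneg (div_nonneg (le_max_right _ _) (abs_nonneg _))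
  have hcC : ∀ (k : ℕ) x, c k x ≤ (k : ℝ) := fun k =>
    indicator_le' (fun x _ => min_le_left _ _) fun x _ => k.cast_nonneg
  have hθm : Measurable θ := measurable_const.indicator hpos
  have hθ0 : ∀ x, 0 ≤ θ x := indicator_nonneg fun _ _ => zero_le_one
  have hθ1 : ∀ x, θ x ≤ 1 := indicator_le' (fun _ _ => le_rfl) fun _ _ => zero_le_one
  choose v hvm hvV hv using fun k => exists_weak_linear hΩ hV hV0 hV1 (hcm k) (hc0 k) (hcC k)
    hθm hθ0 hθ1
  set D : ℕ → Euc N → ℝ := fun k => {x | z' x < 0}.indicator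
    fun x => max (max (f' x) 0 - k * |z' x|) 0 * V x with hD
  have hfV : IntegrableOn (fun x => f x * V x) Ω := integrableOn_mul_of_rho hΩ hf hV
  have hDle : ∀ k, ∀ᵐ x ∂volume.restrict Ω, ‖D k x‖ ≤ ‖f x * V x‖ := fun k => by
    filter_upwards [hmem, hf'] with x hx hfx
    rw [hD, norm_mul, hfx]
    refine (norm_indicator_le_norm_self _ _).trans ?_
    rw [norm_mul]
    refine mul_le_mul_of_nonneg_right ?_ (norm_nonneg _)
    rw [Real.norm_eq_abs, Real.norm_eq_abs, abs_of_nonneg (le_max_right _ _)]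
    have : 0 ≤ (k : ℝ) * |z' x| := by positivity
    exact max_le (by linarith [max_le (le_abs_self (f' x)) (abs_nonneg (f' x))]) (abs_nonneg _)
  have hDm : ∀ k, AEStronglyMeasurable (D k) (volume.restrict Ω) := fun k =>
    (((((hf'M.max measurable_const).sub (hz'M.abs.const_mul _)).max measurable_const).mul
      hV.1.continuous.measurable).indicator hneg).aestronglyMeasurable
  have hDi : ∀ k, IntegrableOn (D k) Ω := fun k => Integrable.mono hfV (hDm k) (hDle k)
  have hD0 : Tendsto (fun k => ∫ x in Ω, D k x) atTop (𝓝 0) := by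
    rw [show (0:ℝ) = ∫ x in Ω, (0:ℝ) by simp]
    refine tendsto_integral_of_dominated_convergence (fun x => ‖f x * V x‖) hDm hfV.norm hDle
      (ae_of_all _ fun x => tendsto_const_nhds.congr' ?_)
    by_cases hx : z' x < 0
    · have hx' : 0 < |z' x| := abs_pos.2 hx.ne
      filter_upwards [eventually_ge_atTop ⌈max (f' x) 0 / |z' x|⌉₊] with k hk
      have := (div_le_iff₀ hx').1 (Nat.ceil_le.1 hk)
      simp only [hD]
      rw [indicator_of_mem (show x ∈ {x | z' x < 0} from hx), max_eq_right (by linarith),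
        zero_mul]
    · exact Eventually.of_forall fun k => by
        simp only [hD]
        rw [indicator_of_notMem (show x ∉ {x | z' x < 0} from hx)]
  have hzp : IntegrableOn (fun x => max (z x) 0) Ω := hz.pos_part
  have hmain : ∀ k, ∫ x in Ω, max (z x) 0 ≤ ∫ x in Ω, D k x := fun k => by
    have h1 := integral_test_le hΩ hz hf hν h hV hV0 hV1 (hcm k) (hc0 k) (hcC k) hθm hθ0 hθ1
      (hvm k) (hvV k) (hv k)
    have hzcv : IntegrableOn (fun x => z x * (c k x * v k x)) Ω := by
      refine Integrable.mul_bdd (c := k * B) hz ((hcm k).aestronglyMeasurable.mul (hvm k)) ?_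
      filter_upwards [hmem, hvV k] with x hx hvx
      rw [Real.norm_eq_abs, abs_of_nonneg (mul_nonneg (hc0 k x) hvx.1)]
      exact mul_le_mul (hcC k x) (hvx.2.trans ((le_abs_self _).trans (hB x hx))) hvx.1
        k.cast_nonneg
    have hfv : IntegrableOn (fun x => f x * v k x) Ω := by
      have hfm : AEStronglyMeasurable f (volume.restrict Ω) := ⟨f', hf'm, hf'⟩
      refine Integrable.mono hfV (hfm.mul (hvm k)) ?_
      filter_upwards [hmem, hvV k] with x hx hvx
      rw [norm_mul, norm_mul]
      refine mul_le_mul_of_nonneg_left ?_ (norm_nonneg _)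
      rw [Real.norm_eq_abs, Real.norm_eq_abs, abs_of_nonneg hvx.1, abs_of_nonneg (hV0 x hx)]
      exact hvx.2
    have e1 : ∫ x in Ω, z x * (θ x - c k x * v k x) =
        ∫ x in Ω, (max (z x) 0 - z x * (c k x * v k x)) := by
      refine integral_congr_ae ?_
      filter_upwards [hz'] with x hx
      have : z x * θ x = max (z x) 0 := by
        rw [hx]
        by_cases h0 : 0 < z' x
        · rw [hθ, indicator_of_mem (show x ∈ {x | 0 < z' x} from h0), max_eq_left h0.le, mul_one]
        · rw [hθ, indicator_of_notMem (show x ∉ {x | 0 < z' x} from h0),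
            max_eq_right (not_lt.1 h0), mul_zero]
      simp only [mul_sub, this]
    rw [e1, integral_sub hzp hzcv] at h1
    have h2 : ∫ x in Ω, (f x * v k x + z x * (c k x * v k x)) ≤ ∫ x in Ω, D k x := by
      refine integral_mono_ae (hfv.add hzcv) (hDi k) ?_
      filter_upwards [hmem, hvV k, hz', hf', hfz] with x hx hvx hzx hfx hfzx
      change f x * v k x + z x * (c k x * v k x) ≤ D k x
      by_cases h0 : z' x < 0
      · have hx' : 0 < |z' x| := abs_pos.2 h0.ne
        simp only [hD, hcdef]
        rw [indicator_of_mem (show x ∈ {x | z' x < 0} from h0),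
          indicator_of_mem (show x ∈ {x | z' x < 0} from h0), hzx, hfx]
        have e : z' x * min (k : ℝ) (max (f' x) 0 / |z' x|) =
            - min (k * |z' x|) (max (f' x) 0) := by
          rw [show z' x = -|z' x| by rw [abs_of_neg h0]; ring, neg_mul, abs_neg, abs_abs,
            mul_min_of_nonneg _ _ hx'.le, mul_div_cancel₀ _ hx'.ne', mul_comm]
        have e2 : f' x * v k x + z' x * (min (k : ℝ) (max (f' x) 0 / |z' x|) * v k x) =
            (f' x - min (k * |z' x|) (max (f' x) 0)) * v k x := by
          rw [← mul_assoc, e]; ring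
        rw [e2]
        have h3 : f' x - min (k * |z' x|) (max (f' x) 0) ≤
            max (max (f' x) 0 - k * |z' x|) 0 := by
          rcases le_total (k * |z' x|) (max (f' x) 0) with h4 | h4
          · rw [min_eq_left h4]
            exact (sub_le_sub_right (le_max_left _ _) _).trans (le_max_left _ _)
          · rw [min_eq_right h4]
            exact (sub_nonpos.2 (le_max_left _ _)).trans (le_max_right _ _)
        exact mul_le_mul h3 hvx.2 hvx.1 (le_max_right _ _)
      · simp only [hD, hcdef]
        rw [indicator_of_notMem (show x ∉ {x | z' x < 0} from h0),
          indicator_of_notMem (show x ∉ {x | z' x < 0} from h0), zero_mul, mul_zero, add_zero]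
        exact mul_nonpos_of_nonpos_of_nonneg (hfzx (by rw [hzx]; exact not_lt.1 h0)) hvx.1
    rw [integral_add hfv hzcv] at h2
    linarith
  have hle : ∫ x in Ω, max (z x) 0 ≤ 0 := ge_of_tendsto' hD0 hmain
  have h0 := (integral_eq_zero_iff_of_nonneg_ae (ae_of_all _ fun x => le_max_right _ _) hzp).1
    (le_antisymm hle (integral_nonneg fun x => le_max_right _ _))
  filter_upwards [h0] with x hx
  exact max_eq_right_iff.1 hx

/-- The one-sided `k`-Lipschitz upper envelope of `H`. -/
def lipEnv (H : ℝ → ℝ) (k : ℕ) (t : ℝ) : ℝ := ⨆ q : ℚ, (H q - k * max (q - t) 0)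

theorem bddAbove_lipEnv {H : ℝ → ℝ} {B : ℝ} (hB : ∀ t, |H t| ≤ B) (k : ℕ) (t : ℝ) :
    BddAbove (range fun q : ℚ => H q - k * max (q - t) 0) := by
  refine ⟨B, ?_⟩
  rintro _ ⟨q, rfl⟩
  have : 0 ≤ (k : ℝ) * max (q - t) 0 := mul_nonneg k.cast_nonneg (le_max_right _ _)
  change H q - k * max (q - t) 0 ≤ B
  linarith [(abs_le.1 (hB q)).2]

theorem le_lipEnv {H : ℝ → ℝ} (hH : Continuous H) {B : ℝ} (hB : ∀ t, |H t| ≤ B) (k : ℕ)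
    (t : ℝ) : H t ≤ lipEnv H k t := by
  by_contra! hlt
  have h1 : ∀ᶠ s in 𝓝 t, lipEnv H k t < H s := hH.continuousAt.eventually_const_lt hlt
  obtain ⟨δ, hδ, h2⟩ := Metric.eventually_nhds_iff.1 h1
  obtain ⟨q, hq1, hq2⟩ := exists_rat_btwn (sub_lt_self t hδ)
  have h3 := h2 (y := q) (by rw [Real.dist_eq, abs_lt]; constructor <;> linarith)
  have h4 := le_ciSup (bddAbove_lipEnv hB k t) q
  simp only [max_eq_right (sub_nonpos.2 hq2.le), mul_zero, sub_zero] at h4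
  exact absurd h3 (not_lt.2 h4)

theorem lipEnv_le {H : ℝ → ℝ} {B : ℝ} (hB : ∀ t, |H t| ≤ B) (k : ℕ) (t : ℝ) :
    lipEnv H k t ≤ B := by
  refine ciSup_le fun q => ?_
  have : 0 ≤ (k : ℝ) * max (q - t) 0 := mul_nonneg k.cast_nonneg (le_max_right _ _)
  linarith [(abs_le.1 (hB q)).2]

theorem abs_lipEnv_le {H : ℝ → ℝ} (hH : Continuous H) {B : ℝ} (hB : ∀ t, |H t| ≤ B) (k : ℕ)
    (t : ℝ) : |lipEnv H k t| ≤ B :=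
  abs_le.2 ⟨(abs_le.1 (hB t)).1.trans (le_lipEnv hH hB k t), lipEnv_le hB k t⟩

theorem lipEnv_le_add {H : ℝ → ℝ} {B : ℝ} (hB : ∀ t, |H t| ≤ B) (k : ℕ) {s t : ℝ} (hst : s ≤ t) :
    lipEnv H k t ≤ lipEnv H k s + k * (t - s) := by
  refine ciSup_le fun q => ?_
  have h1 := le_ciSup (bddAbove_lipEnv hB k s) q
  have h2 : max ((q : ℝ) - s) 0 ≤ max ((q : ℝ) - t) 0 + (t - s) := by
    refine max_le ?_ ?_ <;> linarith [le_max_left ((q : ℝ) - t) 0, le_max_right ((q : ℝ) - t) 0]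
  have h3 := mul_le_mul_of_nonneg_left h2 (Nat.cast_nonneg (α := ℝ) k)
  have h4 : H q - k * max (q - s) 0 ≤ lipEnv H k s := h1
  linarith

theorem lipEnv_succ_le {H : ℝ → ℝ} {B : ℝ} (hB : ∀ t, |H t| ≤ B) (k : ℕ) (t : ℝ) :
    lipEnv H (k + 1) t ≤ lipEnv H k t := by
  refine ciSup_mono (bddAbove_lipEnv hB k t) fun q => ?_
  have h1 := le_max_right ((q : ℝ) - t) 0
  push_cast
  linarith

theorem lipEnv_le_shift {H : ℝ → ℝ} (hm : Monotone H) {B : ℝ} (hB : ∀ t, |H t| ≤ B) (k : ℕ)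
    (t : ℝ) {δ : ℝ} (hδ : 2 * B ≤ k * δ) : lipEnv H k t ≤ H (t + δ) := by
  refine ciSup_le fun q => ?_
  have h0 : 0 ≤ (k : ℝ) * max (q - t) 0 := mul_nonneg k.cast_nonneg (le_max_right _ _)
  rcases le_total (q : ℝ) (t + δ) with h | h
  · linarith [hm h]
  · have h1 : (k : ℝ) * δ ≤ k * max (q - t) 0 :=
      mul_le_mul_of_nonneg_left (le_max_of_le_left (by linarith)) k.cast_nonneg
    linarith [(abs_le.1 (hB q)).2, (abs_le.1 (hB (t + δ))).1]

theorem tendsto_lipEnv {H : ℝ → ℝ} (hH : Continuous H) (hm : Monotone H) {B : ℝ}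
    (hB : ∀ t, |H t| ≤ B) {u : ℕ → ℝ} {t : ℝ} (hu : Tendsto u atTop (𝓝 t)) :
    Tendsto (fun k => lipEnv H k (u k)) atTop (𝓝 (H t)) := by
  have h1 : Tendsto (fun k : ℕ => u k + 2 * B / k) atTop (𝓝 t) := by
    simpa using hu.add (tendsto_const_div_atTop_nhds_zero_nat (2 * B))
  refine tendsto_of_tendsto_of_tendsto_of_le_of_le' ((hH.tendsto t).comp hu)
    ((hH.tendsto t).comp h1) (Eventually.of_forall fun k => le_lipEnv hH hB k (u k)) ?_
  filter_upwards [eventually_gt_atTop 0] with k hk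
  have : (k : ℝ) ≠ 0 := by positivity
  exact lipEnv_le_shift hm hB k (u k) (by field_simp; rfl)

/-- Truncation of `s` to `[-m, m]`. -/
def trunc (m s : ℝ) : ℝ := max (-m) (min m s)

theorem continuous_trunc (m : ℝ) : Continuous (trunc m) :=
  continuous_const.max (continuous_const.min continuous_id)

theorem monotone_trunc (m : ℝ) : Monotone (trunc m) := fun _ _ h =>
  max_le_max le_rfl (min_le_min le_rfl h)

theorem abs_trunc_le {m : ℝ} (hm : 0 ≤ m) (s : ℝ) : |trunc m s| ≤ m :=
  abs_le.2 ⟨le_max_left _ _, max_le (by linarith) (min_le_left _ _)⟩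

theorem trunc_of_abs_le {m s : ℝ} (h : |s| ≤ m) : trunc m s = s := by
  rw [trunc, min_eq_right (abs_le.1 h).2, max_eq_right (abs_le.1 h).1]

theorem trunc_of_le_neg {m s : ℝ} (h : s ≤ -m) : trunc m s = -m :=
  max_eq_left ((min_le_right _ _).trans h)

theorem abs_comp_trunc_le {g : ℝ → ℝ} (hodd : ∀ t, g (-t) = - g t) (hmono : Monotone g)
    {m : ℝ} (hm : 0 ≤ m) (s : ℝ) : |g (trunc m s)| ≤ g m := by
  have h := abs_le.1 (abs_trunc_le hm s)
  exact abs_le.2 ⟨by rw [← hodd]; exact hmono h.1, hmono h.2⟩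

theorem measurable_lipEnv_trunc {α : Type*} [MeasurableSpace α] {g : ℝ → ℝ} (hg : Continuous g)
    (hodd : ∀ t, g (-t) = - g t) (hmono : Monotone g) {m u : α → ℝ} (hm : Measurable m)
    (hm0 : ∀ x, 0 ≤ m x) (hu : Measurable u) (k : ℕ) :
    Measurable fun x => lipEnv (fun s => g (trunc (m x) s)) k (u x) := by
  refine Measurable.iSup fun q => ?_
  refine (hg.measurable.comp (hm.neg.max (hm.min measurable_const))).sub
    (((measurable_const.sub hu).max measurable_const).const_mul _)

theorem sum_range_min_sub_min {t : ℝ} (ht : 0 ≤ t) (n : ℕ) :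
    ∑ i ∈ Finset.range n, (min t ((i : ℝ) + 1) - min t i) = min t n := by
  have h := Finset.sum_range_sub (fun i : ℕ => min t (i : ℝ)) n
  push_cast at h
  rw [h, min_eq_right ht, sub_zero]

/-- Solvability of `-ΔE = G` for a nonnegative right-hand side with `∫ G ρ < ∞`. -/
theorem exists_weak_poisson [NeZero N] {Ω : Set (Euc N)} (hΩ : IsBoundedC2Domain Ω)
    {G : Euc N → ℝ} (hG : Measurable G) (hG0 : ∀ x, 0 ≤ G x)
    (hGi : IntegrableOn (fun x => G x * rho Ω x) Ω) :
    ∃ E : Euc N → ℝ, IntegrableOn E Ω ∧ (∀ᵐ x ∂volume.restrict Ω, 0 ≤ E x) ∧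
      ∀ φ, TestFun Ω φ → ∫ x in Ω, E x * (-lap φ x) = ∫ x in Ω, G x * φ x := by
  have hO := hΩ.1
  haveI : IsFiniteMeasure (volume.restrict Ω) := ⟨by
    rw [Measure.restrict_apply_univ]; exact hΩ.volume_lt_top⟩
  have hmem : ∀ᵐ x ∂volume.restrict Ω, x ∈ Ω := ae_restrict_mem hO.measurableSet
  obtain ⟨V, hV, hV0, hV1⟩ := hΩ.exists_superharmonic
  obtain ⟨B, hB0, hB⟩ := exists_bound_of_continuous hV.1.continuous hΩ.2.2.1
  set θ : ℕ → Euc N → ℝ := fun i x => min (G x) ((i : ℝ) + 1) - min (G x) i with hθ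
  have hθm : ∀ i, Measurable (θ i) := fun i =>
    (hG.min measurable_const).sub (hG.min measurable_const)
  have hθ0 : ∀ i x, 0 ≤ θ i x := fun i x => sub_nonneg.2 (min_le_min le_rfl (by linarith))
  have hθ1 : ∀ i x, θ i x ≤ 1 := fun i x => by
    simp only [hθ]
    rcases le_total (G x) i with h | h
    · rw [min_eq_left h]; linarith [min_le_left (G x) ((i : ℝ) + 1)]
    · rw [min_eq_right h]; linarith [min_le_right (G x) ((i : ℝ) + 1)]
  choose e hem heV he using fun i => exists_weak_linear hΩ hV hV0 hV1 (c := fun _ => 0)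
    measurable_const (fun _ => le_rfl) (C := 0) (fun _ => le_rfl) (hθm i) (hθ0 i) (hθ1 i)
  simp only [zero_mul, add_zero] at he
  have hei : ∀ i, IntegrableOn (e i) Ω := fun i => by
    refine Integrable.of_bound (hem i) B ?_
    filter_upwards [heV i, hmem] with x hx hxΩ
    rw [Real.norm_eq_abs, abs_of_nonneg hx.1]
    exact hx.2.trans ((le_abs_self _).trans (hB x hxΩ))
  have hθi : ∀ i, IntegrableOn (θ i) Ω := fun i =>
    Integrable.of_bound (hθm i).aestronglyMeasurable 1 (ae_of_all _ fun x => by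
      rw [Real.norm_eq_abs, abs_of_nonneg (hθ0 i x)]; exact hθ1 i x)
  have hθφ : ∀ i φ, TestFun Ω φ → IntegrableOn (fun x => θ i x * φ x) Ω := fun i φ hφ =>
    integrableOn_mul_of_continuous hΩ (hθi i) hφ.1.continuous
  have hGV := integrableOn_mul_of_rho hΩ hGi hV
  have hele : ∀ i, ∫ x in Ω, e i x ≤ ∫ x in Ω, θ i x * V x := fun i => by
    rw [← he i V hV]
    refine integral_mono_ae (hei i)
      (integrableOn_mul_of_continuous hΩ (hei i) (continuous_lap hV.1).neg) ?_
    filter_upwards [heV i, hmem] with x hx hxΩ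
    exact le_mul_of_one_le_right hx.1 (hV1 x hxΩ)
  have hnorm : ∀ i, ∫ x in Ω, ‖e i x‖ = ∫ x in Ω, e i x := fun i =>
    integral_congr_ae ((heV i).mono fun x hx => by
      simp only [Real.norm_eq_abs, abs_of_nonneg hx.1])
  have hθsum : ∀ φ, TestFun Ω φ → ∀ n, ∑ i ∈ Finset.range n, ∫ x in Ω, θ i x * φ x =
      ∫ x in Ω, min (G x) n * φ x := fun φ hφ n => by
    rw [← integral_finsetSum _ fun i _ => hθφ i φ hφ]
    refine integral_congr_ae (ae_of_all _ fun x => ?_)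
    simp only [hθ, ← Finset.sum_mul, sum_range_min_sub_min (hG0 x)]
  have hsum : Summable fun i => ∫ x in Ω, ‖e i x‖ := by
    refine summable_of_sum_range_le (c := ∫ x in Ω, G x * V x)
      (fun i => integral_nonneg fun x => norm_nonneg _) fun n => ?_
    refine (Finset.sum_le_sum fun i _ => (hnorm i).trans_le (hele i)).trans ?_
    rw [hθsum V hV]
    have hm : AEStronglyMeasurable (fun x => min (G x) n * V x) (volume.restrict Ω) :=
      ((hG.min measurable_const).mul hV.1.continuous.measurable).aestronglyMeasurable
    refine integral_mono_of_nonneg ?_ hGV ?_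
    · filter_upwards [hmem] with x hx
      exact mul_nonneg (le_min (hG0 x) n.cast_nonneg) (hV0 x hx)
    · filter_upwards [hmem] with x hx
      exact mul_le_mul_of_nonneg_right (min_le_left _ _) (hV0 x hx)
  have hfin : ∫⁻ x in Ω, ∑' i, ‖e i x‖ₑ ≠ ⊤ := by
    have h2 := hsum.tsum_ofReal_ne_top
    simp only [ofReal_integral_norm_eq_lintegral_enorm (hei _)] at h2
    rwa [lintegral_tsum fun i => (hem i).enorm]
  have haes : ∀ᵐ x ∂volume.restrict Ω, Summable fun i => e i x := by
    filter_upwards [ae_lt_top' (AEMeasurable.tsum fun i => (hem i).enorm) hfin] with x hx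
    exact Summable.of_nnnorm (ENNReal.tsum_coe_ne_top_iff_summable.1 hx.ne)
  have hnn : ∀ᵐ x ∂volume.restrict Ω, ∀ i, 0 ≤ e i x := ae_all_iff.2 fun i =>
    (heV i).mono fun x hx => hx.1
  refine ⟨fun x => ∑' i, e i x, ?_, hnn.mono fun x hx => tsum_nonneg hx, fun φ hφ => ?_⟩
  · refine ⟨aestronglyMeasurable_of_tendsto_ae atTop
      (f := fun n x => ∑ i ∈ Finset.range n, e i x)
      (fun n => Finset.aestronglyMeasurable_fun_sum _ fun i _ => hem i)
      (haes.mono fun x hx => hx.hasSum.tendsto_sum_nat), ?_⟩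
    refine lt_of_le_of_lt (lintegral_mono_ae (haes.mono fun x hx => ?_)) (lt_top_iff_ne_top.2 hfin)
    exact enorm_tsum_le_tsum_enorm
  · obtain ⟨A, hA0, hA⟩ := exists_bound_of_continuous (continuous_lap hφ.1) hΩ.2.2.1
    have hi : ∀ i, IntegrableOn (fun x => e i x * (-lap φ x)) Ω := fun i =>
      integrableOn_mul_of_continuous hΩ (hei i) (continuous_lap hφ.1).neg
    have hs : Summable fun i => ∫ x in Ω, ‖e i x * (-lap φ x)‖ := by
      refine (hsum.mul_right A).of_nonneg_of_le
        (fun i => integral_nonneg fun x => norm_nonneg _) fun i => ?_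
      rw [← integral_mul_const]
      refine integral_mono_ae (hi i).norm ((hei i).norm.mul_const A) ?_
      filter_upwards [hmem] with x hx
      rw [norm_mul, norm_neg]
      exact mul_le_mul_of_nonneg_left (hA x hx) (norm_nonneg _)
    have h1 := (hasSum_integral_of_summable_integral_norm hi hs).tendsto_sum_nat
    have e1 : ∫ x in Ω, ∑' i, e i x * (-lap φ x) = ∫ x in Ω, (∑' i, e i x) * (-lap φ x) := by
      simp only [tsum_mul_right]
    rw [e1] at h1
    refine tendsto_nhds_unique h1 ?_
    simp only [he _ φ hφ, hθsum φ hφ]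
    have hGφ := integrableOn_mul_of_rho hΩ hGi hφ
    refine tendsto_integral_of_dominated_convergence (fun x => ‖G x * φ x‖)
      (fun n => ((hG.min measurable_const).mul
        hφ.1.continuous.measurable).aestronglyMeasurable) hGφ.norm
      (fun n => ae_of_all _ fun x => ?_) (ae_of_all _ fun x => ?_)
    · rw [norm_mul, norm_mul]
      refine mul_le_mul_of_nonneg_right ?_ (norm_nonneg _)
      rw [Real.norm_eq_abs, Real.norm_eq_abs, abs_of_nonneg (hG0 x),
        abs_of_nonneg (le_min (hG0 x) n.cast_nonneg)]
      exact min_le_left _ _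
    · refine tendsto_const_nhds.congr' ?_
      filter_upwards [eventually_ge_atTop ⌈G x⌉₊] with n hn
      rw [min_eq_left (Nat.ceil_le.1 hn)]

/-- `u` solves `-Δu + h + ν = p - n`, tested against `C²` functions vanishing on `∂Ω`. -/
def IsDefectSol (Ω : Set (Euc N)) (p n : Measure (Euc N)) (u h : Euc N → ℝ)
    (ν : Measure (Euc N)) : Prop :=
  ∀ φ, TestFun Ω φ → (∫ x in Ω, u x * (-lap φ x)) + (∫ x in Ω, h x * φ x) + (∫ x, φ x ∂ν) =
    (∫ x, φ x ∂p) - ∫ x, φ x ∂n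

theorem integrableOn_mul_rho_of_abs_le {Ω : Set (Euc N)} {G h : Euc N → ℝ}
    (hGi : IntegrableOn (fun x => G x * rho Ω x) Ω)
    (hh : AEStronglyMeasurable h (volume.restrict Ω))
    (hle : ∀ᵐ x ∂volume.restrict Ω, |h x| ≤ G x) : IntegrableOn (fun x => h x * rho Ω x) Ω := by
  refine Integrable.mono hGi (hh.mul (continuous_rho Ω).aestronglyMeasurable) ?_
  filter_upwards [hle] with x hx
  rw [norm_mul, norm_mul]
  exact mul_le_mul_of_nonneg_right (hx.trans (le_abs_self _)) (norm_nonneg _)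

/-- One step of the monotone scheme: the defect measure is absorbed by the operator `-Δ + k`. -/
theorem exists_defect_step [NeZero N] {Ω : Set (Euc N)} (hΩ : IsBoundedC2Domain Ω)
    {p n ν : Measure (Euc N)} (hn : MemMrho Ω n) (hν : MemMrho Ω ν)
    {G U u : Euc N → ℝ} (hGm : AEStronglyMeasurable G (volume.restrict Ω))
    (hG0 : ∀ x, 0 ≤ G x) (hGi : IntegrableOn (fun x => G x * rho Ω x) Ω)
    (hU : IntegrableOn U Ω)
    (hUeq : ∀ φ, TestFun Ω φ → (∫ x in Ω, U x * (-lap φ x)) + (∫ x in Ω, G x * φ x) =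
      (∫ x, φ x ∂p) + ∫ x, φ x ∂n)
    {F₁ F₂ : Euc N → ℝ → ℝ} {k : ℕ}
    (hm₁ : ∀ w, AEStronglyMeasurable w (volume.restrict Ω) →
      AEStronglyMeasurable (fun x => F₁ x (w x)) (volume.restrict Ω))
    (hm₂ : ∀ w, AEStronglyMeasurable w (volume.restrict Ω) →
      AEStronglyMeasurable (fun x => F₂ x (w x)) (volume.restrict Ω))
    (hb₁ : ∀ x t, |F₁ x t| ≤ G x) (hb₂ : ∀ x t, |F₂ x t| ≤ G x)
    (hlip : ∀ x s t, s ≤ t → F₁ x t ≤ F₁ x s + k * (t - s))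
    (hanti : ∀ x t, F₂ x t ≤ F₁ x t) (hFU : ∀ x, G x ≤ F₁ x (U x))
    (hu : IntegrableOn u Ω) (huU : ∀ᵐ x ∂volume.restrict Ω, u x ≤ U x)
    (hueq : IsDefectSol Ω p n u (fun x => F₁ x (u x)) ν) :
    ∃ v : Euc N → ℝ, ∃ ν' : Measure (Euc N), IntegrableOn v Ω ∧
      (∀ᵐ x ∂volume.restrict Ω, 0 ≤ v x ∧ u x + v x ≤ U x) ∧
      (∀ φ, TestFun Ω φ → ∫ x in Ω, v x * (-lap φ x + k * φ x) = ∫ x, φ x ∂ν) ∧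
      MemMrho Ω ν' ∧ IsDefectSol Ω p n (fun x => u x + v x) (fun x => F₂ x (u x + v x)) ν' := by
  have hO := hΩ.1
  have hk0 : (0 : ℝ) ≤ k := k.cast_nonneg
  set w : Euc N → ℝ := fun x => U x - u x with hw
  have hwi : IntegrableOn w Ω := hU.sub hu
  have hw0 : ∀ᵐ x ∂volume.restrict Ω, 0 ≤ w x := huU.mono fun x hx => sub_nonneg.2 hx
  have hρ : ∀ {f : Euc N → ℝ}, IntegrableOn f Ω → IntegrableOn (fun x => f x * rho Ω x) Ω :=
    fun hf => integrableOn_mul_of_continuous hΩ hf (continuous_rho Ω)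
  have hF₁u := hm₁ u hu.aestronglyMeasurable
  have hF₁ui := integrableOn_mul_rho_of_abs_le hGi hF₁u (ae_of_all _ fun x => hb₁ x (u x))
  set r : Euc N → ℝ := fun x => F₁ x (u x) - G x + k * w x with hr
  have hr0 : ∀ᵐ x ∂volume.restrict Ω, 0 ≤ r x := by
    filter_upwards [huU] with x hx
    simp only [hr, hw]
    linarith [hlip x _ _ hx, hFU x]
  have hrm : AEMeasurable r (volume.restrict Ω) :=
    (hF₁u.aemeasurable.sub hGm.aemeasurable).add (hwi.aemeasurable.const_mul _)
  have hri : IntegrableOn (fun x => r x * rho Ω x) Ω := by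
    have h1 : IntegrableOn (fun x => F₁ x (u x) * rho Ω x - G x * rho Ω x +
      k * (w x * rho Ω x)) Ω := (hF₁ui.sub hGi).add ((hρ hwi).const_mul _)
    refine h1.congr (ae_of_all _ fun x => ?_)
    simp only [hr]; ring
  have hν₂ := memMrho_add (memMrho_add hn hn) (memMrho_withDensity hO hrm hri)
  obtain ⟨v, hvm, hvw, hv⟩ := exists_split hΩ hwi hw0 (c := fun _ => (k : ℝ)) measurable_const
    (fun _ => hk0) (fun _ => le_rfl) hν hν₂ fun φ hφ => by
      have i1 : IntegrableOn (fun x => U x * (-lap φ x)) Ω :=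
        integrableOn_mul_of_continuous hΩ hU (continuous_lap hφ.1).neg
      have i2 : IntegrableOn (fun x => u x * (-lap φ x)) Ω :=
        integrableOn_mul_of_continuous hΩ hu (continuous_lap hφ.1).neg
      have i3 : IntegrableOn (fun x => w x * φ x) Ω :=
        integrableOn_mul_of_continuous hΩ hwi hφ.1.continuous
      have i4 := integrableOn_mul_of_rho hΩ hF₁ui hφ
      have i5 := integrableOn_mul_of_rho hΩ hGi hφ
      have i12 : IntegrableOn (fun x => U x * (-lap φ x) - u x * (-lap φ x)) Ω := i1.sub i2
      have i45 : IntegrableOn (fun x => F₁ x (u x) * φ x - G x * φ x) Ω := i4.sub i5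
      have i3' : IntegrableOn (fun x => k * (w x * φ x)) Ω := i3.const_mul _
      have e1 : ∫ x in Ω, w x * (-lap φ x + k * φ x) =
          ∫ x in Ω, (U x * (-lap φ x) - u x * (-lap φ x) + k * (w x * φ x)) := by
        congr 1; ext x; simp only [hw]; ring
      have e2 : ∫ x in Ω, r x * φ x =
          ∫ x in Ω, (F₁ x (u x) * φ x - G x * φ x + k * (w x * φ x)) := by
        congr 1; ext x; simp only [hr]; ring
      have j1 := hφ.integrable hΩ hn
      have j2 := hφ.integrable hΩ (memMrho_withDensity hO hrm hri)
      rw [e1, integral_add i12 i3', integral_sub i1 i2,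
        integral_add_measure (j1.add_measure j1) j2, integral_add_measure j1 j1,
        integral_withDensity_ofReal hrm hr0, e2, integral_add i45 i3', integral_sub i4 i5]
      linarith [hUeq φ hφ, hueq φ hφ]
  have hvi : IntegrableOn v Ω := Integrable.mono hwi hvm (by
    filter_upwards [hvw] with x hx
    rw [Real.norm_eq_abs, abs_of_nonneg hx.1]
    exact hx.2.trans (le_abs_self _))
  have huv : IntegrableOn (fun x => u x + v x) Ω := hu.add hvi
  have hF₂m := hm₂ _ huv.aestronglyMeasurable
  have hF₂i := integrableOn_mul_rho_of_abs_le hGi hF₂m (ae_of_all _ fun x => hb₂ x (u x + v x))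
  set r' : Euc N → ℝ := fun x => k * v x - F₂ x (u x + v x) + F₁ x (u x) with hr'
  have hr'0 : ∀ᵐ x ∂volume.restrict Ω, 0 ≤ r' x := by
    filter_upwards [hvw] with x hx
    simp only [hr']
    linarith [hlip x (u x) (u x + v x) (by linarith), hanti x (u x + v x)]
  have hr'm : AEMeasurable r' (volume.restrict Ω) :=
    ((hvm.aemeasurable.const_mul _).sub hF₂m.aemeasurable).add hF₁u.aemeasurable
  have hr'i : IntegrableOn (fun x => r' x * rho Ω x) Ω := by
    have h1 : IntegrableOn (fun x => k * (v x * rho Ω x) - F₂ x (u x + v x) * rho Ω x +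
      F₁ x (u x) * rho Ω x) Ω := (((hρ hvi).const_mul _).sub hF₂i).add hF₁ui
    refine h1.congr (ae_of_all _ fun x => ?_)
    simp only [hr']; ring
  refine ⟨v, _, hvi, ?_, hv, memMrho_withDensity hO hr'm hr'i, fun φ hφ => ?_⟩
  · filter_upwards [hvw] with x hx
    refine ⟨hx.1, ?_⟩
    simp only [hw] at hx
    linarith
  · have i1 : IntegrableOn (fun x => u x * (-lap φ x)) Ω :=
      integrableOn_mul_of_continuous hΩ hu (continuous_lap hφ.1).neg
    have i2 : IntegrableOn (fun x => v x * (-lap φ x)) Ω :=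
      integrableOn_mul_of_continuous hΩ hvi (continuous_lap hφ.1).neg
    have i3 : IntegrableOn (fun x => v x * φ x) Ω :=
      integrableOn_mul_of_continuous hΩ hvi hφ.1.continuous
    have i3' : IntegrableOn (fun x => k * (v x * φ x)) Ω := i3.const_mul _
    have i4 := integrableOn_mul_of_rho hΩ hF₁ui hφ
    have i5 := integrableOn_mul_of_rho hΩ hF₂i hφ
    have i35 : IntegrableOn (fun x => k * (v x * φ x) - F₂ x (u x + v x) * φ x) Ω := i3'.sub i5
    have e1 : ∫ x in Ω, (u x + v x) * (-lap φ x) =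
        ∫ x in Ω, (u x * (-lap φ x) + v x * (-lap φ x)) := by
      congr 1; ext x; ring
    have e2 : ∫ x in Ω, r' x * φ x =
        ∫ x in Ω, (k * (v x * φ x) - F₂ x (u x + v x) * φ x + F₁ x (u x) * φ x) := by
      congr 1; ext x; simp only [hr']; ring
    have e3 : ∫ x in Ω, v x * (-lap φ x + k * φ x) =
        ∫ x in Ω, (v x * (-lap φ x) + k * (v x * φ x)) := by
      congr 1; ext x; ring
    have h1 := hv φ hφ
    rw [e3, integral_add i2 i3'] at h1
    rw [e1, integral_add i1 i2, integral_withDensity_ofReal hr'm hr'0, e2,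
      integral_add i35 i4, integral_sub i3' i5]
    linarith [hueq φ hφ]

theorem exists_seq_of_step {α : Type*} {P : ℕ → α → Prop} {R : ℕ → α → α → Prop} {a : α}
    (h0 : P 0 a) (hs : ∀ k s, P k s → ∃ s', P (k + 1) s' ∧ R k s s') :
    ∃ f : ℕ → α, f 0 = a ∧ ∀ k, P k (f k) ∧ R k (f k) (f (k + 1)) := by
  choose t ht hR using hs
  let F : ∀ k, {s // P k s} := fun k =>
    Nat.rec (motive := fun k => {s // P k s}) ⟨a, h0⟩ (fun k s => ⟨t k s.1 s.2, ht k s.1 s.2⟩) k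
  exact ⟨fun k => (F k).1, rfl, fun k => ⟨(F k).2, hR k (F k).1 (F k).2⟩⟩

theorem eq_zero_of_tendsto_of_le_mul_summable {D a : ℕ → ℝ} {d C : ℝ}
    (hD : Tendsto D atTop (𝓝 d)) (ha : Summable a) (hle : ∀ k, |D k| ≤ C * ((k + 1) * a k)) :
    d = 0 := by
  by_contra hd
  have hd' : 0 < |d| := abs_pos.2 hd
  have h1 : ∀ᶠ k in atTop, |d| / 2 < |D k| := hD.abs.eventually_const_lt (by linarith)
  have h2 : Summable fun k : ℕ => 1 / ((k : ℝ) + 1) := by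
    refine Summable.of_norm_bounded_eventually_nat (ha.mul_left (2 * C / |d|)) ?_
    filter_upwards [h1] with k hk
    have hk1 : (0 : ℝ) < k + 1 := by positivity
    rw [Real.norm_eq_abs, abs_of_nonneg (by positivity), div_le_iff₀ hk1]
    have h3 := hk.le.trans (hle k)
    have h4 : 2 * C / |d| * a k * (k + 1) = 2 * (C * ((k + 1) * a k)) / |d| := by
      field_simp
    rw [h4, le_div_iff₀ hd']
    linarith
  exact Real.not_summable_one_div_natCast ((summable_nat_add_iff 1).1 (by simpa using h2))

/-- Solvability of the equation whose nonlinearity is truncated at the barriers `±U`. -/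
theorem exists_truncated_solution [NeZero N] {Ω : Set (Euc N)} (hΩ : IsBoundedC2Domain Ω)
    {g : ℝ → ℝ} (hgc : Continuous g) (hodd : ∀ t, g (-t) = - g t) (hmono : Monotone g)
    (hg0 : g 0 = 0) {p n : Measure (Euc N)} (hp : MemMrho Ω p) (hn : MemMrho Ω n)
    {U : Euc N → ℝ} (hUm : Measurable U) (hU0 : ∀ x, 0 ≤ U x) (hU : IntegrableOn U Ω)
    (hGi : IntegrableOn (fun x => g (U x) * rho Ω x) Ω)
    (hUeq : ∀ φ, TestFun Ω φ → (∫ x in Ω, U x * (-lap φ x)) + (∫ x in Ω, g (U x) * φ x) =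
      (∫ x, φ x ∂p) + ∫ x, φ x ∂n) :
    ∃ u : Euc N → ℝ, IntegrableOn u Ω ∧ (∀ᵐ x ∂volume.restrict Ω, u x ≤ U x) ∧
      ∀ φ, TestFun Ω φ →
        (∫ x in Ω, u x * (-lap φ x)) + (∫ x in Ω, g (trunc (U x) (u x)) * φ x) =
          (∫ x, φ x ∂p) - ∫ x, φ x ∂n := by
  have hO := hΩ.1
  have hmem : ∀ᵐ x ∂volume.restrict Ω, x ∈ Ω := ae_restrict_mem hO.measurableSet
  set G : Euc N → ℝ := fun x => g (U x) with hGdef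
  have hGm : Measurable G := hgc.measurable.comp hUm
  have hG0 : ∀ x, 0 ≤ G x := fun x => by
    have := hmono (hU0 x); rwa [hg0] at this
  set H : Euc N → ℝ → ℝ := fun x s => g (trunc (U x) s) with hH
  have hHc : ∀ x, Continuous (H x) := fun x => hgc.comp (continuous_trunc _)
  have hHm : ∀ x, Monotone (H x) := fun x => hmono.comp (monotone_trunc _)
  have hHb : ∀ x t, |H x t| ≤ G x := fun x t => abs_comp_trunc_le hodd hmono (hU0 x) t
  have hHU : ∀ x, H x (U x) = G x := fun x => by
    simp only [hH]; rw [trunc_of_abs_le (abs_of_nonneg (hU0 x)).le]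
  set F : ℕ → Euc N → ℝ → ℝ := fun k x => lipEnv (H x) k with hF
  have hFm : ∀ k w, AEStronglyMeasurable w (volume.restrict Ω) →
      AEStronglyMeasurable (fun x => F k x (w x)) (volume.restrict Ω) := fun k w hw =>
    (measurable_lipEnv_trunc hgc hodd hmono hUm hU0 hw.stronglyMeasurable_mk.measurable
      k).aestronglyMeasurable.congr (hw.ae_eq_mk.mono fun x hx => by
        change lipEnv _ _ _ = lipEnv _ _ _
        rw [hx])
  have hFb : ∀ k x t, |F k x t| ≤ G x := fun k x t => abs_lipEnv_le (hHc x) (hHb x) k t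
  obtain ⟨E, hE, hE0, hEeq⟩ := exists_weak_poisson hΩ hGm hG0 hGi
  set L : Euc N → ℝ := fun x => -U x - 2 * E x with hL
  have hLi : IntegrableOn L Ω := hU.neg.sub (hE.const_mul 2)
  have hLU : ∀ᵐ x ∂volume.restrict Ω, L x ≤ U x := hE0.mono fun x hx => by
    simp only [hL]; linarith [hU0 x]
  have hF0m := hFm 0 L hLi.aestronglyMeasurable
  have hF0i := integrableOn_mul_rho_of_abs_le hGi hF0m (ae_of_all _ fun x => hFb 0 x (L x))
  set r : Euc N → ℝ := fun x => G x - F 0 x (L x) with hr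
  have hr0 : ∀ x, 0 ≤ r x := fun x => sub_nonneg.2 (abs_le.1 (hFb 0 x (L x))).2
  have hrm : AEMeasurable r (volume.restrict Ω) := hGm.aemeasurable.sub hF0m.aemeasurable
  have hri : IntegrableOn (fun x => r x * rho Ω x) Ω := by
    have h1 : IntegrableOn (fun x => G x * rho Ω x - F 0 x (L x) * rho Ω x) Ω := hGi.sub hF0i
    refine h1.congr (ae_of_all _ fun x => ?_)
    simp only [hr]; ring
  have hstart : IsDefectSol Ω p n L (fun x => F 0 x (L x))
      (p + p + (volume.restrict Ω).withDensity fun x => ENNReal.ofReal (r x)) := fun φ hφ => by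
    have j1 := hφ.integrable hΩ hp
    have j2 := hφ.integrable hΩ (memMrho_withDensity hO hrm hri)
    have i1 : IntegrableOn (fun x => U x * (-lap φ x)) Ω :=
      integrableOn_mul_of_continuous hΩ hU (continuous_lap hφ.1).neg
    have i2 : IntegrableOn (fun x => E x * (-lap φ x)) Ω :=
      integrableOn_mul_of_continuous hΩ hE (continuous_lap hφ.1).neg
    have i1' : IntegrableOn (fun x => -(U x * (-lap φ x))) Ω := i1.neg
    have i2' : IntegrableOn (fun x => 2 * (E x * (-lap φ x))) Ω := i2.const_mul 2
    have i4 := integrableOn_mul_of_rho hΩ hF0i hφ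
    have i5 := integrableOn_mul_of_rho hΩ hGi hφ
    have e1 : ∫ x in Ω, L x * (-lap φ x) =
        ∫ x in Ω, (-(U x * (-lap φ x)) - 2 * (E x * (-lap φ x))) := by
      congr 1; ext x; simp only [hL]; ring
    have e2 : ∫ x in Ω, r x * φ x = ∫ x in Ω, (G x * φ x - F 0 x (L x) * φ x) := by
      congr 1; ext x; simp only [hr]; ring
    rw [e1, integral_sub i1' i2', integral_neg, integral_const_mul,
      integral_add_measure (j1.add_measure j1) j2, integral_add_measure j1 j1,
      integral_withDensity_ofReal hrm (ae_of_all _ hr0), e2, integral_sub i5 i4]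
    linarith [hUeq φ hφ, hEeq φ hφ]
  obtain ⟨S, -, hS⟩ := exists_seq_of_step
    (P := fun k (s : (Euc N → ℝ) × Measure (Euc N)) => IntegrableOn s.1 Ω ∧
      (∀ᵐ x ∂volume.restrict Ω, s.1 x ≤ U x) ∧ MemMrho Ω s.2 ∧
      IsDefectSol Ω p n s.1 (fun x => F k x (s.1 x)) s.2)
    (R := fun k s s' => (∀ᵐ x ∂volume.restrict Ω, s.1 x ≤ s'.1 x) ∧
      ∀ φ, TestFun Ω φ → ∫ x in Ω, (s'.1 x - s.1 x) * (-lap φ x + k * φ x) = ∫ x, φ x ∂s.2)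
    (a := (L, _)) ⟨hLi, hLU, memMrho_add (memMrho_add hp hp) (memMrho_withDensity hO hrm hri),
      hstart⟩ fun k s ⟨hs1, hs2, hs3, hs4⟩ => by
      obtain ⟨v, ν', hvi, hv0, hv, hν', hsol⟩ := exists_defect_step hΩ hn hs3
        hGm.aestronglyMeasurable hG0 hGi hU hUeq (k := k) (hFm k) (hFm (k + 1)) (hFb k)
        (hFb (k + 1)) (fun x a b hab => lipEnv_le_add (hHb x) k hab)
        (fun x t => lipEnv_succ_le (hHb x) k t)
        (fun x => (hHU x).ge.trans (le_lipEnv (hHc x) (hHb x) k (U x))) hs1 hs2 hs4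
      refine ⟨(fun x => s.1 x + v x, ν'), ⟨hs1.add hvi, hv0.mono fun x hx => hx.2, hν', hsol⟩,
        hv0.mono fun x hx => by simpa using hx.1, fun φ hφ => ?_⟩
      simpa using hv φ hφ
  set u : ℕ → Euc N → ℝ := fun k => (S k).1 with hudef
  have hui : ∀ k, IntegrableOn (u k) Ω := fun k => (hS k).1.1
  have huU : ∀ᵐ x ∂volume.restrict Ω, ∀ k, u k x ≤ U x := ae_all_iff.2 fun k => (hS k).1.2.1
  have humono : ∀ᵐ x ∂volume.restrict Ω, Monotone fun k => u k x := by
    filter_upwards [ae_all_iff.2 fun k => (hS k).2.1] with x hx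
    exact monotone_nat_of_le_succ hx
  set w : Euc N → ℝ := fun x => ⨆ k, u k x with hw
  have hlim : ∀ᵐ x ∂volume.restrict Ω, Tendsto (fun k => u k x) atTop (𝓝 (w x)) := by
    filter_upwards [huU, humono] with x h1 h2
    exact tendsto_atTop_ciSup h2 ⟨U x, by rintro _ ⟨k, rfl⟩; exact h1 k⟩
  have hwm : AEStronglyMeasurable w (volume.restrict Ω) :=
    aestronglyMeasurable_of_tendsto_ae atTop (fun k => (hui k).aestronglyMeasurable) hlim
  have hwU : ∀ᵐ x ∂volume.restrict Ω, w x ≤ U x := by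
    filter_upwards [huU] with x h1 using ciSup_le h1
  have hub : ∀ᵐ x ∂volume.restrict Ω, ∀ k, |u k x| ≤ |u 0 x| + |U x| := by
    filter_upwards [huU, humono] with x h1 h2 k
    have h3 : u 0 x ≤ u k x := h2 k.zero_le
    exact abs_le.2 ⟨by linarith [neg_abs_le (u 0 x), abs_nonneg (U x)],
      by linarith [h1 k, le_abs_self (U x), abs_nonneg (u 0 x)]⟩
  have hdom : IntegrableOn (fun x => |u 0 x| + |U x|) Ω := (hui 0).abs.add hU.abs
  have hwi : IntegrableOn w Ω := Integrable.mono' hdom hwm (by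
    filter_upwards [hub, hlim] with x h1 h2
    exact le_of_tendsto' h2.abs h1)
  have hsum : Summable fun k => ∫ x in Ω, (u (k + 1) x - u k x) := by
    refine summable_of_sum_range_le (c := (∫ x in Ω, U x) - ∫ x in Ω, u 0 x) (fun k =>
      integral_nonneg_of_ae ((hS k).2.1.mono fun x hx => sub_nonneg.2 hx)) fun m => ?_
    simp only [integral_sub (hui _) (hui _)]
    rw [Finset.sum_range_sub fun k => ∫ x in Ω, u k x]
    exact sub_le_sub_right (integral_mono_ae (hui m) hU (huU.mono fun x hx => hx m)) _
  refine ⟨w, hwi, hwU, fun φ hφ => ?_⟩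
  obtain ⟨A, hA0, hA⟩ := exists_bound_of_continuous (continuous_lap hφ.1) hΩ.2.2.1
  obtain ⟨B, hB0, hB⟩ := exists_bound_of_continuous hφ.1.continuous hΩ.2.2.1
  have l1 : Tendsto (fun k => ∫ x in Ω, u k x * (-lap φ x)) atTop
      (𝓝 (∫ x in Ω, w x * (-lap φ x))) := by
    refine tendsto_integral_of_dominated_convergence (fun x => (|u 0 x| + |U x|) * A)
      (fun k => (integrableOn_mul_of_continuous hΩ (hui k)
        (continuous_lap hφ.1).neg).aestronglyMeasurable)
      (hdom.mul_const A) (fun k => ?_) (hlim.mono fun x hx => hx.mul_const _)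
    filter_upwards [hub, hmem] with x h1 hx
    rw [norm_mul, norm_neg]
    exact mul_le_mul (h1 k) (hA x hx) (norm_nonneg _) (by positivity)
  have l2 : Tendsto (fun k => ∫ x in Ω, F k x (u k x) * φ x) atTop
      (𝓝 (∫ x in Ω, H x (w x) * φ x)) := by
    have hGφ := integrableOn_mul_of_rho hΩ hGi hφ
    refine tendsto_integral_of_dominated_convergence (fun x => ‖G x * φ x‖)
      (fun k => (hFm k _ (hui k).aestronglyMeasurable).mul
        hφ.1.continuous.aestronglyMeasurable) hGφ.norm (fun k => ae_of_all _ fun x => ?_)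
      (hlim.mono fun x hx => (tendsto_lipEnv (hHc x) (hHm x) (hHb x) hx).mul_const _)
    rw [norm_mul, norm_mul]
    exact mul_le_mul_of_nonneg_right ((hFb k x _).trans (le_abs_self _)) (norm_nonneg _)
  have hz := eq_zero_of_tendsto_of_le_mul_summable (C := A + B)
    ((l1.add l2).sub_const ((∫ x, φ x ∂p) - ∫ x, φ x ∂n)) hsum fun k => by
      have h1 := (hS k).1.2.2.2 φ hφ
      have h2 := (hS k).2.2 φ hφ
      have h3 : (∫ x in Ω, u k x * (-lap φ x)) + (∫ x in Ω, F k x (u k x) * φ x) -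
          ((∫ x, φ x ∂p) - ∫ x, φ x ∂n) =
          -∫ x in Ω, (u (k + 1) x - u k x) * (-lap φ x + k * φ x) := by
        simp only [hudef]
        linarith
      rw [h3, abs_neg, ← integral_const_mul, ← integral_const_mul]
      refine (abs_integral_le_integral_abs).trans (integral_mono_of_nonneg
        (ae_of_all _ fun x => abs_nonneg _)
        ((((hui (k + 1)).sub (hui k)).const_mul _).const_mul _) ?_)
      filter_upwards [hmem, (hS k).2.1] with x hx h4
      have h5 : 0 ≤ u (k + 1) x - u k x := sub_nonneg.2 h4
      have hk : (0 : ℝ) ≤ k := k.cast_nonneg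
      have h6 : |-lap φ x + k * φ x| ≤ (A + B) * (k + 1) := by
        refine (abs_add_le _ _).trans ?_
        rw [abs_neg, abs_mul, abs_of_nonneg hk]
        have := mul_le_mul_of_nonneg_left (hB x hx) hk
        nlinarith [hA x hx, mul_nonneg hA0 hk]
      change |(u (k + 1) x - u k x) * (-lap φ x + k * φ x)| ≤
        (A + B) * ((k + 1) * (u (k + 1) x - u k x))
      rw [abs_mul, abs_of_nonneg h5]
      exact (mul_le_mul_of_nonneg_left h6 h5).trans_eq (by ring)
  exact sub_eq_zero.1 hz

theorem integral_neg_mul_lap_add [NeZero N] {Ω : Set (Euc N)} (hΩ : IsBoundedC2Domain Ω)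
    {u h φ : Euc N → ℝ} (hu : IntegrableOn u Ω) (hh : IntegrableOn (fun x => h x * rho Ω x) Ω)
    (hφ : TestFun Ω φ) :
    ∫ x in Ω, (-(u x) * lap φ x + h x * φ x) =
      (∫ x in Ω, u x * (-lap φ x)) + ∫ x in Ω, h x * φ x := by
  have i1 : IntegrableOn (fun x => u x * (-lap φ x)) Ω :=
    integrableOn_mul_of_continuous hΩ hu (continuous_lap hφ.1).neg
  rw [← integral_add i1 (integrableOn_mul_of_rho hΩ hh hφ)]
  congr 1; ext x; ring

theorem abs_eq_comp_abs {g : ℝ → ℝ} (hodd : ∀ t, g (-t) = - g t) (hmono : Monotone g)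
    (hg0 : g 0 = 0) (t : ℝ) : |g t| = g |t| := by
  rcases le_total 0 t with h | h
  · rw [abs_of_nonneg h, abs_of_nonneg (hg0 ▸ hmono h)]
  · rw [abs_of_nonpos h, abs_of_nonpos (hg0 ▸ hmono h), hodd]

theorem IsWeakSol.exists_nonneg [NeZero N] {Ω : Set (Euc N)} (hΩ : IsBoundedC2Domain Ω)
    {g : ℝ → ℝ} (hgc : Continuous g) (hodd : ∀ t, g (-t) = - g t) (hmono : Monotone g)
    (hg0 : g 0 = 0) {ω : Measure (Euc N)} (hω : MemMrho Ω ω) {u : Euc N → ℝ}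
    (hu : IsWeakSol Ω g ω 0 u) :
    ∃ U : Euc N → ℝ, Measurable U ∧ (∀ x, 0 ≤ U x) ∧ IntegrableOn U Ω ∧
      IntegrableOn (fun x => g (U x) * rho Ω x) Ω ∧
      ∀ φ, TestFun Ω φ →
        (∫ x in Ω, U x * (-lap φ x)) + (∫ x in Ω, g (U x) * φ x) = ∫ x, φ x ∂ω := by
  obtain ⟨hui, hgi, heq⟩ := hu
  have hgm : AEStronglyMeasurable (fun x => g (u x)) (volume.restrict Ω) :=
    hgc.comp_aestronglyMeasurable hui.aestronglyMeasurable
  have hgi' : IntegrableOn (fun x => g (u x) * rho Ω x) Ω :=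
    integrableOn_mul_rho_of_abs_le hgi hgm
      (ae_of_all _ fun x => (abs_eq_comp_abs hodd hmono hg0 _).le)
  have heq' : ∀ φ, TestFun Ω φ →
      (∫ x in Ω, u x * (-lap φ x)) + (∫ x in Ω, g (u x) * φ x) = ∫ x, φ x ∂ω := fun φ hφ => by
    rw [← integral_neg_mul_lap_add hΩ hui hgi' hφ, (heq φ hφ).2.2]
    simp
  have hu0 : ∀ᵐ x ∂volume.restrict Ω, -u x ≤ 0 := by
    refine ae_nonpos_of_weak_subsolution hΩ hui.neg hgm hgi' hω (fun φ hφ => ?_)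
      (ae_of_all _ fun x hx => ?_)
    · have : ∫ x in Ω, -u x * (-lap φ x) = -∫ x in Ω, u x * (-lap φ x) := by
        rw [← integral_neg]; congr 1; ext x; ring
      rw [this, ← heq' φ hφ]
      ring
    · have h1 : u x ≤ 0 := by simpa using hx
      exact hg0 ▸ hmono h1
  have hae : ∀ᵐ x ∂volume.restrict Ω, max (hui.aestronglyMeasurable.mk u x) 0 = u x := by
    filter_upwards [hu0, hui.aestronglyMeasurable.ae_eq_mk] with x h1 h2
    rw [← h2, max_eq_left (by linarith)]
  refine ⟨fun x => max (hui.aestronglyMeasurable.mk u x) 0,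
    hui.aestronglyMeasurable.stronglyMeasurable_mk.measurable.max measurable_const,
    fun x => le_max_right _ _, hui.congr (hae.mono fun x hx => hx.symm),
    hgi'.congr (hae.mono fun x hx => by simp only [hx]), fun φ hφ => ?_⟩
  rw [← heq' φ hφ]
  congr 1
  · exact integral_congr_ae (hae.mono fun x hx => by simp only [hx])
  · exact integral_congr_ae (hae.mono fun x hx => by simp only [hx])

theorem exists_weakSol_of_add [NeZero N] {Ω : Set (Euc N)} (hΩ : IsBoundedC2Domain Ω)
    {g : ℝ → ℝ} (hgc : Continuous g) (hodd : ∀ t, g (-t) = - g t) (hmono : Monotone g)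
    (hg0 : g 0 = 0) {p n : Measure (Euc N)} (hp : MemMrho Ω p) (hn : MemMrho Ω n)
    (h : ∃ u, IsWeakSol Ω g (p + n) 0 u) : ∃ u, IsWeakSol Ω g p n u := by
  obtain ⟨u₀, hu₀⟩ := h
  obtain ⟨U, hUm, hU0, hU, hGi, hUeq'⟩ :=
    hu₀.exists_nonneg hΩ hgc hodd hmono hg0 (memMrho_add hp hn)
  have hUeq : ∀ φ, TestFun Ω φ →
      (∫ x in Ω, U x * (-lap φ x)) + (∫ x in Ω, g (U x) * φ x) =
        (∫ x, φ x ∂p) + ∫ x, φ x ∂n := fun φ hφ => by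
    rw [hUeq' φ hφ, integral_add_measure (hφ.integrable hΩ hp) (hφ.integrable hΩ hn)]
  obtain ⟨u, hu, huU, hueq⟩ :=
    exists_truncated_solution hΩ hgc hodd hmono hg0 hp hn hUm hU0 hU hGi hUeq
  have hGm : AEStronglyMeasurable (fun x => g (U x)) (volume.restrict Ω) :=
    (hgc.measurable.comp hUm).aestronglyMeasurable
  have hHm : AEStronglyMeasurable (fun x => g (trunc (U x) (u x))) (volume.restrict Ω) := by
    have hm := hu.aemeasurable
    have h1 : AEMeasurable (fun x => max (-U x) (min (U x) (u x))) (volume.restrict Ω) :=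
      hUm.aemeasurable.neg.max (hUm.aemeasurable.min hm)
    exact hgc.comp_aestronglyMeasurable h1.aestronglyMeasurable
  have hHi : IntegrableOn (fun x => g (trunc (U x) (u x)) * rho Ω x) Ω :=
    integrableOn_mul_rho_of_abs_le hGi hHm
      (ae_of_all _ fun x => abs_comp_trunc_le hodd hmono (hU0 x) _)
  have hlow : ∀ᵐ x ∂volume.restrict Ω, -U x - u x ≤ 0 := by
    refine ae_nonpos_of_weak_subsolution hΩ (z := fun x => -U x - u x)
      (f := fun x => g (U x) + g (trunc (U x) (u x))) (hU.neg.sub hu) (hGm.add hHm) ?_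
      (memMrho_add hp hp) (fun φ hφ => ?_) (ae_of_all _ fun x hx => ?_)
    · refine (hGi.add hHi).congr (ae_of_all _ fun x => ?_)
      simp only [Pi.add_apply]; ring
    · have i1 : IntegrableOn (fun x => U x * (-lap φ x)) Ω :=
        integrableOn_mul_of_continuous hΩ hU (continuous_lap hφ.1).neg
      have i2 : IntegrableOn (fun x => u x * (-lap φ x)) Ω :=
        integrableOn_mul_of_continuous hΩ hu (continuous_lap hφ.1).neg
      have i1' : IntegrableOn (fun x => -(U x * (-lap φ x))) Ω := i1.neg
      have i3 := integrableOn_mul_of_rho hΩ hGi hφ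
      have i4 := integrableOn_mul_of_rho hΩ hHi hφ
      have j := hφ.integrable hΩ hp
      have e1 : ∫ x in Ω, (-U x - u x) * (-lap φ x) =
          ∫ x in Ω, (-(U x * (-lap φ x)) - u x * (-lap φ x)) := by
        congr 1; ext x; ring
      rw [e1, integral_sub i1' i2, integral_neg, integral_add_measure j j]
      simp only [add_mul]
      rw [integral_add i3 i4]
      linarith [hUeq φ hφ, hueq φ hφ]
    · rw [trunc_of_le_neg (by linarith), hodd, add_neg_cancel]
  have habs : ∀ᵐ x ∂volume.restrict Ω, |u x| ≤ U x := by
    filter_upwards [huU, hlow] with x h1 h2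
    exact abs_le.2 ⟨by linarith, h1⟩
  have hgm : AEStronglyMeasurable (fun x => g |u x|) (volume.restrict Ω) :=
    (hgc.comp continuous_abs).comp_aestronglyMeasurable hu.aestronglyMeasurable
  have heq : ∀ᵐ x ∂volume.restrict Ω, g (trunc (U x) (u x)) = g (u x) :=
    habs.mono fun x hx => by rw [trunc_of_abs_le hx]
  refine ⟨u, hu, integrableOn_mul_rho_of_abs_le hGi hgm (habs.mono fun x hx => ?_),
    fun φ hφ => ⟨hφ.integrable hΩ hp, hφ.integrable hΩ hn, ?_⟩⟩
  · rw [abs_of_nonneg (hg0 ▸ hmono (abs_nonneg (u x)))]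
    exact hmono hx
  · have hgi : IntegrableOn (fun x => g (u x) * rho Ω x) Ω :=
      hHi.congr (heq.mono fun x hx => by simp only [hx])
    rw [integral_neg_mul_lap_add hΩ hu hgi hφ, ← hueq φ hφ]
    congr 1
    exact integral_congr_ae (heq.mono fun x hx => by simp only [hx])

theorem IsWeakSol.neg {Ω : Set (Euc N)} {g : ℝ → ℝ} (hodd : ∀ t, g (-t) = - g t)
    {p n : Measure (Euc N)} {u : Euc N → ℝ} (hu : IsWeakSol Ω g p n u) :
    IsWeakSol Ω g n p (fun x => -u x) := by
  refine ⟨hu.1.neg, by simpa only [abs_neg] using hu.2.1, fun φ hφ => ?_⟩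
  obtain ⟨h1, h2, h3⟩ := hu.2.2 φ hφ
  refine ⟨h2, h1, ?_⟩
  rw [← neg_sub, ← h3, ← integral_neg]
  congr 1; ext x; rw [hodd]; ring

theorem MeasureTheory.Measure.MutuallySingular.eq_zero_or_eq_zero {α : Type*} [MeasurableSpace α]
    [Subsingleton α] {p n : Measure α} (h : p.MutuallySingular n) : p = 0 ∨ n = 0 := by
  obtain ⟨s, -, h1, h2⟩ := h
  rcases s.eq_empty_or_nonempty with rfl | hs
  · right
    simpa using h2
  · left
    rw [hs.eq_univ] at h1
    simpa using h1

/-- If `μ ∈ 𝔐_ρ(Ω)` and `|μ| = μ⁺ + μ⁻` is `g`-good, then `μ` is `g`-good. -/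
theorem good_of_abs_good
    {N : ℕ} (Ω : Set (Euc N)) (hΩ : IsBoundedC2Domain Ω)
    (g : ℝ → ℝ) (hgc : Continuous g) (hodd : ∀ t, g (-t) = - g t)
    (hmono : Monotone g) (hg0 : g 0 = 0)
    (μ : SignedRho Ω)
    (habs : ∃ u : Euc N → ℝ, IsWeakSol Ω g (μ.pos + μ.neg) 0 u) :
    ∃ u : Euc N → ℝ, IsWeakSol Ω g μ.pos μ.neg u := by
  rcases Nat.eq_zero_or_pos N with rfl | hN
  · obtain ⟨u, hu⟩ := habs
    rcases μ.singular.eq_zero_or_eq_zero with h | h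
    · rw [h, zero_add] at hu
      exact ⟨_, by rw [h]; exact hu.neg hodd⟩
    · rw [h, add_zero] at hu
      exact ⟨u, by rwa [h]⟩
  · haveI : NeZero N := ⟨hN.ne'⟩
    exact exists_weakSol_of_add hΩ hgc hodd hmono hg0 μ.pos_mem μ.neg_mem habs

end
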